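/- arXiv:2310.17709 — 10 statements merged into one kernel-verified Lean document; each statement's English description precedes it below -/
import Mathlib

section
/- Finite-time singularity (Theorem 1.1, reduced Calabi-symmetry form): There exist an integer n ≥ 2, a real R > 1 with a = 6R, a smooth function σ : [1,a] → ℝ satisfying 0 ≤ σ(x) < R on [1,a] and σ(x) ≥ k(x−1)(a−x) for some k > 0 (so σ(1) = σ(a) = 0), reals p > a and q, and a smooth function f₀ : [1,a] → ℝ with f₀(1) = q and f₀(a) = p, such that there is NO smooth function f : [0, R/4] × [1,a] → ℝ solving ∂_t f = σ(x)·( (∂_xx f)/(1 + (∂_x f)²) + (n−1)·(x·∂_x f − f)/(x² + f²) ) with f(0,·) = f₀. In other words, every smooth solution with initial data f₀ exists only on a time interval [0,T) with T ≤ R/4. -/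
open Real Set

/-- The right-hand side of the reduced line bundle mean curvature flow under Calabi symmetry:
`σ(x)·( f_xx/(1+f_x²) + (n−1)·(x f_x − f)/(x² + f²) )`, with spatial derivatives taken
within the interval `[1,a]`. -/
noncomputable def flowRHS (n : ℕ) (a : ℝ) (σ : ℝ → ℝ) (f : ℝ → ℝ → ℝ) (t x : ℝ) : ℝ :=
  σ x * (derivWithin (derivWithin (f t) (Icc 1 a)) (Icc 1 a) x /
      (1 + (derivWithin (f t) (Icc 1 a) x) ^ 2) +
    ((n : ℝ) - 1) * (x * derivWithin (f t) (Icc 1 a) x - f t x) / (x ^ 2 + (f t x) ^ 2))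

/-- Fundamental theorem of calculus for one-sided derivatives on a closed interval. -/
lemma integral_eq_sub_of_hasDerivWithinAt_Icc {c d : ℝ} (hcd : c ≤ d) {u u' : ℝ → ℝ}
    (hu : ∀ x ∈ Icc c d, HasDerivWithinAt u (u' x) (Icc c d) x)
    (hu' : ContinuousOn u' (Icc c d)) : ∫ x in c..d, u' x = u d - u c := by
  refine intervalIntegral.integral_eq_sub_of_hasDerivAt_of_le hcd
    (fun x hx => (hu x hx).continuousWithinAt) (fun x hx => ?_)
    (hu'.intervalIntegrable_of_Icc hcd)
  exact (hu x (Ioo_subset_Icc_self hx)).hasDerivAt (Icc_mem_nhds hx.1 hx.2)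

lemma ContinuousOn.slice_right {A B : Set ℝ} {u : ℝ × ℝ → ℝ} (hu : ContinuousOn u (A ×ˢ B))
    {t : ℝ} (ht : t ∈ A) : ContinuousOn (fun x => u (t, x)) B :=
  hu.comp (by fun_prop) fun _ hx => ⟨ht, hx⟩

lemma ContinuousOn.slice_left {A B : Set ℝ} {u : ℝ × ℝ → ℝ} (hu : ContinuousOn u (A ×ˢ B))
    {x : ℝ} (hx : x ∈ B) : ContinuousOn (fun t => u (t, x)) A :=
  hu.comp (by fun_prop) fun _ ht => ⟨ht, hx⟩

open MeasureTheory in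
/-- If the spatial integral of the time derivative is at most `B`, then the spatial integral
grows at rate at most `B`. -/
lemma integral_le_add_of_integral_deriv_le {T c d B : ℝ} (hT : 0 ≤ T) (hcd : c ≤ d)
    {u u' : ℝ × ℝ → ℝ}
    (hu : ContinuousOn u (Icc 0 T ×ˢ Icc c d))
    (hu' : ContinuousOn u' (Icc 0 T ×ˢ Icc c d))
    (hd : ∀ t ∈ Icc 0 T, ∀ x ∈ Icc c d,
      HasDerivWithinAt (fun s => u (s, x)) (u' (t, x)) (Icc 0 T) t)
    (hB : ∀ t ∈ Icc 0 T, ∫ x in c..d, u' (t, x) ≤ B) :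
    ∫ x in c..d, u (T, x) ≤ (∫ x in c..d, u (0, x)) + B * T := by
  have h0 : (0 : ℝ) ∈ Icc 0 T := ⟨le_rfl, hT⟩
  have h1 : T ∈ Icc 0 T := ⟨hT, le_rfl⟩
  have hint : IntegrableOn (Function.uncurry fun t x => u' (t, x))
      (Icc 0 T ×ˢ Icc c d) (volume.prod volume) := by
    have := hu'.integrableOn_compact (μ := volume) (isCompact_Icc.prod isCompact_Icc)
    exact this
  have hswap : ∫ t in (0 : ℝ)..T, ∫ x in c..d, u' (t, x) =
      ∫ x in c..d, ∫ t in (0 : ℝ)..T, u' (t, x) := by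
    refine intervalIntegral_intervalIntegral_swap ?_
    refine IntegrableOn.mono_set hint (prod_mono ?_ ?_)
    · rw [uIoc_of_le hT]; exact Ioc_subset_Icc_self
    · rw [uIoc_of_le hcd]; exact Ioc_subset_Icc_self
  have hftc : ∫ x in c..d, ∫ t in (0 : ℝ)..T, u' (t, x) =
      (∫ x in c..d, u (T, x)) - ∫ x in c..d, u (0, x) := by
    rw [← intervalIntegral.integral_sub
      ((hu.slice_right h1).intervalIntegrable_of_Icc hcd)
      ((hu.slice_right h0).intervalIntegrable_of_Icc hcd)]
    refine intervalIntegral.integral_congr fun x hx => ?_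
    rw [uIcc_of_le hcd] at hx
    exact integral_eq_sub_of_hasDerivWithinAt_Icc hT (fun t ht => hd t ht x hx)
      (hu'.slice_left hx)
  have hle : ∫ t in (0 : ℝ)..T, ∫ x in c..d, u' (t, x) ≤ B * T := by
    have hii : IntervalIntegrable (fun t => ∫ x in c..d, u' (t, x)) volume 0 T := by
      rw [intervalIntegrable_iff_integrableOn_Ioc_of_le hT]
      simp_rw [intervalIntegral.integral_of_le hcd]
      have h2 : Integrable (Function.uncurry fun t x => u' (t, x))
          ((volume.restrict (Ioc 0 T)).prod (volume.restrict (Ioc c d))) := by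
        rw [Measure.prod_restrict]
        exact hint.mono_set (prod_mono Ioc_subset_Icc_self Ioc_subset_Icc_self)
      exact h2.integral_prod_left
    calc _ ≤ ∫ _ in (0 : ℝ)..T, B :=
          intervalIntegral.integral_mono_on hT hii (by simp) hB
      _ = B * T := by simp [mul_comm]
  linarith

lemma hasDerivAt_sqrt_sq_add_sq {ε : ℝ} (hε : 0 < ε) (s : ℝ) :
    HasDerivAt (fun s => √(s ^ 2 + ε ^ 2)) (s / √(s ^ 2 + ε ^ 2)) s := by
  have hp : 0 < s ^ 2 + ε ^ 2 := by positivity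
  convert ((hasDerivAt_pow 2 s).add_const (ε ^ 2)).sqrt hp.ne' using 1
  rw [div_eq_div_iff (by positivity) (by positivity)]
  push_cast; ring

lemma hasDerivAt_div_sqrt_sq_add_sq {ε : ℝ} (hε : 0 < ε) (s : ℝ) :
    HasDerivAt (fun s => s / √(s ^ 2 + ε ^ 2)) (ε ^ 2 / √(s ^ 2 + ε ^ 2) ^ 3) s := by
  have hp : 0 < s ^ 2 + ε ^ 2 := by positivity
  have hr : 0 < √(s ^ 2 + ε ^ 2) := Real.sqrt_pos.2 hp
  have hs := Real.sq_sqrt hp.le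
  refine ((hasDerivAt_id' s).div (hasDerivAt_sqrt_sq_add_sq hε s) hr.ne').congr_deriv ?_
  field_simp
  rw [hs]; ring

/-- The total variation does not increase: the case of a conservation law `h_t = P_x` whose flux
vanishes at the endpoints and is dissipative up to a quadratic error in `h`. -/
lemma integral_abs_le_of_dissipative {T a C : ℝ} (hT : 0 ≤ T) (ha : 1 ≤ a) (hC : 0 ≤ C)
    {h hx P Px : ℝ × ℝ → ℝ}
    (ch : ContinuousOn h (Icc 0 T ×ˢ Icc 1 a)) (chx : ContinuousOn hx (Icc 0 T ×ˢ Icc 1 a))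
    (cP : ContinuousOn P (Icc 0 T ×ˢ Icc 1 a)) (cPx : ContinuousOn Px (Icc 0 T ×ˢ Icc 1 a))
    (dh : ∀ t ∈ Icc 0 T, ∀ x ∈ Icc 1 a,
      HasDerivWithinAt (fun y => h (t, y)) (hx (t, x)) (Icc 1 a) x)
    (dP : ∀ t ∈ Icc 0 T, ∀ x ∈ Icc 1 a,
      HasDerivWithinAt (fun y => P (t, y)) (Px (t, x)) (Icc 1 a) x)
    (dt : ∀ t ∈ Icc 0 T, ∀ x ∈ Icc 1 a,
      HasDerivWithinAt (fun s => h (s, x)) (Px (t, x)) (Icc 0 T) t)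
    (hP1 : ∀ t ∈ Icc 0 T, P (t, 1) = 0) (hPa : ∀ t ∈ Icc 0 T, P (t, a) = 0)
    (hdis : ∀ p ∈ Icc 0 T ×ˢ Icc 1 a, -(hx p * P p) ≤ C * h p ^ 2) :
    ∫ x in (1 : ℝ)..a, |h (T, x)| ≤ ∫ x in (1 : ℝ)..a, |h (0, x)| := by
  have h0 : (0 : ℝ) ∈ Icc 0 T := ⟨le_rfl, hT⟩
  have h1 : T ∈ Icc 0 T := ⟨hT, le_rfl⟩
  have key : ∀ ε : ℝ, 0 < ε → ∫ x in (1 : ℝ)..a, |h (T, x)| ≤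
      (∫ x in (1 : ℝ)..a, |h (0, x)|) + ε * ((a - 1) * (1 + C * T)) := by
    intro ε hε
    have hpos : ∀ s : ℝ, 0 < √(s ^ 2 + ε ^ 2) := fun s => Real.sqrt_pos.2 (by positivity)
    have cη : ContinuousOn (fun p => √(h p ^ 2 + ε ^ 2)) (Icc 0 T ×ˢ Icc 1 a) := by fun_prop
    have cη' : ContinuousOn (fun p => h p / √(h p ^ 2 + ε ^ 2)) (Icc 0 T ×ˢ Icc 1 a) :=
      ch.div cη fun p _ => (hpos _).ne'
    have cη'' : ContinuousOn (fun p => ε ^ 2 / √(h p ^ 2 + ε ^ 2) ^ 3)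
        (Icc 0 T ×ˢ Icc 1 a) :=
      continuousOn_const.div (cη.pow 3) fun p _ => (pow_pos (hpos _) 3).ne'
    have cu : ContinuousOn (fun p => h p / √(h p ^ 2 + ε ^ 2) * Px p) (Icc 0 T ×ˢ Icc 1 a) :=
      cη'.mul cPx
    have cv : ContinuousOn (fun p => ε ^ 2 / √(h p ^ 2 + ε ^ 2) ^ 3 * hx p * P p)
        (Icc 0 T ×ˢ Icc 1 a) := (cη''.mul chx).mul cP
    have main := integral_le_add_of_integral_deriv_le (B := C * ε * (a - 1)) hT ha
      (u := fun p => √(h p ^ 2 + ε ^ 2)) (u' := fun p => h p / √(h p ^ 2 + ε ^ 2) * Px p)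
      cη cu
      (fun t ht x hx' =>
        HasDerivAt.comp_hasDerivWithinAt (h₂ := fun s => √(s ^ 2 + ε ^ 2)) t
          (hasDerivAt_sqrt_sq_add_sq hε (h (t, x))) (dt t ht x hx'))
      (fun t ht => by
        have hz : ∫ x in (1 : ℝ)..a, (ε ^ 2 / √(h (t, x) ^ 2 + ε ^ 2) ^ 3 * hx (t, x) * P (t, x)
            + h (t, x) / √(h (t, x) ^ 2 + ε ^ 2) * Px (t, x)) = 0 := by
          refine (integral_eq_sub_of_hasDerivWithinAt_Icc ha
            (u := fun x => h (t, x) / √(h (t, x) ^ 2 + ε ^ 2) * P (t, x))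
            (fun x hx' => (HasDerivAt.comp_hasDerivWithinAt
              (h₂ := fun s => s / √(s ^ 2 + ε ^ 2)) x
              (hasDerivAt_div_sqrt_sq_add_sq hε (h (t, x))) (dh t ht x hx')).mul
              (dP t ht x hx'))
            ((cv.slice_right ht).add (cu.slice_right ht))).trans ?_
          simp [hP1 t ht, hPa t ht]
        rw [intervalIntegral.integral_add ((cv.slice_right ht).intervalIntegrable_of_Icc ha)
          ((cu.slice_right ht).intervalIntegrable_of_Icc ha)] at hz
        have hle : ∫ x in (1 : ℝ)..a,
            -(ε ^ 2 / √(h (t, x) ^ 2 + ε ^ 2) ^ 3 * hx (t, x) * P (t, x)) ≤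
            ∫ _ in (1 : ℝ)..a, C * ε := by
          refine intervalIntegral.integral_mono_on ha
            ((cv.slice_right ht).neg.intervalIntegrable_of_Icc ha) (by simp) fun x hx' => ?_
          have hd := hdis (t, x) ⟨ht, hx'⟩
          set s := h (t, x)
          set r := √(s ^ 2 + ε ^ 2) with hr
          have hrp : 0 < r := hpos s
          have hsq : r ^ 2 = s ^ 2 + ε ^ 2 := Real.sq_sqrt (by positivity)
          have hεr : ε ≤ r := by nlinarith [sq_nonneg s]
          calc _ = ε ^ 2 / r ^ 3 * -(hx (t, x) * P (t, x)) := by ring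
            _ ≤ ε ^ 2 / r ^ 3 * (C * s ^ 2) := by gcongr
            _ ≤ C * ε := by
              rw [div_mul_eq_mul_div, div_le_iff₀ (by positivity)]
              have e1 : s ^ 2 ≤ r ^ 2 := by nlinarith
              have e2 : ε * s ^ 2 ≤ r * r ^ 2 := by gcongr
              nlinarith [mul_le_mul_of_nonneg_left e2 (mul_nonneg hC hε.le)]
        rw [intervalIntegral.integral_neg] at hle
        have : ∫ _ in (1 : ℝ)..a, C * ε = C * ε * (a - 1) := by
          simp only [intervalIntegral.integral_const, smul_eq_mul]; ring
        linarith)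
    have lo : ∫ x in (1 : ℝ)..a, |h (T, x)| ≤ ∫ x in (1 : ℝ)..a, √(h (T, x) ^ 2 + ε ^ 2) := by
      refine intervalIntegral.integral_mono_on ha
        ((ch.slice_right h1).abs.intervalIntegrable_of_Icc ha)
        ((cη.slice_right h1).intervalIntegrable_of_Icc ha) fun x _ => ?_
      exact Real.abs_le_sqrt (by nlinarith [sq_nonneg ε])
    have up : ∫ x in (1 : ℝ)..a, √(h (0, x) ^ 2 + ε ^ 2) ≤
        ∫ x in (1 : ℝ)..a, (|h (0, x)| + ε) := by
      refine intervalIntegral.integral_mono_on ha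
        ((cη.slice_right h0).intervalIntegrable_of_Icc ha)
        (((ch.slice_right h0).abs.add continuousOn_const).intervalIntegrable_of_Icc ha)
        fun x _ => ?_
      refine Real.sqrt_le_iff.2 ⟨by positivity, ?_⟩
      nlinarith [sq_abs (h (0, x)), abs_nonneg (h (0, x))]
    rw [intervalIntegral.integral_add ((ch.slice_right h0).abs.intervalIntegrable_of_Icc ha)
      (by simp)] at up
    simp only [intervalIntegral.integral_const, smul_eq_mul] at up
    nlinarith
  refine le_of_forall_pos_le_add fun δ hδ => ?_
  have hq : 0 < (a - 1) * (1 + C * T) + 1 := by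
    have : 0 ≤ (a - 1) * (1 + C * T) := mul_nonneg (by linarith) (by positivity)
    linarith
  refine (key (δ / ((a - 1) * (1 + C * T) + 1)) (by positivity)).trans ?_
  gcongr
  rw [div_mul_eq_mul_div, div_le_iff₀ hq]
  nlinarith

/-- A bump function supported in `[-2, -1]`, its first two derivatives `W₁`, `W₂`, and the
primitive `H` of `W₁ s / (1 + s ^ 2)`, which drops by a positive amount across the support. -/
lemma exists_bump_with_arctan_primitive :
    ∃ (W W₁ W₂ H : ℝ → ℝ) (M c₀ : ℝ), 0 < c₀ ∧
      (∀ s, HasDerivAt W (W₁ s) s) ∧ (∀ s, HasDerivAt W₁ (W₂ s) s) ∧ Continuous W₂ ∧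
      (∀ s, |W₂ s| ≤ M) ∧ (∀ s, 0 ≤ W s) ∧ (∀ s, W s ≤ 1) ∧
      (∀ s, s ≤ -2 ∨ -1 ≤ s → W s = 0 ∧ W₁ s = 0) ∧
      (∀ s, HasDerivAt H (W₁ s / (1 + s ^ 2)) s) ∧
      (∀ s, s ≤ -2 → H s = 0) ∧ (∀ s, -1 ≤ s → H s = -c₀) := by
  let b : ContDiffBump (-(3 / 2) : ℝ) := ⟨1 / 4, 1 / 2, by norm_num, by norm_num⟩
  have hb : ContDiff ℝ 2 b := b.contDiff
  have hb1 : ContDiff ℝ 1 (deriv b) := ((contDiff_succ_iff_deriv (n := 1)).1 hb).2.2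
  have hb2 : Continuous (deriv (deriv b)) := hb1.continuous_deriv le_rfl
  have hW : ∀ s, HasDerivAt b (deriv b s) s := fun s =>
    (hb.differentiable (by norm_num) s).hasDerivAt
  have hW1 : ∀ s, HasDerivAt (deriv b) (deriv (deriv b) s) s := fun s =>
    (hb1.differentiable (by norm_num) s).hasDerivAt
  have hz : ∀ s, s ≤ -2 ∨ -1 ≤ s → b s = 0 := fun s hs => by
    refine b.zero_of_le_dist ?_
    rw [Real.dist_eq]
    show (1 / 2 : ℝ) ≤ _
    rcases hs with hs | hs
    · rw [abs_of_nonpos (by linarith)]; linarith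
    · rw [abs_of_nonneg (by linarith)]; linarith
  have hz1 : ∀ s, s ≤ -2 ∨ -1 ≤ s → deriv b s = 0 := fun s hs => by
    have hmin : IsLocalMin b s := Filter.Eventually.of_forall fun y => by
      rw [hz s hs]; exact b.nonneg
    exact hmin.deriv_eq_zero
  obtain ⟨M, hM⟩ := (b.hasCompactSupport.deriv.deriv).exists_bound_of_continuous hb2
  let q : ℝ → ℝ := fun u => -(2 * u) * b u / (1 + u ^ 2) ^ 2
  have hq : Continuous q := by
    refine Continuous.div ?_ (by fun_prop) fun u => by positivity
    exact (by fun_prop : Continuous fun u : ℝ => -(2 * u)).mul hb.continuous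
  have hqz : ∀ s, s ≤ -2 ∨ -1 ≤ s → q s = 0 := fun s hs => by simp [q, hz s hs]
  refine ⟨b, deriv b, deriv (deriv b), fun s => b s / (1 + s ^ 2) - ∫ u in (-2 : ℝ)..s, q u,
    M, ∫ u in (-2 : ℝ)..(-1), q u, ?_, hW, hW1, hb2, fun s => by simpa using hM s,
    fun s => b.nonneg, fun s => b.le_one, fun s hs => ⟨hz s hs, hz1 s hs⟩, fun s => ?_,
    fun s hs => ?_, fun s hs => ?_⟩
  · refine intervalIntegral.integral_pos (by norm_num) hq.continuousOn (fun x hx => ?_)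
      ⟨-(3 / 2), by norm_num, ?_⟩
    · exact div_nonneg (mul_nonneg (by linarith [hx.2]) b.nonneg) (by positivity)
    · have : b (-(3 / 2)) = 1 := b.one_of_mem_closedBall (by
        simpa using b.rIn_pos.le)
      simp only [q, this]; norm_num
  · have h1 : HasDerivAt (fun s : ℝ => 1 + s ^ 2) (2 * s) s := by
      simpa using (hasDerivAt_pow 2 s).const_add 1
    have h2 := ((hW s).div h1 (by positivity)).sub
      (intervalIntegral.integral_hasDerivAt_right (hq.intervalIntegrable (-2) s)
        (hq.stronglyMeasurableAtFilter _ _) hq.continuousAt)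
    refine h2.congr_deriv ?_
    simp only [q]
    field_simp
    ring
  · have : ∫ u in (-2 : ℝ)..s, q u = 0 := by
      rw [intervalIntegral.integral_symm, intervalIntegral.integral_congr (g := fun _ => 0)]
      · simp
      · intro u hu
        rw [uIcc_of_le hs] at hu
        exact hqz u (Or.inl hu.2)
    simp [this, hz s (Or.inl hs)]
  · have : ∫ u in (-1 : ℝ)..s, q u = 0 := by
      rw [intervalIntegral.integral_congr (g := fun _ => 0)]
      · simp
      · intro u hu
        rw [uIcc_of_le hs] at hu
        exact hqz u (Or.inr hu.1)
    simp only [hz s (Or.inr hs), zero_div, zero_sub, neg_inj]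
    rw [← intervalIntegral.integral_add_adjacent_intervals
      (hq.intervalIntegrable (-2) (-1)) (hq.intervalIntegrable (-1) s), this, add_zero]

/-- Testing the derivative of the total angle `arctan (g + x g') + m arctan g` against `W₁ ∘ g`:
the second-order part contributes at most a multiple of the total variation of `g`. -/
lemma integral_bump_mul_angle_deriv_le {W₁ W₂ H : ℝ → ℝ} {M c₀ m c d : ℝ} (hcd : c ≤ d)
    (hW₁ : ∀ s, HasDerivAt W₁ (W₂ s) s) (hW₂ : Continuous W₂) (hM : ∀ s, |W₂ s| ≤ M)
    (hH : ∀ s, HasDerivAt H (W₁ s / (1 + s ^ 2)) s)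
    {g h hx : ℝ → ℝ}
    (dg : ∀ x ∈ Icc c d, HasDerivWithinAt g (h x) (Icc c d) x)
    (dh : ∀ x ∈ Icc c d, HasDerivWithinAt h (hx x) (Icc c d) x)
    (chx : ContinuousOn hx (Icc c d))
    (hc : W₁ (g c) = 0) (hd : W₁ (g d) = 0) (hHc : H (g c) = 0) (hHd : H (g d) = -c₀) :
    ∫ x in c..d, W₁ (g x) * ((2 * h x + x * hx x) / (1 + (g x + x * h x) ^ 2) +
      m * h x / (1 + g x ^ 2)) ≤ M * (π / 2) * (∫ x in c..d, |h x|) - m * c₀ := by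
  have cg : ContinuousOn g (Icc c d) := fun x hx => (dg x hx).continuousWithinAt
  have ch : ContinuousOn h (Icc c d) := fun x hx => (dh x hx).continuousWithinAt
  have cW₁ : Continuous W₁ := continuous_iff_continuousAt.2 fun s => (hW₁ s).continuousAt
  have c1 : ContinuousOn (fun x => W₂ (g x) * h x * arctan (g x + x * h x)) (Icc c d) :=
    ((hW₂.comp_continuousOn cg).mul ch).mul
      (continuous_arctan.comp_continuousOn (cg.add (continuousOn_id.mul ch)))
  have c2 : ContinuousOn (fun x => W₁ (g x) *
      ((2 * h x + x * hx x) / (1 + (g x + x * h x) ^ 2) + m * h x / (1 + g x ^ 2)))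
      (Icc c d) := by
    refine (cW₁.comp_continuousOn cg).mul (ContinuousOn.add ?_ ?_)
    · exact ContinuousOn.div (by fun_prop) (by fun_prop) fun x _ => by positivity
    · exact ContinuousOn.div (by fun_prop) (by fun_prop) fun x _ => by positivity
  have hz : ∫ x in c..d, (W₂ (g x) * h x * arctan (g x + x * h x) + W₁ (g x) *
      ((2 * h x + x * hx x) / (1 + (g x + x * h x) ^ 2) + m * h x / (1 + g x ^ 2))) =
      -(m * c₀) := by
    refine (integral_eq_sub_of_hasDerivWithinAt_Icc hcd
      (u := fun x => W₁ (g x) * arctan (g x + x * h x) + m * H (g x)) ?_ (c1.add c2)).trans ?_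
    rotate_left
    · simp [hc, hd, hHc, hHd]
    · intro x hx'
      have e1 : HasDerivWithinAt (fun x => W₁ (g x)) (W₂ (g x) * h x) (Icc c d) x :=
        (hW₁ (g x)).comp_hasDerivWithinAt x (dg x hx')
      have e2 : HasDerivWithinAt (fun x => H (g x)) (W₁ (g x) / (1 + g x ^ 2) * h x)
          (Icc c d) x := (hH (g x)).comp_hasDerivWithinAt x (dg x hx')
      have e3 : HasDerivWithinAt (fun x => g x + x * h x) (h x + (1 * h x + x * hx x))
          (Icc c d) x := (dg x hx').add ((hasDerivWithinAt_id x _).mul (dh x hx'))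
      refine ((e1.mul e3.arctan).add (e2.const_mul m)).congr_deriv ?_
      simp only [Pi.add_apply]
      ring
  rw [intervalIntegral.integral_add (c1.intervalIntegrable_of_Icc hcd)
    (c2.intervalIntegrable_of_Icc hcd)] at hz
  have hle : ∫ x in c..d, -(W₂ (g x) * h x * arctan (g x + x * h x)) ≤
      ∫ x in c..d, M * (π / 2) * |h x| := by
    refine intervalIntegral.integral_mono_on hcd (c1.neg.intervalIntegrable_of_Icc hcd)
      ((continuousOn_const.mul ch.abs).intervalIntegrable_of_Icc hcd) fun x _ => ?_
    refine (neg_le_abs _).trans ?_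
    rw [abs_mul, abs_mul]
    have ha : |arctan (g x + x * h x)| ≤ π / 2 :=
      abs_le.2 ⟨(neg_pi_div_two_lt_arctan _).le, (arctan_lt_pi_div_two _).le⟩
    have hM0 : 0 ≤ M := (abs_nonneg _).trans (hM 0)
    calc _ ≤ M * |h x| * (π / 2) := by gcongr; exact hM _
      _ = _ := by ring
  rw [intervalIntegral.integral_neg, intervalIntegral.integral_const_mul] at hle
  linarith

/-- For `n` large, the flow written in terms of `g = f / x` has no smooth solution on
`[0, 1/2] × [1, 12]` starting from `g = x - 4`.  The functions `h`, `hx` are the first two spatial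
derivatives of `g`, and `P`, `Px` are its time derivative and the spatial derivative of that. -/
lemma exists_dimension_without_slope_solution :
    ∃ n : ℕ, 2 ≤ n ∧ ∀ g h hx P Px : ℝ × ℝ → ℝ,
      ContinuousOn g (Icc 0 (1 / 2) ×ˢ Icc 1 12) → ContinuousOn h (Icc 0 (1 / 2) ×ˢ Icc 1 12) →
      ContinuousOn hx (Icc 0 (1 / 2) ×ˢ Icc 1 12) → ContinuousOn P (Icc 0 (1 / 2) ×ˢ Icc 1 12) →
      ContinuousOn Px (Icc 0 (1 / 2) ×ˢ Icc 1 12) →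
      (∀ t ∈ Icc (0 : ℝ) (1 / 2), ∀ x ∈ Icc (1 : ℝ) 12,
        HasDerivWithinAt (fun y => g (t, y)) (h (t, x)) (Icc 1 12) x ∧
        HasDerivWithinAt (fun y => h (t, y)) (hx (t, x)) (Icc 1 12) x ∧
        HasDerivWithinAt (fun y => P (t, y)) (Px (t, x)) (Icc 1 12) x ∧
        HasDerivWithinAt (fun s => g (s, x)) (P (t, x)) (Icc 0 (1 / 2)) t ∧
        HasDerivWithinAt (fun s => h (s, x)) (Px (t, x)) (Icc 0 (1 / 2)) t ∧
        P (t, x) = (x - 1) * (12 - x) / 20 / x *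
          ((2 * h (t, x) + x * hx (t, x)) / (1 + (g (t, x) + x * h (t, x)) ^ 2) +
            ((n : ℝ) - 1) * h (t, x) / (1 + g (t, x) ^ 2))) →
      (∀ x ∈ Icc (1 : ℝ) 12, g (0, x) = x - 4 ∧ h (0, x) = 1) → False := by
  obtain ⟨W, W₁, W₂, H, M, c₀, hc₀, hW, hW₁, hW₂, hM, hW0, hW1, hsupp, hH, hHl, hHr⟩ :=
    exists_bump_with_arctan_primitive
  have hM0 : 0 ≤ M := (abs_nonneg _).trans (hM 0)
  obtain ⟨k, hk⟩ := exists_nat_gt ((M * (π / 2) * 11 + 200) / c₀)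
  rw [div_lt_iff₀ hc₀] at hk
  refine ⟨k + 2, by omega, ?_⟩
  intro g h hx P Px cg ch chx cP cPx hall hinit
  have hI0 : (0 : ℝ) ∈ Icc (0 : ℝ) (1 / 2) := by norm_num
  have hP : ∀ t ∈ Icc (0 : ℝ) (1 / 2), ∀ x ∈ Icc (1 : ℝ) 12, _ :=
    fun t ht x hx' => (hall t ht x hx').2.2.2.2.2
  have hP1 : ∀ t ∈ Icc (0 : ℝ) (1 / 2), P (t, 1) = 0 := fun t ht => by
    rw [hP t ht 1 (by norm_num)]; norm_num
  have hPa : ∀ t ∈ Icc (0 : ℝ) (1 / 2), P (t, 12) = 0 := fun t ht => by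
    rw [hP t ht 12 (by norm_num)]; norm_num
  have hconst : ∀ x ∈ Icc (1 : ℝ) 12, (∀ t ∈ Icc (0 : ℝ) (1 / 2), P (t, x) = 0) →
      ∀ t ∈ Icc (0 : ℝ) (1 / 2), g (t, x) = x - 4 := by
    intro x hx' hp t ht
    rw [← (hinit x hx').1]
    refine constant_of_derivWithin_zero (f := fun s => g (s, x))
      (fun s hs => (hall s hs x hx').2.2.2.1.differentiableWithinAt) (fun s hs => ?_) t ht
    have hs' := Ico_subset_Icc_self hs
    rw [(hall s hs' x hx').2.2.2.1.derivWithin (uniqueDiffOn_Icc (by norm_num) s hs'), hp s hs']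
  have hg1 := hconst 1 (by norm_num) hP1
  have hga := hconst 12 (by norm_num) hPa
  have hTV : ∀ t ∈ Icc (0 : ℝ) (1 / 2), ∫ x in (1 : ℝ)..12, |h (t, x)| ≤ 11 := by
    intro t ht
    obtain ⟨A, hA⟩ := (isCompact_Icc.prod isCompact_Icc).exists_bound_of_continuousOn
      (s := Icc (0 : ℝ) (1 / 2) ×ˢ Icc (1 : ℝ) 12)
      (f := fun p => 1 + (g p + p.2 * h p) ^ 2) (by fun_prop)
    have hA0 : 0 ≤ A := (norm_nonneg _).trans (hA (0, 1) (by norm_num))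
    have hsub : Icc 0 t ×ˢ Icc (1 : ℝ) 12 ⊆ Icc (0 : ℝ) (1 / 2) ×ˢ Icc (1 : ℝ) 12 :=
      prod_mono (Icc_subset_Icc_right ht.2) Subset.rfl
    have hst : ∀ s ∈ Icc 0 t, s ∈ Icc (0 : ℝ) (1 / 2) := fun s hs => ⟨hs.1, hs.2.trans ht.2⟩
    have hle := integral_abs_le_of_dissipative (T := t) (a := 12) (C := 2 * A * (k + 3) ^ 2) ht.1
      (by norm_num) (by positivity) (ch.mono hsub) (chx.mono hsub) (cP.mono hsub) (cPx.mono hsub)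
      (fun s hs x hx' => (hall s (hst s hs) x hx').2.1)
      (fun s hs x hx' => (hall s (hst s hs) x hx').2.2.1)
      (fun s hs x hx' => (hall s (hst s hs) x hx').2.2.2.2.1.mono (Icc_subset_Icc_right ht.2))
      (fun s hs => hP1 s (hst s hs)) (fun s hs => hPa s (hst s hs)) (by
        rintro ⟨s, x⟩ hp
        obtain ⟨hs, hx'⟩ := hsub hp
        dsimp only at hs hx'
        have hA' := (le_abs_self _).trans (hA (s, x) (hsub hp))
        dsimp only at hA'
        rw [hP s hs x hx']
        have hx1 : 1 ≤ x := hx'.1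
        have hx2 : x ≤ 12 := hx'.2
        set G := g (s, x)
        set u := h (s, x)
        set v := hx (s, x)
        set D := 1 + (G + x * u) ^ 2
        have hD1 : 1 ≤ D := by simp only [D]; nlinarith [sq_nonneg (G + x * u)]
        have hG1 : 1 ≤ 1 + G ^ 2 := by nlinarith [sq_nonneg G]
        set τ := (x - 1) * (12 - x) / 20
        have hτ0 : 0 ≤ τ := div_nonneg (mul_nonneg (by linarith) (by linarith)) (by norm_num)
        have hτ2 : τ ≤ 8 := by simp only [τ]; nlinarith [sq_nonneg (x - 6)]
        push_cast
        set β := (2 / D + ((k : ℝ) + 1) / (1 + G ^ 2)) / x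
        have hβ0 : 0 ≤ β := by positivity
        have hβ : β ≤ k + 3 := by
          have e1 : 2 / D ≤ 2 := div_le_self (by norm_num) hD1
          have e2 : ((k : ℝ) + 1) / (1 + G ^ 2) ≤ k + 1 := div_le_self (by positivity) hG1
          refine (div_le_self (by positivity) hx1).trans (by linarith)
        have hrw : -(v * (τ / x * ((2 * u + x * v) / D + ((k : ℝ) + 2 - 1) * u / (1 + G ^ 2)))) =
            τ * (-(v ^ 2 / D) - v * u * β) := by
          simp only [β]
          field_simp
          ring
        have hsq : -(v ^ 2 / D) - v * u * β ≤ D * (u * β) ^ 2 / 4 := by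
          have : D * (u * β) ^ 2 / 4 + v ^ 2 / D + v * u * β = (v + D * (u * β) / 2) ^ 2 / D := by
            field_simp; ring
          have h0 : 0 ≤ (v + D * (u * β) / 2) ^ 2 / D := by positivity
          linarith
        calc _ = τ * (-(v ^ 2 / D) - v * u * β) := hrw
          _ ≤ τ * (D * (u * β) ^ 2 / 4) := by gcongr
          _ ≤ 8 * (A * (u * β) ^ 2 / 4) := by gcongr
          _ = 2 * A * β ^ 2 * u ^ 2 := by ring
          _ ≤ 2 * A * (k + 3) ^ 2 * u ^ 2 := by gcongr)
    refine hle.trans (le_of_eq ?_)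
    rw [intervalIntegral.integral_congr (g := fun _ => 1)]
    · norm_num
    · intro x hx'
      rw [uIcc_of_le (by norm_num)] at hx'
      simp [(hinit x hx').2]
  obtain ⟨δ, hδ, huc⟩ := Metric.uniformContinuousOn_iff.1
    ((isCompact_Icc.prod isCompact_Icc).uniformContinuousOn_of_continuous cg) 1 one_pos
  set e := min (δ / 2) 1
  have he0 : 0 < e := lt_min (by linarith) one_pos
  have he1 : e ≤ 1 := min_le_right _ _
  have heδ : e < δ := (min_le_left _ _).trans_lt (by linarith)
  have hgc : ∀ t ∈ Icc (0 : ℝ) (1 / 2), g (t, 1 + e) ≤ -2 := fun t ht => by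
    have := huc (t, 1 + e) ⟨ht, by constructor <;> dsimp only <;> linarith⟩ (t, 1)
      ⟨ht, by norm_num⟩ (by simpa [Prod.dist_eq, Real.dist_eq, abs_of_pos he0] using ⟨hδ, heδ⟩)
    rw [hg1 t ht, Real.dist_eq] at this
    linarith [(abs_lt.1 this).2]
  have hgd : ∀ t ∈ Icc (0 : ℝ) (1 / 2), -1 ≤ g (t, 12 - e) := fun t ht => by
    have := huc (t, 12 - e) ⟨ht, by constructor <;> dsimp only <;> linarith⟩ (t, 12)
      ⟨ht, by norm_num⟩ (by simpa [Prod.dist_eq, Real.dist_eq, abs_of_pos he0] using ⟨hδ, heδ⟩)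
    rw [hga t ht, Real.dist_eq] at this
    linarith [(abs_lt.1 this).1]
  have hcd : 1 + e ≤ 12 - e := by linarith
  have hss : Icc (1 + e) (12 - e) ⊆ Icc (1 : ℝ) 12 :=
    Icc_subset_Icc (by linarith) (by linarith)
  have hsub : Icc (0 : ℝ) (1 / 2) ×ˢ Icc (1 + e) (12 - e) ⊆
      Icc (0 : ℝ) (1 / 2) ×ˢ Icc (1 : ℝ) 12 := prod_mono Subset.rfl hss
  have hσ : ∀ x ∈ Icc (1 + e) (12 - e), 0 < (x - 1) * (12 - x) / 20 := fun x hx' =>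
    div_pos (mul_pos (by linarith [hx'.1]) (by linarith [hx'.2])) (by norm_num)
  have cw : ContinuousOn (fun p : ℝ × ℝ => p.2 / ((p.2 - 1) * (12 - p.2) / 20))
      (Icc (0 : ℝ) (1 / 2) ×ˢ Icc (1 + e) (12 - e)) :=
    ContinuousOn.div (by fun_prop) (by fun_prop) fun p hp => (hσ p.2 hp.2).ne'
  have cW : Continuous W := continuous_iff_continuousAt.2 fun s => (hW s).continuousAt
  have cW₁ : Continuous W₁ := continuous_iff_continuousAt.2 fun s => (hW₁ s).continuousAt
  have cu : ContinuousOn (fun p : ℝ × ℝ => p.2 / ((p.2 - 1) * (12 - p.2) / 20) * W (g p))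
      (Icc (0 : ℝ) (1 / 2) ×ˢ Icc (1 + e) (12 - e)) :=
    cw.mul (cW.comp_continuousOn (cg.mono hsub))
  have main := integral_le_add_of_integral_deriv_le (T := 1 / 2) (by norm_num) hcd
    (B := M * (π / 2) * 11 - (k + 1) * c₀)
    (u := fun p => p.2 / ((p.2 - 1) * (12 - p.2) / 20) * W (g p))
    (u' := fun p => p.2 / ((p.2 - 1) * (12 - p.2) / 20) * (W₁ (g p) * P p))
    cu (cw.mul ((cW₁.comp_continuousOn (cg.mono hsub)).mul (cP.mono hsub)))
    (fun t ht x hx' => by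
      have hWg : HasDerivWithinAt (fun s => W (g (s, x))) (W₁ (g (t, x)) * P (t, x))
          (Icc 0 (1 / 2)) t :=
        (hW (g (t, x))).comp_hasDerivWithinAt t (hall t ht x (hss hx')).2.2.2.1
      exact hWg.const_mul (x / ((x - 1) * (12 - x) / 20)))
    (fun t ht => by
      have hle := integral_bump_mul_angle_deriv_le (m := k + 1) hcd hW₁ hW₂ hM hH
        (g := fun x => g (t, x)) (h := fun x => h (t, x)) (hx := fun x => hx (t, x))
        (fun x hx' => (hall t ht x (hss hx')).1.mono hss)
        (fun x hx' => (hall t ht x (hss hx')).2.1.mono hss)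
        ((chx.mono hsub).slice_right ht)
        (hsupp _ (Or.inl (hgc t ht))).2 (hsupp _ (Or.inr (hgd t ht))).2
        (hHl _ (hgc t ht)) (hHr _ (hgd t ht))
      have hTV' : ∫ x in (1 + e)..(12 - e), |h (t, x)| ≤ 11 := by
        refine le_trans ?_ (hTV t ht)
        refine intervalIntegral.integral_mono_interval (by linarith) hcd (by linarith)
          (Filter.Eventually.of_forall fun x => abs_nonneg _)
          ((ch.slice_right ht).abs.intervalIntegrable_of_Icc (by norm_num))
      have heq : ∫ x in (1 + e)..(12 - e), x / ((x - 1) * (12 - x) / 20) *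
            (W₁ (g (t, x)) * P (t, x)) =
          ∫ x in (1 + e)..(12 - e), W₁ (g (t, x)) *
            ((2 * h (t, x) + x * hx (t, x)) / (1 + (g (t, x) + x * h (t, x)) ^ 2) +
              ((k : ℝ) + 1) * h (t, x) / (1 + g (t, x) ^ 2)) := by
        refine intervalIntegral.integral_congr fun x hx' => ?_
        rw [uIcc_of_le hcd] at hx'
        have hx1 : x ≠ 0 := by linarith [(hss hx').1]
        have hσx := (hσ x hx').ne'
        rw [hP t ht x (hss hx')]
        push_cast
        set τ := (x - 1) * (12 - x) / 20
        set Θ := (2 * h (t, x) + x * hx (t, x)) / (1 + (g (t, x) + x * h (t, x)) ^ 2)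
        rw [show (k : ℝ) + 2 - 1 = k + 1 by ring]
        field_simp
      refine heq.le.trans (hle.trans ?_)
      gcongr)
  have hstart : ∫ x in (1 + e)..(12 - e), x / ((x - 1) * (12 - x) / 20) * W (g (0, x)) ≤ 77 := by
    calc _ ≤ ∫ _ in (1 + e)..(12 - e), (7 : ℝ) := by
          refine intervalIntegral.integral_mono_on hcd
            ((cu.slice_right hI0).intervalIntegrable_of_Icc hcd) (by simp) fun x hx' => ?_
          rw [(hinit x (hss hx')).1]
          by_cases hx2 : x - 4 ≤ -2 ∨ -1 ≤ x - 4
          · rw [(hsupp _ hx2).1]; norm_num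
          · push Not at hx2
            have hw : x / ((x - 1) * (12 - x) / 20) ≤ 7 := by
              rw [div_le_iff₀ (hσ x hx')]
              nlinarith
            have hw0 : 0 ≤ x / ((x - 1) * (12 - x) / 20) :=
              div_nonneg (by linarith) (hσ x hx').le
            nlinarith [hW0 (x - 4), hW1 (x - 4)]
      _ ≤ 77 := by
        simp only [intervalIntegral.integral_const, smul_eq_mul]; linarith
  have hend : 0 ≤ ∫ x in (1 + e)..(12 - e),
      x / ((x - 1) * (12 - x) / 20) * W (g (1 / 2, x)) :=
    intervalIntegral.integral_nonneg hcd fun x hx' =>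
      mul_nonneg (div_nonneg (by linarith [hx'.1]) (hσ x hx').le) (hW0 _)
  dsimp only at main
  nlinarith

section Rectangle

variable {b c d : ℝ} {F : ℝ × ℝ → ℝ}

lemma ContDiffOn.fderivWithin_rectangle_apply (hb : 0 < b) (hcd : c < d)
    (hF : ContDiffOn ℝ (⊤ : ℕ∞) F (Icc 0 b ×ˢ Icc c d)) (v : ℝ × ℝ) :
    ContDiffOn ℝ (⊤ : ℕ∞) (fun p => fderivWithin ℝ F (Icc 0 b ×ˢ Icc c d) p v)
      (Icc 0 b ×ˢ Icc c d) :=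
  (hF.fderivWithin ((uniqueDiffOn_Icc hb).prod (uniqueDiffOn_Icc hcd)) le_rfl).clm_apply
    contDiffOn_const

lemma ContDiffOn.hasDerivWithinAt_snd (hF : ContDiffOn ℝ (⊤ : ℕ∞) F (Icc 0 b ×ˢ Icc c d))
    {t x : ℝ} (ht : t ∈ Icc 0 b) (hx : x ∈ Icc c d) :
    HasDerivWithinAt (fun y => F (t, y)) (fderivWithin ℝ F (Icc 0 b ×ˢ Icc c d) (t, x) (0, 1))
      (Icc c d) x :=
  ((hF.differentiableOn (by simp) (t, x) ⟨ht, hx⟩).hasFDerivWithinAt).comp_hasDerivWithinAt x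
    ((hasDerivWithinAt_const x _ t).prodMk (hasDerivWithinAt_id x _))
    fun _ hy => mk_mem_prod ht hy

lemma ContDiffOn.hasDerivWithinAt_fst (hF : ContDiffOn ℝ (⊤ : ℕ∞) F (Icc 0 b ×ˢ Icc c d))
    {t x : ℝ} (ht : t ∈ Icc 0 b) (hx : x ∈ Icc c d) :
    HasDerivWithinAt (fun s => F (s, x)) (fderivWithin ℝ F (Icc 0 b ×ˢ Icc c d) (t, x) (1, 0))
      (Icc 0 b) t :=
  ((hF.differentiableOn (by simp) (t, x) ⟨ht, hx⟩).hasFDerivWithinAt).comp_hasDerivWithinAt t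
    ((hasDerivWithinAt_id t _).prodMk (hasDerivWithinAt_const t _ x))
    fun _ hs => mk_mem_prod hs hx

lemma ContDiffOn.fderivWithin_fderivWithin_comm (hb : 0 < b) (hcd : c < d)
    (hF : ContDiffOn ℝ (⊤ : ℕ∞) F (Icc 0 b ×ˢ Icc c d)) (v w : ℝ × ℝ) {p : ℝ × ℝ}
    (hp : p ∈ Icc 0 b ×ˢ Icc c d) :
    fderivWithin ℝ (fun q => fderivWithin ℝ F (Icc 0 b ×ˢ Icc c d) q v)
        (Icc 0 b ×ˢ Icc c d) p w =
      fderivWithin ℝ (fun q => fderivWithin ℝ F (Icc 0 b ×ˢ Icc c d) q w)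
        (Icc 0 b ×ˢ Icc c d) p v := by
  have hS : UniqueDiffOn ℝ (Icc 0 b ×ˢ Icc c d) :=
    (uniqueDiffOn_Icc hb).prod (uniqueDiffOn_Icc hcd)
  have hD : DifferentiableWithinAt ℝ (fderivWithin ℝ F (Icc 0 b ×ˢ Icc c d))
      (Icc 0 b ×ˢ Icc c d) p :=
    (hF.fderivWithin (m := (⊤ : ℕ∞)) hS le_rfl).differentiableOn (by simp) p hp
  have hcl : p ∈ closure (interior (Icc 0 b ×ˢ Icc c d)) := by
    rw [interior_prod_eq, interior_Icc, interior_Icc, closure_prod_eq, closure_Ioo hb.ne,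
      closure_Ioo hcd.ne]
    exact hp
  have hsymm := (hF p hp).isSymmSndFDerivWithinAt
    (by simpa using WithTop.coe_le_coe.2 (le_top : (2 : ℕ∞) ≤ ⊤)) hS hcl hp
  rw [fderivWithin_clm_apply (hS p hp) hD (differentiableWithinAt_const v),
    fderivWithin_clm_apply (hS p hp) hD (differentiableWithinAt_const w)]
  simpa using hsymm w v

end Rectangle

/-- **Finite-time singularity** (Theorem 1.1, reduced Calabi-symmetry form).  There exist
`n ≥ 2`, `R > 1` with `a = 6R`, a smooth `σ` with `0 ≤ σ < R` and `σ(x) ≥ k(x−1)(a−x)`,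
reals `p > a`, `q`, and smooth initial data `f₀` with `f₀(1) = q`, `f₀(a) = p`, such that
no smooth solution of the reduced flow with initial data `f₀` exists on `[0, R/4] × [1,a]`. -/
theorem finite_time_singularity :
    ∃ (n : ℕ) (R a k p q : ℝ) (σ f₀ : ℝ → ℝ),
      2 ≤ n ∧ 1 < R ∧ a = 6 * R ∧ 0 < k ∧
      ContDiffOn ℝ (⊤ : ℕ∞) σ (Icc 1 a) ∧
      (∀ x ∈ Icc 1 a, 0 ≤ σ x ∧ σ x < R ∧ k * (x - 1) * (a - x) ≤ σ x) ∧
      a < p ∧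
      ContDiffOn ℝ (⊤ : ℕ∞) f₀ (Icc 1 a) ∧ f₀ 1 = q ∧ f₀ a = p ∧
      ¬ ∃ f : ℝ → ℝ → ℝ,
          ContDiffOn ℝ (⊤ : ℕ∞) (fun pt : ℝ × ℝ => f pt.1 pt.2) (Icc 0 (R / 4) ×ˢ Icc 1 a) ∧
          (∀ x ∈ Icc 1 a, f 0 x = f₀ x) ∧
          (∀ t ∈ Icc (0 : ℝ) (R / 4), ∀ x ∈ Icc 1 a,
            derivWithin (fun s => f s x) (Icc 0 (R / 4)) t = flowRHS n a σ f t x) := by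
  obtain ⟨n, hn, hno⟩ := exists_dimension_without_slope_solution
  refine ⟨n, 2, 12, 1 / 20, 96, -3, fun x => (x - 1) * (12 - x) / 20, fun x => x * (x - 4), hn,
    by norm_num, by norm_num, by norm_num, by fun_prop, fun x hx => ⟨?_, ?_, ?_⟩, by norm_num,
    by fun_prop, by norm_num, by norm_num, ?_⟩
  · exact div_nonneg (mul_nonneg (by linarith [hx.1]) (by linarith [hx.2])) (by norm_num)
  · nlinarith [sq_nonneg (x - 13 / 2)]
  · exact le_of_eq (by ring)
  rw [show (2 : ℝ) / 4 = 1 / 2 by norm_num]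
  rintro ⟨f, hf, hf0, hpde⟩
  have hb : (0 : ℝ) < 1 / 2 := by norm_num
  have hcd : (1 : ℝ) < 12 := by norm_num
  set S : Set (ℝ × ℝ) := Icc (0 : ℝ) (1 / 2) ×ˢ Icc (1 : ℝ) 12 with hS
  let g : ℝ × ℝ → ℝ := fun p => f p.1 p.2 / p.2
  have hg : ContDiffOn ℝ (⊤ : ℕ∞) g S :=
    hf.div contDiffOn_snd fun p hp => by
      have := hp.2.1
      linarith
  let h : ℝ × ℝ → ℝ := fun p => fderivWithin ℝ g S p (0, 1)
  have hh : ContDiffOn ℝ (⊤ : ℕ∞) h S := hg.fderivWithin_rectangle_apply hb hcd _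
  let P : ℝ × ℝ → ℝ := fun p => fderivWithin ℝ g S p (1, 0)
  have hP : ContDiffOn ℝ (⊤ : ℕ∞) P S := hg.fderivWithin_rectangle_apply hb hcd _
  have dg : ∀ t ∈ Icc (0 : ℝ) (1 / 2), ∀ x ∈ Icc (1 : ℝ) 12,
      HasDerivWithinAt (fun y => g (t, y)) (h (t, x)) (Icc 1 12) x :=
    fun t ht x hx => hg.hasDerivWithinAt_snd ht hx
  have dh : ∀ t ∈ Icc (0 : ℝ) (1 / 2), ∀ x ∈ Icc (1 : ℝ) 12,
      HasDerivWithinAt (fun y => h (t, y)) (fderivWithin ℝ h S (t, x) (0, 1)) (Icc 1 12) x :=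
    fun t ht x hx => hh.hasDerivWithinAt_snd ht hx
  have dgt : ∀ t ∈ Icc (0 : ℝ) (1 / 2), ∀ x ∈ Icc (1 : ℝ) 12,
      HasDerivWithinAt (fun s => g (s, x)) (P (t, x)) (Icc 0 (1 / 2)) t :=
    fun t ht x hx => hg.hasDerivWithinAt_fst ht hx
  have hfg : ∀ t, ∀ x ∈ Icc (1 : ℝ) 12, f t x = x * g (t, x) := fun t x hx => by
    have : x ≠ 0 := by linarith [hx.1]
    simp only [g]
    field_simp
  have ud := uniqueDiffOn_Icc hcd
  refine hno g h (fun p => fderivWithin ℝ h S p (0, 1)) P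
    (fun p => fderivWithin ℝ P S p (0, 1)) hg.continuousOn hh.continuousOn
    (hh.fderivWithin_rectangle_apply hb hcd _).continuousOn hP.continuousOn
    (hP.fderivWithin_rectangle_apply hb hcd _).continuousOn
    (fun t ht x hx => ⟨dg t ht x hx, dh t ht x hx, hP.hasDerivWithinAt_snd ht hx,
      dgt t ht x hx, ?_, ?_⟩) fun x hx => ⟨?_, ?_⟩
  · rw [hg.fderivWithin_fderivWithin_comm hb hcd (1, 0) (0, 1) ⟨ht, hx⟩]
    exact hh.hasDerivWithinAt_fst ht hx
  · have hx0 : x ≠ 0 := by linarith [hx.1]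
    have d1 : ∀ y ∈ Icc (1 : ℝ) 12,
        derivWithin (f t) (Icc 1 12) y = g (t, y) + y * h (t, y) := fun y hy => by
      have e : HasDerivWithinAt (fun y => y * g (t, y)) (1 * g (t, y) + y * h (t, y))
          (Icc 1 12) y := (hasDerivWithinAt_id y _).mul (dg t ht y hy)
      rw [(e.congr (fun z hz => hfg t z hz) (hfg t y hy)).derivWithin (ud y hy), one_mul]
    have d2 : derivWithin (derivWithin (f t) (Icc 1 12)) (Icc 1 12) x =
        2 * h (t, x) + x * fderivWithin ℝ h S (t, x) (0, 1) := by
      have e : HasDerivWithinAt (fun y => g (t, y) + y * h (t, y))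
          (h (t, x) + (1 * h (t, x) + x * fderivWithin ℝ h S (t, x) (0, 1)))
          (Icc 1 12) x := (dg t ht x hx).add ((hasDerivWithinAt_id x _).mul (dh t ht x hx))
      rw [(e.congr d1 (d1 x hx)).derivWithin (ud x hx)]
      ring
    have d3 : derivWithin (fun s => f s x) (Icc 0 (1 / 2)) t = x * P (t, x) := by
      have e := (dgt t ht x hx).const_mul x
      exact (e.congr (fun s _ => hfg s x hx) (hfg t x hx)).derivWithin
        (uniqueDiffOn_Icc hb t ht)
    have hE := hpde t ht x hx
    rw [d3, flowRHS, d2, d1 x hx, hfg t x hx] at hE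
    have hq : ((n : ℝ) - 1) * (x * (g (t, x) + x * h (t, x)) - x * g (t, x)) /
        (x ^ 2 + (x * g (t, x)) ^ 2) = ((n : ℝ) - 1) * h (t, x) / (1 + g (t, x) ^ 2) := by
      have : x ^ 2 + (x * g (t, x)) ^ 2 ≠ 0 := by positivity
      field_simp
      ring
    rw [hq] at hE
    rw [div_mul_eq_mul_div, eq_div_iff hx0, ← hE, mul_comm]
  · simp only [g, hf0 x hx]
    have hx0 : x ≠ 0 := by linarith [hx.1]
    field_simp
  · have e : HasDerivWithinAt (fun y : ℝ => y - 4) 1 (Icc 1 12) x :=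
      (hasDerivWithinAt_id x _).sub_const 4
    refine (ud x hx).eq_deriv _ (dg 0 (by norm_num) x hx) (e.congr (fun y hy => ?_) ?_)
    all_goals
      simp only [g]
      rw [hf0 _ (by assumption)]
      refine mul_div_cancel_left₀ _ ?_
      first
        | linarith [hx.1]
        | linarith [hy.1]
end

section
/- Hyperbola subsolution (Lemma 3.2): Let n ≥ 2 be an integer, let 1 < b_∞ < b₀ < a be reals, k > 0, and let σ : ℝ → ℝ satisfy σ(x) ≥ k(x−1)(a−x) ≥ 0 for all x ∈ [1,a]. Suppose b : [0,T) → ℝ is differentiable, satisfies b_∞ < b(t) ≤ b₀ for all t, and solves the ODE b'(t) = −( k·b_∞·(b_∞−1)·(a²−b₀²) / ( a·(a²−b_∞²)·(2a²−b_∞²)² ) )·(b(t)−b_∞)·b(t)³. Define g(t,y) := sqrt( ((a²−b(t)²)/(a²−b_∞²))·y² + b(t)² ). Then for all t ∈ [0,T) and all y ∈ [−sqrt(a²−b_∞²), sqrt(a²−b_∞²)], g is a subsolution: ∂_t g(t,y) ≥ σ(g(t,y))·( (∂_yy g)/(1 + (∂_y g)²) + (n−1)·(y·∂_y g − g)/(y²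 + g²) ). -/
open Real Set

/-- The family of hyperbolas `x = g(t,y) = sqrt( ((a²−b(t)²)/(a²−b_∞²))·y² + b(t)² )`,
viewed as graphs over the `y`-axis. -/
noncomputable def hyperbolaBarrier (a binf : ℝ) (b : ℝ → ℝ) (t y : ℝ) : ℝ :=
  Real.sqrt ((a ^ 2 - b t ^ 2) / (a ^ 2 - binf ^ 2) * y ^ 2 + b t ^ 2)

lemma sqrt_quadratic_hasDerivAt {m c : ℝ} (hm : 0 ≤ m) (hc : 0 < c) (y : ℝ) :
    HasDerivAt (fun y => √(m * y ^ 2 + c)) (m * y / √(m * y ^ 2 + c)) y := by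
  have hpos : 0 < m * y ^ 2 + c := by positivity
  have h : HasDerivAt (fun y : ℝ => m * y ^ 2 + c) (m * (2 * y)) y := by
    simpa using ((hasDerivAt_pow 2 y).const_mul m).add_const c
  convert h.sqrt hpos.ne' using 1
  field_simp

lemma deriv_sqrt_quadratic {m c : ℝ} (hm : 0 ≤ m) (hc : 0 < c) :
    deriv (fun y => √(m * y ^ 2 + c)) = fun y => m * y / √(m * y ^ 2 + c) :=
  funext fun y => (sqrt_quadratic_hasDerivAt hm hc y).deriv

lemma deriv_deriv_sqrt_quadratic {m c : ℝ} (hm : 0 ≤ m) (hc : 0 < c) (y : ℝ) :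
    deriv (deriv (fun y => √(m * y ^ 2 + c))) y = m * c / √(m * y ^ 2 + c) ^ 3 := by
  have hpos : 0 < m * y ^ 2 + c := by positivity
  have hg : 0 < √(m * y ^ 2 + c) := Real.sqrt_pos.2 hpos
  have hsq : √(m * y ^ 2 + c) ^ 2 = m * y ^ 2 + c := Real.sq_sqrt hpos.le
  have h := ((hasDerivAt_id y).const_mul m).div (sqrt_quadratic_hasDerivAt hm hc y) hg.ne'
  rw [deriv_sqrt_quadratic hm hc]
  refine h.deriv.trans ?_
  simp only [id]
  generalize √(m * y ^ 2 + c) = g at hg hsq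
  field_simp
  linear_combination m * hsq

/-- Upper bound for the curvature operator on the hyperbola `g² = m y² + b²`. -/
lemma hyperbola_curvature_le {m y b g N : ℝ} (hg : 0 < g) (hN : 1 ≤ N)
    (hsq : g ^ 2 = m * y ^ 2 + b ^ 2) :
    m * b ^ 2 / g ^ 3 / (1 + (m * y / g) ^ 2) + N * (y * (m * y / g) - g) / (y ^ 2 + g ^ 2) ≤
      -(b ^ 4 * (1 - m) / (g * (g ^ 2 + m ^ 2 * y ^ 2) * (y ^ 2 + g ^ 2))) := by
  have hP : 0 < g ^ 2 + m ^ 2 * y ^ 2 := by positivity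
  have hQ : 0 < y ^ 2 + g ^ 2 := by positivity
  have e₁ : m * b ^ 2 / g ^ 3 / (1 + (m * y / g) ^ 2) =
      m * b ^ 2 / (g * (g ^ 2 + m ^ 2 * y ^ 2)) := by
    field_simp
  have e₂ : y * (m * y / g) - g = -(b ^ 2 / g) := by
    field_simp
    linear_combination -hsq
  have e₃ : -(b ^ 4 * (1 - m) / (g * (g ^ 2 + m ^ 2 * y ^ 2) * (y ^ 2 + g ^ 2))) =
      m * b ^ 2 / (g * (g ^ 2 + m ^ 2 * y ^ 2)) + 1 * -(b ^ 2 / g) / (y ^ 2 + g ^ 2) := by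
    field_simp
    linear_combination b ^ 2 * (1 - m) * hsq
  rw [e₁, e₂, e₃]
  have hle : N * -(b ^ 2 / g) ≤ 1 * -(b ^ 2 / g) :=
    mul_le_mul_of_nonpos_right hN (neg_nonpos.2 (by positivity))
  gcongr

/-- Time derivative of the barrier along a differentiable vertex path. -/
lemma hyperbolaBarrier_hasDerivWithinAt {a binf b' t y : ℝ} {b : ℝ → ℝ} {s : Set ℝ}
    (hD : a ^ 2 - binf ^ 2 ≠ 0) (hg : 0 < hyperbolaBarrier a binf b t y)
    (hb : HasDerivWithinAt b b' s t) :
    HasDerivWithinAt (fun s => hyperbolaBarrier a binf b s y)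
      (b t * b' * (a ^ 2 - binf ^ 2 - y ^ 2) /
        ((a ^ 2 - binf ^ 2) * hyperbolaBarrier a binf b t y)) s t := by
  have hsq := hb.pow 2
  have h := (((hsq.const_sub (a ^ 2)).div_const (a ^ 2 - binf ^ 2)).mul_const (y ^ 2)).add hsq
  refine (h.sqrt (Real.sqrt_pos.1 hg).ne').congr_deriv ?_
  change _ / (2 * hyperbolaBarrier a binf b t y) = _
  field_simp
  simp
  ring

/-- The vertex speed is at most the speed forced by the curvature bound. -/
lemma vertex_speed_le {a β b₀ b g m y k D : ℝ} (h1 : 1 < β) (h2 : β < b) (h3 : b ≤ b₀)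
    (h4 : b₀ < a) (hk : 0 < k) (hD : D = a ^ 2 - β ^ 2) (hm : m = (a ^ 2 - b ^ 2) / D)
    (hy : y ^ 2 ≤ D) (hbg : b ≤ g) (hga : g ≤ a) :
    k * β * (β - 1) * (a ^ 2 - b₀ ^ 2) / (a * D * (2 * a ^ 2 - β ^ 2) ^ 2) * (b - β) * b ^ 3 ≤
      k * (g - 1) * m * (b ^ 2 - β ^ 2) * b ^ 3 /
        ((a + g) * (g ^ 2 + m ^ 2 * y ^ 2) * (y ^ 2 + g ^ 2)) := by
  have hD0 : 0 < D := by rw [hD]; nlinarith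
  have hb₀ : 0 < a ^ 2 - b₀ ^ 2 := by nlinarith
  have hm_lower : (a ^ 2 - b₀ ^ 2) / D ≤ m := by
    rw [hm]
    have : b ^ 2 ≤ b₀ ^ 2 := by nlinarith
    gcongr
  have hm_pos : 0 < m := lt_of_lt_of_le (by positivity) hm_lower
  have hm_le : m ≤ 1 := by
    rw [hm, div_le_one hD0, hD]
    nlinarith
  have hg0 : 0 < g := by linarith
  have hga2 : g ^ 2 ≤ a ^ 2 := by gcongr
  have hP : g ^ 2 + m ^ 2 * y ^ 2 ≤ 2 * a ^ 2 - β ^ 2 := by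
    have : m ^ 2 * y ^ 2 ≤ 1 * y ^ 2 := by
      gcongr
      exact pow_le_one₀ hm_pos.le hm_le
    linarith
  have hQ : y ^ 2 + g ^ 2 ≤ 2 * a ^ 2 - β ^ 2 := by linarith
  have hb0 : 0 < b := by linarith
  have ha0 : 0 < a := by linarith
  have hbβ : 0 < b - β := by linarith
  have hβ1 : 0 < β - 1 := by linarith
  have hsq_diff : 2 * β * (b - β) ≤ b ^ 2 - β ^ 2 := by nlinarith
  have hR : 0 < 2 * a ^ 2 - β ^ 2 := lt_of_lt_of_le (by positivity) hQ
  calc _ = k * (β - 1) * ((a ^ 2 - b₀ ^ 2) / D) * (2 * β * (b - β)) * b ^ 3 /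
        ((a + a) * (2 * a ^ 2 - β ^ 2) * (2 * a ^ 2 - β ^ 2)) := by
        field_simp
        ring
    _ ≤ _ := by
        have hβg : β - 1 ≤ g - 1 := by linarith
        have hg1 : 0 ≤ g - 1 := by linarith
        have hb2 : 0 ≤ b ^ 2 - β ^ 2 := by nlinarith
        gcongr

/-- **Hyperbola subsolution** (Lemma 3.2).  With `1 < b_∞ < b₀ < a`, `σ(x) ≥ k(x−1)(a−x)` on
`[1,a]`, and `b` solving the barrier ODE with `b_∞ < b(t) ≤ b₀`, the family of hyperbolas
`g(t,y)` is a subsolution of the reduced flow written for graphs over the `y`-axis, for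
`y ∈ [−sqrt(a²−b_∞²), sqrt(a²−b_∞²)]`. -/
theorem hyperbola_subsolution (n : ℕ) (hn : 2 ≤ n) (a binf b₀ k T : ℝ)
    (h1 : 1 < binf) (h2 : binf < b₀) (h3 : b₀ < a) (hk : 0 < k)
    (σ : ℝ → ℝ) (hσ : ∀ x ∈ Icc 1 a, k * (x - 1) * (a - x) ≤ σ x)
    (b : ℝ → ℝ)
    (hb : ∀ t ∈ Ico (0 : ℝ) T, binf < b t ∧ b t ≤ b₀)
    (hODE : ∀ t ∈ Ico (0 : ℝ) T,
      HasDerivWithinAt b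
        (-(k * binf * (binf - 1) * (a ^ 2 - b₀ ^ 2) /
              (a * (a ^ 2 - binf ^ 2) * (2 * a ^ 2 - binf ^ 2) ^ 2)) *
          (b t - binf) * b t ^ 3) (Ico 0 T) t) :
    ∀ t ∈ Ico (0 : ℝ) T,
      ∀ y ∈ Icc (-Real.sqrt (a ^ 2 - binf ^ 2)) (Real.sqrt (a ^ 2 - binf ^ 2)),
        derivWithin (fun s => hyperbolaBarrier a binf b s y) (Ico 0 T) t ≥
          σ (hyperbolaBarrier a binf b t y) *
            (deriv (deriv (hyperbolaBarrier a binf b t)) y /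
                (1 + (deriv (hyperbolaBarrier a binf b t) y) ^ 2) +
              ((n : ℝ) - 1) *
                (y * deriv (hyperbolaBarrier a binf b t) y - hyperbolaBarrier a binf b t y) /
                (y ^ 2 + (hyperbolaBarrier a binf b t y) ^ 2)) := by
  intro t ht y hy
  obtain ⟨hβb, hbb₀⟩ := hb t ht
  have hD : 0 < a ^ 2 - binf ^ 2 := by nlinarith
  have hy2 : y ^ 2 ≤ a ^ 2 - binf ^ 2 := by
    rw [← Real.sq_sqrt hD.le]
    exact sq_le_sq' hy.1 hy.2
  set m := (a ^ 2 - b t ^ 2) / (a ^ 2 - binf ^ 2) with hm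
  have hm0 : 0 < m := div_pos (by nlinarith) hD
  have hb0 : 0 < b t := by linarith
  have hc : 0 < b t ^ 2 := by positivity
  have hfun : hyperbolaBarrier a binf b t = fun y => √(m * y ^ 2 + b t ^ 2) := rfl
  have hrad : 0 < m * y ^ 2 + b t ^ 2 := by positivity
  have hg0 : 0 < hyperbolaBarrier a binf b t y := Real.sqrt_pos.2 hrad
  have hsq : hyperbolaBarrier a binf b t y ^ 2 = m * y ^ 2 + b t ^ 2 := Real.sq_sqrt hrad.le
  rw [(hyperbolaBarrier_hasDerivWithinAt hD.ne' hg0 (hODE t ht)).derivWithin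
    (uniqueDiffOn_Ico 0 T t ht)]
  have hd1 : deriv (hyperbolaBarrier a binf b t) y = m * y / hyperbolaBarrier a binf b t y :=
    (sqrt_quadratic_hasDerivAt hm0.le hc y).deriv
  have hd2 : deriv (deriv (hyperbolaBarrier a binf b t)) y =
      m * b t ^ 2 / hyperbolaBarrier a binf b t y ^ 3 :=
    deriv_deriv_sqrt_quadratic hm0.le hc y
  rw [hd1, hd2]
  generalize hyperbolaBarrier a binf b t y = g at hg0 hsq
  have hbg : b t ≤ g := by
    refine le_of_sq_le_sq ?_ hg0.le
    rw [hsq]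
    nlinarith [mul_nonneg hm0.le (sq_nonneg y)]
  have hmD : m * (a ^ 2 - binf ^ 2) = a ^ 2 - b t ^ 2 := div_mul_cancel₀ _ hD.ne'
  have hag : (a - g) * (a + g) = m * (a ^ 2 - binf ^ 2 - y ^ 2) := by
    linear_combination -hsq - hmD
  have hga : g ≤ a := by
    have : 0 ≤ (a - g) * (a + g) := hag ▸ mul_nonneg hm0.le (by linarith)
    nlinarith
  have hN : (1 : ℝ) ≤ n - 1 := by
    have : (2 : ℝ) ≤ n := by exact_mod_cast hn
    linarith
  have hσg := hσ g ⟨by linarith, hga⟩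
  have hσ0 : 0 ≤ σ g := le_trans
    (mul_nonneg (mul_nonneg hk.le (by linarith)) (by linarith)) hσg
  have hm1 : 1 - m = (b t ^ 2 - binf ^ 2) / (a ^ 2 - binf ^ 2) := by
    rw [hm]
    field_simp
    ring
  have hb2 : 0 ≤ b t ^ 2 - binf ^ 2 := by nlinarith
  have hm1' : 0 ≤ 1 - m := hm1 ▸ div_nonneg hb2 hD.le
  have hspeed := vertex_speed_le h1 hβb hbb₀ h3 hk rfl hm hy2 hbg hga
  have ha_sub : a - g = m * (a ^ 2 - binf ^ 2 - y ^ 2) / (a + g) :=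
    eq_div_of_mul_eq (by linarith) hag
  have hy0 : 0 ≤ a ^ 2 - binf ^ 2 - y ^ 2 := by linarith
  have hag0 : 0 < a + g := by linarith
  refine (mul_le_mul_of_nonneg_left (hyperbola_curvature_le hg0 hN hsq) hσ0).trans ?_
  refine (mul_le_mul_of_nonpos_right hσg (neg_nonpos.2 (by positivity))).trans ?_
  have hscaled := mul_le_mul_of_nonneg_left hspeed
    (show 0 ≤ b t * (a ^ 2 - binf ^ 2 - y ^ 2) / ((a ^ 2 - binf ^ 2) * g) by positivity)
  refine le_trans (le_of_eq ?_) ((neg_le_neg hscaled).trans (le_of_eq ?_))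
  · have hP : 0 < g ^ 2 + m ^ 2 * y ^ 2 := by positivity
    have hQ : 0 < y ^ 2 + g ^ 2 := by positivity
    rw [ha_sub, hm1]
    clear_value m
    field_simp
  · ring
end

section
/- Solution of the barrier initial value problem: Let C₁ > 0 and 0 < b_∞ < b₀ be reals. Then there exists a unique differentiable solution b : [0,∞) → ℝ of the initial value problem b'(t) = −C₁·(b(t) − b_∞)·b(t)³ with b(0) = b₀; it satisfies b_∞ < b(t) ≤ b₀ for all t ≥ 0 and is strictly decreasing. Moreover, for every b₁ ∈ (b_∞, b₀) there is a unique time T > 0 with b(T) = b₁, given explicitly by T = ( F(b₀) − F(b₁) ) / C₁, where F(b) := ( b_∞² + 2b²·log(b − b_∞) + 2b_∞·b − 2b²·log b ) / ( 2·b_∞³·b² ). -/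
open Real Set

/-- The explicit antiderivative `F(b) = (b_∞² + 2b² log(b−b_∞) + 2b_∞ b − 2b² log b)/(2 b_∞³ b²)`
of `1/((b−b_∞) b³)`. -/
noncomputable def Fbar (binf s : ℝ) : ℝ :=
  (binf ^ 2 + 2 * s ^ 2 * Real.log (s - binf) + 2 * binf * s - 2 * s ^ 2 * Real.log s) /
    (2 * binf ^ 3 * s ^ 2)

theorem Fbar_eq {binf s : ℝ} (h : binf ≠ 0) (hs : s ≠ 0) :
    Fbar binf s = (binf ^ 3)⁻¹ * Real.log (s - binf) +
      ((2 * binf * s ^ 2)⁻¹ + (binf ^ 2 * s)⁻¹ - (binf ^ 3)⁻¹ * Real.log s) := by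
  unfold Fbar
  field_simp
  ring

theorem hasStrictDerivAt_Fbar {binf s : ℝ} (h : 0 < binf) (hs : binf < s) :
    HasStrictDerivAt (Fbar binf) ((s - binf) * s ^ 3)⁻¹ s := by
  have hs0 : s ≠ 0 := (h.trans hs).ne'
  have hsub : s - binf ≠ 0 := (sub_pos.2 hs).ne'
  have hid := hasStrictDerivAt_id s
  have h_log : HasStrictDerivAt (fun x => Real.log (x - binf)) (1 / (s - binf)) s :=
    HasStrictDerivAt.log (hid.sub_const binf) hsub
  have h_num := (((((hid.pow 2).const_mul 2).mul h_log).const_add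
    (binf ^ 2)).add (hid.const_mul (2 * binf))).sub
      (((hid.pow 2).const_mul 2).mul (HasStrictDerivAt.log hid hs0))
  have h_den := (hid.pow 2).const_mul (2 * binf ^ 3)
  have h_quot := h_num.fun_div h_den (by simp only [Pi.pow_apply, id]; positivity)
  refine (h_quot.congr_deriv ?_).congr_of_eventuallyEq (.of_forall fun x => ?_)
  · simp only [Pi.pow_apply, Pi.add_apply, Pi.sub_apply, Pi.mul_apply, id]
    field_simp
    ring
  · simp [Fbar]

theorem strictMonoOn_Fbar {binf : ℝ} (h : 0 < binf) : StrictMonoOn (Fbar binf) (Ioi binf) := by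
  refine strictMonoOn_of_deriv_pos (convex_Ioi binf)
    (fun s hs => (hasStrictDerivAt_Fbar h hs).hasDerivAt.continuousAt.continuousWithinAt)
    fun s hs => ?_
  rw [interior_Ioi] at hs
  rw [(hasStrictDerivAt_Fbar h hs).hasDerivAt.deriv]
  have : 0 < s := h.trans hs
  have : 0 < s - binf := sub_pos.2 hs
  positivity

theorem tendsto_Fbar_nhdsGT {binf : ℝ} (h : 0 < binf) :
    Filter.Tendsto (Fbar binf) (nhdsWithin binf (Ioi binf)) Filter.atBot := by
  have h_sub : Filter.Tendsto (fun s => s - binf) (nhdsWithin binf (Ioi binf))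
      (nhdsWithin 0 (Ioi 0)) := by
    refine tendsto_nhdsWithin_iff.2 ⟨?_, ?_⟩
    · have : ContinuousAt (fun s : ℝ => s - binf) binf := by fun_prop
      simpa using this.tendsto.mono_left nhdsWithin_le_nhds
    · filter_upwards [self_mem_nhdsWithin] with s hs using sub_pos.2 (mem_Ioi.1 hs)
  have h_log := (Real.tendsto_log_nhdsGT_zero.comp h_sub).const_mul_atBot
    (show 0 < (binf ^ 3)⁻¹ by positivity)
  have h_rest : ContinuousAt (fun s => (2 * binf * s ^ 2)⁻¹ + (binf ^ 2 * s)⁻¹ -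
      (binf ^ 3)⁻¹ * Real.log s) binf := by
    fun_prop (disch := positivity)
  refine (h_log.atBot_add (h_rest.tendsto.mono_left nhdsWithin_le_nhds)).congr' ?_
  filter_upwards [self_mem_nhdsWithin] with s hs
  exact (Fbar_eq h.ne' (h.trans hs).ne').symm

theorem exists_Fbar_eq {binf b₀ y : ℝ} (h : 0 < binf) (hb : binf < b₀) (hy : y ≤ Fbar binf b₀) :
    ∃ s, binf < s ∧ s ≤ b₀ ∧ Fbar binf s = y := by
  obtain ⟨a, hay, hba, hab⟩ := (((tendsto_Fbar_nhdsGT h).eventually_le_atBot y).and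
    (Ioo_mem_nhdsGT hb)).exists
  have h_cont : ContinuousOn (Fbar binf) (Icc a b₀) := fun s hs =>
    (hasStrictDerivAt_Fbar h (hba.trans_le hs.1)).hasDerivAt.continuousAt.continuousWithinAt
  obtain ⟨s, hs, hsy⟩ := intermediate_value_Icc hab.le h_cont ⟨hay, hy⟩
  exact ⟨s, hba.trans_le hs.1, hs.2, hsy⟩

/-- Solutions on `[0, ∞)` of an autonomous scalar equation with `C¹` right-hand side are
determined by their initial value. -/
theorem eqOn_Ici_of_hasDerivWithinAt {v f g : ℝ → ℝ} (hv : ContDiff ℝ 1 v)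
    (hf : ∀ t ∈ Ici (0 : ℝ), HasDerivWithinAt f (v (f t)) (Ici 0) t)
    (hg : ∀ t ∈ Ici (0 : ℝ), HasDerivWithinAt g (v (g t)) (Ici 0) t)
    (h0 : f 0 = g 0) : EqOn f g (Ici 0) := by
  intro T hT
  have hf_cont : ContinuousOn f (Icc 0 T) := fun t ht =>
    (hf t ht.1).continuousWithinAt.mono Icc_subset_Ici_self
  have hg_cont : ContinuousOn g (Icc 0 T) := fun t ht =>
    (hg t ht.1).continuousWithinAt.mono Icc_subset_Ici_self
  obtain ⟨R, hR⟩ := ((isCompact_Icc.image_of_continuousOn hf_cont).union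
    (isCompact_Icc.image_of_continuousOn hg_cont)).isBounded.subset_closedBall 0
  obtain ⟨K, hK⟩ := hv.contDiffOn.exists_lipschitzOnWith one_ne_zero
    (convex_closedBall (0 : ℝ) R) (isCompact_closedBall 0 R)
  exact ODE_solution_unique_of_mem_Icc_right (v := fun _ => v)
    (s := fun _ => Metric.closedBall 0 R) (fun _ _ => hK) hf_cont
    (fun t ht => (hf t ht.1).mono (Ici_subset_Ici.2 ht.1))
    (fun t ht => hR (.inl (mem_image_of_mem f (Ico_subset_Icc_self ht)))) hg_cont
    (fun t ht => (hg t ht.1).mono (Ici_subset_Ici.2 ht.1))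
    (fun t ht => hR (.inr (mem_image_of_mem g (Ico_subset_Icc_self ht)))) h0 ⟨hT, le_rfl⟩

/-- **Solution of the barrier initial value problem.**  For `C₁ > 0` and `0 < b_∞ < b₀`,
the IVP `b' = −C₁ (b − b_∞) b³`, `b(0) = b₀`, has a unique differentiable solution on
`[0,∞)`; it satisfies `b_∞ < b(t) ≤ b₀`, is strictly decreasing, and for each
`b₁ ∈ (b_∞, b₀)` there is a unique hitting time `T = (F(b₀) − F(b₁))/C₁ > 0` with `b(T) = b₁`. -/
theorem barrier_ivp (C₁ binf b₀ : ℝ) (hC : 0 < C₁) (h1 : 0 < binf) (h2 : binf < b₀) :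
    ∃ b : ℝ → ℝ,
      (b 0 = b₀ ∧ ∀ t ∈ Ici (0 : ℝ),
        HasDerivWithinAt b (-C₁ * (b t - binf) * b t ^ 3) (Ici 0) t) ∧
      (∀ c : ℝ → ℝ,
        (c 0 = b₀ ∧ ∀ t ∈ Ici (0 : ℝ),
          HasDerivWithinAt c (-C₁ * (c t - binf) * c t ^ 3) (Ici 0) t) →
        ∀ t ∈ Ici (0 : ℝ), c t = b t) ∧
      (∀ t ∈ Ici (0 : ℝ), binf < b t ∧ b t ≤ b₀) ∧
      StrictAntiOn b (Ici 0) ∧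
      (∀ b₁ ∈ Ioo binf b₀,
        0 < (Fbar binf b₀ - Fbar binf b₁) / C₁ ∧
        b ((Fbar binf b₀ - Fbar binf b₁) / C₁) = b₁ ∧
        ∀ T : ℝ, 0 < T → b T = b₁ → T = (Fbar binf b₀ - Fbar binf b₁) / C₁) := by
  set f : ℝ → ℝ := fun s => (Fbar binf b₀ - Fbar binf s) / C₁ with hf_def
  have hf_anti : StrictAntiOn f (Ioi binf) := fun s hs r hr hsr =>
    div_lt_div_of_pos_right (sub_lt_sub_left (strictMonoOn_Fbar h1 hs hr hsr) _) hC
  have hf_b₀ : f b₀ = 0 := by simp [hf_def]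
  have hf_surj : ∀ t ∈ Ici (0 : ℝ), ∃ s, binf < s ∧ s ≤ b₀ ∧ f s = t := by
    intro t ht
    obtain ⟨s, hs, hsb, hFs⟩ := exists_Fbar_eq (y := Fbar binf b₀ - C₁ * t) h1 h2
      (sub_le_self _ (mul_nonneg hC.le ht))
    exact ⟨s, hs, hsb, by simp only [hf_def, hFs]; field_simp; ring⟩
  set b : ℝ → ℝ := Function.invFunOn f (Ioi binf)
  have hb_left : ∀ s, binf < s → b (f s) = s := fun s hs =>
    hf_anti.injOn.leftInvOn_invFunOn hs
  have hb_deriv : ∀ t ∈ Ici (0 : ℝ),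
      HasDerivWithinAt b (-C₁ * (b t - binf) * b t ^ 3) (Ici 0) t := by
    intro t ht
    obtain ⟨s, hs, -, rfl⟩ := hf_surj t ht
    have hs0 : s ≠ 0 := (h1.trans hs).ne'
    have hsub : s - binf ≠ 0 := (sub_pos.2 hs).ne'
    have hfs := ((hasStrictDerivAt_Fbar h1 hs).const_sub (Fbar binf b₀)).div_const C₁
    have hbs := hfs.to_local_left_inverse
      (div_ne_zero (neg_ne_zero.2 (inv_ne_zero (mul_ne_zero hsub (pow_ne_zero 3 hs0)))) hC.ne')
      ((eventually_gt_nhds hs).mono hb_left)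
    rw [hb_left s hs]
    refine (hbs.hasDerivAt.congr_deriv ?_).hasDerivWithinAt
    field_simp
  have hb_zero : b 0 = b₀ := hf_b₀ ▸ hb_left b₀ h2
  have hb_anti : StrictAntiOn b (Ici 0) := by
    intro t ht u hu htu
    obtain ⟨s, hs, -, rfl⟩ := hf_surj t ht
    obtain ⟨r, hr, -, rfl⟩ := hf_surj u hu
    rw [hb_left s hs, hb_left r hr]
    exact (hf_anti.lt_iff_gt hs hr).1 htu
  refine ⟨b, ⟨hb_zero, hb_deriv⟩, fun c hc => ?_, fun t ht => ?_, hb_anti, fun b₁ hb₁ => ?_⟩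
  · exact eqOn_Ici_of_hasDerivWithinAt (v := fun x => -C₁ * (x - binf) * x ^ 3) (by fun_prop)
      hc.2 hb_deriv (hc.1.trans hb_zero.symm)
  · obtain ⟨s, hs, hsb, rfl⟩ := hf_surj t ht
    rw [hb_left s hs]
    exact ⟨hs, hsb⟩
  · have h_pos : 0 < f b₁ := hf_b₀ ▸ hf_anti hb₁.1 h2 hb₁.2
    refine ⟨h_pos, hb_left b₁ hb₁.1, fun T hT hbT => ?_⟩
    exact hb_anti.injOn hT.le h_pos.le (hbT.trans (hb_left b₁ hb₁.1).symm)
end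

section
/- Hyperbola avoidance (Proposition 3.3, graphical form): Let n ≥ 2 be an integer, 1 < b_∞ < b₀ < a, k > 0, and σ : [1,a] → ℝ with σ(x) ≥ k(x−1)(a−x) for x ∈ [1,a]. Let b : [0,T) → ℝ solve b'(t) = −( k·b_∞·(b_∞−1)·(a²−b₀²) / ( a·(a²−b_∞²)·(2a²−b_∞²)² ) )·(b−b_∞)·b³ with b(0) = b₀ and b_∞ < b(t) ≤ b₀, and set g(t,y) := sqrt( ((a²−b(t)²)/(a²−b_∞²))·y² + b(t)² ). Let f : [0,T) × [1,a] → ℝ be a smooth solution of ∂_t f = σ(x)·( (∂_xx f)/(1 + (∂_x f)²) + (n−1)·(x·∂_x f − f)/(x² + f²) ) with fixed boundary values f(t,1) = q and f(t,a) = p where p > sqrt(a²−b_∞²). If at t = 0 the graph of f(0,·) is disjoint from the hyperbola, i.e. (x, f(0,x)) ≠ (g(0,y), y) for all x ∈ [1,a] and all y ∈ [−sqrt(a²−b_∞²), sqrt(a²−b_∞²)], then for every t ∈ [0,T) the graphs remain disjoint: (x, f(t,x)) ≠ (g(t,y), y) for all such x, y. -/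
open Real Set

/-- The second derivative is nonpositive at a local maximum. -/
theorem IsLocalMax.deriv_deriv_nonpos {w : ℝ → ℝ} {x : ℝ} (hw : IsLocalMax w x)
    (hc : ContinuousAt w x) : deriv (deriv w) x ≤ 0 := by
  by_contra! hpos
  have hmin : IsLocalMin w x := isLocalMin_of_deriv_deriv_pos hpos hw.deriv_eq_zero hc
  have hconst : w =ᶠ[nhds x] fun _ => w x := by
    filter_upwards [hw, hmin] with y h₁ h₂ using le_antisymm h₁ h₂
  have h := hconst.deriv.deriv_eq
  simp at h
  exact hpos.ne' h

/-- A function which is negative to the left of one of its zeros has nonnegative derivative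
there. -/
theorem HasDerivAt.nonneg_of_neg_left {w : ℝ → ℝ} {w' r t : ℝ} (hw : HasDerivAt w w' t)
    (hr : r < t) (h₀ : w t = 0) (hneg : ∀ s ∈ Ico r t, w s < 0) : 0 ≤ w' := by
  refine ge_of_tendsto ((hasDerivAt_iff_tendsto_slope.1 hw).mono_left
    (nhdsWithin_mono t fun s (hs : s ∈ Iio t) => ne_of_lt hs)) ?_
  filter_upwards [Ico_mem_nhdsLT hr] with s hs
  rw [slope_def_field, h₀]
  exact div_nonneg_of_nonpos (by linarith [hneg s hs]) (by linarith [hs.2])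

/-- A continuous function on a compact rectangle, negative at time `0` and nonnegative
somewhere, has a first time at which it vanishes. -/
theorem exists_first_touching {w : ℝ → ℝ → ℝ} {t₁ l r : ℝ}
    (hw : ContinuousOn (fun z : ℝ × ℝ => w z.1 z.2) (Icc 0 t₁ ×ˢ Icc l r))
    (hinit : ∀ x ∈ Icc l r, w 0 x < 0)
    (hex : ∃ t ∈ Icc 0 t₁, ∃ x ∈ Icc l r, 0 ≤ w t x) :
    ∃ t ∈ Ioc 0 t₁, ∃ x ∈ Icc l r, w t x = 0 ∧ (∀ y ∈ Icc l r, w t y ≤ 0) ∧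
      ∀ s ∈ Ico 0 t, w s x < 0 := by
  have hK : IsCompact ((Icc 0 t₁ ×ˢ Icc l r) ∩ (fun z : ℝ × ℝ => w z.1 z.2) ⁻¹' Ici 0) :=
    (isCompact_Icc.prod isCompact_Icc).of_isClosed_subset
      (hw.preimage_isClosed_of_isClosed (isClosed_Icc.prod isClosed_Icc) isClosed_Ici)
      inter_subset_left
  obtain ⟨t', ht', x', hx', hpos⟩ := hex
  obtain ⟨⟨t, x⟩, ⟨⟨ht, hx⟩, htx⟩, hmin⟩ :=
    hK.exists_isMinOn ⟨(t', x'), ⟨ht', hx'⟩, hpos⟩ continuous_fst.continuousOn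
  simp only [mem_preimage, mem_Ici] at ht hx htx
  have ht0 : 0 < t := by
    rcases ht.1.eq_or_lt with h | h
    · subst h
      exact absurd (hinit x hx) (not_lt.2 htx)
    · exact h
  have hlt : ∀ s ∈ Ico 0 t, ∀ y ∈ Icc l r, w s y < 0 := by
    intro s hs y hy
    by_contra! h
    have : t ≤ s := hmin (show (s, y) ∈ _ from ⟨⟨⟨hs.1, hs.2.le.trans ht.2⟩, hy⟩, h⟩)
    exact absurd hs.2 (not_lt.2 this)
  have hle : ∀ y ∈ Icc l r, w t y ≤ 0 := by
    intro y hy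
    have hcont : ContinuousWithinAt (fun s => w s y) (Icc 0 t₁) t :=
      (hw (t, y) ⟨ht, hy⟩).comp (f := fun s => (s, y))
        (by fun_prop : Continuous fun s : ℝ => (s, y)).continuousWithinAt fun s hs => ⟨hs, hy⟩
    have hcont' : Filter.Tendsto (fun s => w s y) (nhdsWithin t (Iio t)) (nhds (w t y)) :=
      hcont.mono_left (nhdsWithin_le_of_mem
        (Filter.mem_of_superset (Ico_mem_nhdsLT ht0) fun s hs => ⟨hs.1, hs.2.le.trans ht.2⟩))
    refine le_of_tendsto hcont' ?_
    filter_upwards [Ico_mem_nhdsLT ht0] with s hs using (hlt s hs y hy).le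
  exact ⟨t, ⟨ht0, ht.2⟩, x, hx, le_antisymm (hle x hx) htx, hle, fun s hs => hlt s hs x hx⟩

/-- The spatial part of the flow at a point where a graph with value `u`, slope `u₁` and second
derivative `u₂` touches the hyperbola `x² = A y² + β²` from one side. -/
theorem hyperbola_touching_spatial_bound {n : ℕ} (hn : 2 ≤ n) {A β x u u₁ u₂ : ℝ}
    (hA : 0 < A) (hβ : 0 < β) (hu : x ^ 2 - A * u ^ 2 - β ^ 2 = 0) (hu₁ : A * (u * u₁) = x)
    (hx : 0 < x) (hu₂ : 1 - A * u₁ ^ 2 - A * (u * u₂) ≤ 0) :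
    β ^ 4 * (1 - A) / ((x ^ 2 + u ^ 2) * (A ^ 2 * u ^ 2 + x ^ 2)) ≤
      A * u * (u₂ / (1 + u₁ ^ 2) + ((n : ℝ) - 1) * (x * u₁ - u) / (x ^ 2 + u ^ 2)) := by
  have hu0 : u ≠ 0 := by
    rintro rfl
    simp at hu₁
    exact hx.ne hu₁
  have hn' : (1 : ℝ) ≤ (n : ℝ) - 1 := by
    have : (2 : ℝ) ≤ n := by exact_mod_cast hn
    linarith
  have hP : 0 < x ^ 2 + u ^ 2 := by positivity
  have hQ : 0 < A ^ 2 * u ^ 2 + x ^ 2 := by positivity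
  have hR : 0 < 1 + u₁ ^ 2 := by positivity
  have hkey : A * (u * (x * u₁ - u)) = β ^ 2 := by
    linear_combination x * hu₁ + hu
  have hRQ : (1 + u₁ ^ 2) * (A ^ 2 * u ^ 2) = A ^ 2 * u ^ 2 + x ^ 2 := by
    linear_combination (A * (u * u₁) + x) * hu₁
  have hlow : (1 - A * u₁ ^ 2) * (A * u ^ 2) = -β ^ 2 := by
    linear_combination -(A * (u * u₁) + x) * hu₁ - hu
  have h₁ : -(A * β ^ 2) / (A ^ 2 * u ^ 2 + x ^ 2) ≤ A * u * u₂ / (1 + u₁ ^ 2) := by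
    have hAu : 0 < A ^ 2 * u ^ 2 := by positivity
    rw [← hRQ, ← div_div, div_right_comm]
    apply div_le_div_of_nonneg_right _ hR.le
    rw [div_le_iff₀ hAu]
    have h := mul_le_mul_of_nonneg_right hu₂ hAu.le
    have h' : (1 - A * u₁ ^ 2) * (A ^ 2 * u ^ 2) = -(A * β ^ 2) := by
      linear_combination A * hlow
    linarith
  have h₂ : β ^ 2 / (x ^ 2 + u ^ 2) ≤
      A * u * (((n : ℝ) - 1) * (x * u₁ - u)) / (x ^ 2 + u ^ 2) := by
    apply div_le_div_of_nonneg_right _ hP.le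
    have : A * u * (((n : ℝ) - 1) * (x * u₁ - u)) = ((n : ℝ) - 1) * β ^ 2 := by
      linear_combination ((n : ℝ) - 1) * hkey
    rw [this]
    exact le_mul_of_one_le_left (by positivity) hn'
  have h₃ : β ^ 4 * (1 - A) / ((x ^ 2 + u ^ 2) * (A ^ 2 * u ^ 2 + x ^ 2)) =
      -(A * β ^ 2) / (A ^ 2 * u ^ 2 + x ^ 2) + β ^ 2 / (x ^ 2 + u ^ 2) := by
    field_simp
    linear_combination -(1 - A) * hu
  rw [h₃, mul_add, mul_div_assoc', mul_div_assoc']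
  exact add_le_add h₁ h₂

set_option maxHeartbeats 1000000 in
/-- The speed of the hyperbolas is strictly smaller than the speed of the flow at a touching
point. -/
theorem hyperbola_speed_lt {a binf b₀ k β x u s : ℝ} (h1 : 1 < binf) (h3 : b₀ < a) (hk : 0 < k)
    (hβ : binf < β) (hβ₀ : β ≤ b₀) (hxa : x < a) (hx : 0 < x)
    (hu : x ^ 2 - (a ^ 2 - β ^ 2) / (a ^ 2 - binf ^ 2) * u ^ 2 - β ^ 2 = 0)
    (hs : k * (x - 1) * (a - x) ≤ s) :
    k * binf * (binf - 1) * (a ^ 2 - b₀ ^ 2) /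
          (a * (a ^ 2 - binf ^ 2) * (2 * a ^ 2 - binf ^ 2) ^ 2) *
        (β - binf) * β ^ 4 * (1 - u ^ 2 / (a ^ 2 - binf ^ 2)) <
      s * (β ^ 4 * (1 - (a ^ 2 - β ^ 2) / (a ^ 2 - binf ^ 2)) /
        ((x ^ 2 + u ^ 2) * (((a ^ 2 - β ^ 2) / (a ^ 2 - binf ^ 2)) ^ 2 * u ^ 2 + x ^ 2))) := by
  have ha : 0 < a := hx.trans hxa
  have hD : 0 < a ^ 2 - binf ^ 2 := by nlinarith
  have hE : 0 < a ^ 2 - β ^ 2 := by nlinarith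
  have hE₀ : 0 < a ^ 2 - b₀ ^ 2 := by nlinarith
  have hEE : a ^ 2 - b₀ ^ 2 ≤ a ^ 2 - β ^ 2 := by nlinarith
  set D := a ^ 2 - binf ^ 2 with hDdef
  set A := (a ^ 2 - β ^ 2) / D with hAdef
  have hA : 0 < A := div_pos hE hD
  have hAD : A * D = a ^ 2 - β ^ 2 := div_mul_cancel₀ _ hD.ne'
  have hA1 : A < 1 := by rw [hAdef, div_lt_one hD]; nlinarith
  have hxβ : β ≤ x := by
    have : 0 ≤ A * u ^ 2 := by positivity
    exact le_of_sq_le_sq (by nlinarith) hx.le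
  have hone : 1 - A = (β + binf) * (β - binf) / D := by
    rw [hAdef]; field_simp; rw [hDdef]; ring
  have hgap : 1 - u ^ 2 / D = (a + x) * (a - x) / (a ^ 2 - β ^ 2) := by
    rw [← hAD]; field_simp; linear_combination hAD + hu
  have hu2 : u ^ 2 ≤ D := by
    have : A * u ^ 2 ≤ A * D := by nlinarith
    exact le_of_mul_le_mul_left this hA
  set M := 2 * a ^ 2 - binf ^ 2 with hM
  have hMD : M = a ^ 2 + D := by rw [hM, hDdef]; ring
  have hMpos : 0 < M := by rw [hMD]; positivity
  have hx2 : x ^ 2 ≤ a ^ 2 := by nlinarith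
  have hP : x ^ 2 + u ^ 2 ≤ M := by linarith
  have hQ : A ^ 2 * u ^ 2 + x ^ 2 ≤ M := by
    have : A ^ 2 * u ^ 2 ≤ 1 * u ^ 2 := by
      apply mul_le_mul_of_nonneg_right _ (sq_nonneg u)
      nlinarith
    linarith
  have hPpos : 0 < x ^ 2 + u ^ 2 := by positivity
  have hQpos : 0 < A ^ 2 * u ^ 2 + x ^ 2 := by positivity
  have hβ0 : 0 < β := by linarith
  have hd : 0 < β - binf := by linarith
  have hax : 0 < a - x := by linarith
  have hB : 0 < binf := by linarith
  have hB1 : 0 < binf - 1 := by linarith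
  have hx1 : binf - 1 < x - 1 := by linarith
  set C := k * (a - x) * (β - binf) * β ^ 4 / (D * M ^ 2) with hC
  have hCpos : 0 < C := by positivity
  have hleft : k * binf * (binf - 1) * (a ^ 2 - b₀ ^ 2) / (a * D * M ^ 2) *
      (β - binf) * β ^ 4 * (1 - u ^ 2 / D) =
      C * (binf * (binf - 1) * ((a + x) / a) * ((a ^ 2 - b₀ ^ 2) / (a ^ 2 - β ^ 2))) := by
    rw [hgap, hC]; field_simp
  have hright : C * ((x - 1) * (β + binf)) ≤
      s * (β ^ 4 * (1 - A) / ((x ^ 2 + u ^ 2) * (A ^ 2 * u ^ 2 + x ^ 2))) := by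
    have h : C * ((x - 1) * (β + binf)) =
        k * (x - 1) * (a - x) * (β ^ 4 * (1 - A) / M ^ 2) := by
      rw [hone, hC]; field_simp
    rw [h]
    have hnum : 0 ≤ β ^ 4 * (1 - A) := mul_nonneg (by positivity) (by linarith)
    have hs0 : 0 ≤ k * (x - 1) * (a - x) :=
      mul_nonneg (mul_nonneg hk.le (by linarith)) hax.le
    refine mul_le_mul hs (div_le_div_of_nonneg_left hnum (by positivity) ?_)
      (by positivity) (hs0.trans hs)
    rw [sq M]
    exact mul_le_mul hP hQ hQpos.le hMpos.le
  rw [hleft]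
  refine lt_of_lt_of_le (mul_lt_mul_of_pos_left ?_ hCpos) hright
  have hr₁ : (a + x) / a ≤ 2 := by rw [div_le_iff₀ ha]; linarith
  have hr₂ : (a ^ 2 - b₀ ^ 2) / (a ^ 2 - β ^ 2) ≤ 1 := by rwa [div_le_one hE]
  calc binf * (binf - 1) * ((a + x) / a) * ((a ^ 2 - b₀ ^ 2) / (a ^ 2 - β ^ 2))
      ≤ binf * (binf - 1) * 2 * 1 := by gcongr
    _ < (x - 1) * (β + binf) := by nlinarith

/-- The first and second order conditions for a graph which at an interior point touches the
hyperbola `x² = A y² + c` from one side. -/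
theorem hyperbola_touching_derivatives {l r A c x : ℝ} {v : ℝ → ℝ}
    (hv : ContDiffOn ℝ 2 v (Icc l r)) (hx : x ∈ Ioo l r) (h₀ : x ^ 2 - A * v x ^ 2 - c = 0)
    (hle : ∀ y ∈ Icc l r, y ^ 2 - A * v y ^ 2 - c ≤ 0) :
    A * (v x * derivWithin v (Icc l r) x) = x ∧
      1 - A * derivWithin v (Icc l r) x ^ 2 -
        A * (v x * derivWithin (derivWithin v (Icc l r)) (Icc l r) x) ≤ 0 := by
  have hnhds : Icc l r ∈ nhds x := Icc_mem_nhds hx.1 hx.2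
  have heq : derivWithin v (Icc l r) =ᶠ[nhds x] deriv v := by
    filter_upwards [Ioo_mem_nhds hx.1 hx.2] with y hy
      using derivWithin_of_mem_nhds (Icc_mem_nhds hy.1 hy.2)
  rw [derivWithin_of_mem_nhds (f := derivWithin v (Icc l r)) hnhds, heq.deriv_eq, heq.eq_of_nhds]
  have hcd : ContDiffAt ℝ 2 v x := hv.contDiffAt hnhds
  have hd₁ : ∀ᶠ y in nhds x, HasDerivAt v (deriv v y) y := by
    filter_upwards [hcd.eventually (by simp)] with y hy
      using (hy.differentiableAt (by simp)).hasDerivAt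
  have hd₂ : HasDerivAt (deriv v) (deriv (deriv v) x) x :=
    ((hcd.derivWithin (m := 1) (by norm_num)).differentiableAt (by simp)).hasDerivAt
  have hw₁ : ∀ᶠ y in nhds x, HasDerivAt (fun y => y ^ 2 - A * v y ^ 2 - c)
      (2 * y - 2 * A * (v y * deriv v y)) y := by
    filter_upwards [hd₁] with y hy
    refine ((((hasDerivAt_id y).pow 2).sub ((hy.pow 2).const_mul A)).sub_const c).congr_deriv ?_
    simp only [id_eq]
    push_cast
    ring
  have hw₂ : HasDerivAt (deriv fun y => y ^ 2 - A * v y ^ 2 - c)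
      (2 - 2 * A * (deriv v x * deriv v x + v x * deriv (deriv v) x)) x := by
    refine HasDerivAt.congr_of_eventuallyEq ?_ (hw₁.mono fun y hy => hy.deriv)
    refine (((hasDerivAt_id x).const_mul 2).sub
      ((hd₁.self_of_nhds.mul hd₂).const_mul (2 * A))).congr_deriv ?_
    rw [mul_one]
  have hmax : IsLocalMax (fun y => y ^ 2 - A * v y ^ 2 - c) x := by
    filter_upwards [hnhds] with y hy
    rw [h₀]
    exact hle y hy
  have e₁ := hmax.hasDerivAt_eq_zero hw₁.self_of_nhds
  have e₂ := hmax.deriv_deriv_nonpos hw₁.self_of_nhds.continuousAt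
  rw [hw₂.deriv] at e₂
  constructor
  · linarith
  · linarith

/-- The time derivative of the defining function of the hyperbolas along a graph. -/
theorem hasDerivAt_hyperbola_defining {a D x β' u' t : ℝ} {b u : ℝ → ℝ}
    (hb : HasDerivAt b β' t) (hu : HasDerivAt u u' t) :
    HasDerivAt (fun s => x ^ 2 - (a ^ 2 - b s ^ 2) / D * u s ^ 2 - b s ^ 2)
      (-(2 * b t * β' * (1 - u t ^ 2 / D)) - 2 * ((a ^ 2 - b t ^ 2) / D * u t * u')) t := by
  refine ((((((hb.pow 2).const_sub (a ^ 2)).div_const D).mul (hu.pow 2)).const_sub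
    (x ^ 2)).sub (hb.pow 2)).congr_deriv ?_
  simp only [Pi.pow_apply]
  push_cast
  ring

/-- **Hyperbola avoidance** (Proposition 3.3, graphical form).  If the graph of the initial
data `f(0,·)` is disjoint from the hyperbola `x = g(0,y)`, then the graphs of `f(t,·)` and
the evolving hyperbolas `x = g(t,y)` remain disjoint for all `t ∈ [0,T)`. -/
theorem hyperbola_avoidance (n : ℕ) (hn : 2 ≤ n) (a binf b₀ k T p q : ℝ)
    (h1 : 1 < binf) (h2 : binf < b₀) (h3 : b₀ < a) (hk : 0 < k)
    (σ : ℝ → ℝ) (hσ : ∀ x ∈ Icc 1 a, k * (x - 1) * (a - x) ≤ σ x)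
    (b : ℝ → ℝ) (hb0 : b 0 = b₀)
    (hb : ∀ t ∈ Ico (0 : ℝ) T, binf < b t ∧ b t ≤ b₀)
    (hODE : ∀ t ∈ Ico (0 : ℝ) T,
      HasDerivWithinAt b
        (-(k * binf * (binf - 1) * (a ^ 2 - b₀ ^ 2) /
              (a * (a ^ 2 - binf ^ 2) * (2 * a ^ 2 - binf ^ 2) ^ 2)) *
          (b t - binf) * b t ^ 3) (Ico 0 T) t)
    (f : ℝ → ℝ → ℝ)
    (hf : ContDiffOn ℝ (⊤ : ℕ∞) (fun pt : ℝ × ℝ => f pt.1 pt.2) (Ico 0 T ×ˢ Icc 1 a))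
    (hflow : ∀ t ∈ Ico (0 : ℝ) T, ∀ x ∈ Icc 1 a,
      derivWithin (fun s => f s x) (Ico 0 T) t = flowRHS n a σ f t x)
    (hbdry : ∀ t ∈ Ico (0 : ℝ) T, f t 1 = q ∧ f t a = p)
    (hp : Real.sqrt (a ^ 2 - binf ^ 2) < p)
    (hinit : ∀ x ∈ Icc 1 a,
      ∀ y ∈ Icc (-Real.sqrt (a ^ 2 - binf ^ 2)) (Real.sqrt (a ^ 2 - binf ^ 2)),
        ¬(x = hyperbolaBarrier a binf b 0 y ∧ f 0 x = y)) :
    ∀ t ∈ Ico (0 : ℝ) T, ∀ x ∈ Icc 1 a,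
      ∀ y ∈ Icc (-Real.sqrt (a ^ 2 - binf ^ 2)) (Real.sqrt (a ^ 2 - binf ^ 2)),
        ¬(x = hyperbolaBarrier a binf b t y ∧ f t x = y) := by
  intro t₁ ht₁
  have hT0 : (0 : ℝ) ∈ Ico 0 T := ⟨le_rfl, ht₁.1.trans_lt ht₁.2⟩
  have h1a : 1 ≤ a := by linarith
  have hD : 0 < a ^ 2 - binf ^ 2 := by nlinarith
  have hE : ∀ t ∈ Ico (0 : ℝ) T, 0 < a ^ 2 - b t ^ 2 := fun t ht => by
    obtain ⟨h, h'⟩ := hb t ht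
    nlinarith
  set w : ℝ → ℝ → ℝ := fun t x =>
    x ^ 2 - (a ^ 2 - b t ^ 2) / (a ^ 2 - binf ^ 2) * f t x ^ 2 - b t ^ 2 with hw
  have hw_cont : ContinuousOn (fun z : ℝ × ℝ => w z.1 z.2) (Ico 0 T ×ˢ Icc 1 a) := by
    have hbc : ContinuousOn (fun z : ℝ × ℝ => b z.1) (Ico 0 T ×ˢ Icc 1 a) :=
      ContinuousOn.comp (g := b) (t := Ico 0 T)
        (fun t ht => (hODE t ht).continuousWithinAt) continuous_fst.continuousOn
        fun z hz => hz.1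
    exact (((continuous_snd.pow 2).continuousOn).sub
      (((continuousOn_const.sub (hbc.pow 2)).div_const _).mul (hf.continuousOn.pow 2))).sub
      (hbc.pow 2)
  have hslice : ∀ t ∈ Ico (0 : ℝ) T, ContDiffOn ℝ 2 (f t) (Icc 1 a) := fun t ht =>
    (hf.of_le (WithTop.coe_le_coe.2 le_top)).comp (f := fun x => (t, x))
      (contDiff_const.prodMk contDiff_id).contDiffOn fun x hx => ⟨ht, hx⟩
  have hw_left : ∀ t ∈ Ico (0 : ℝ) T, w t 1 < 0 := fun t ht => by
    have h : 0 ≤ (a ^ 2 - b t ^ 2) / (a ^ 2 - binf ^ 2) * f t 1 ^ 2 :=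
      mul_nonneg (div_nonneg (hE t ht).le hD.le) (sq_nonneg _)
    have := (hb t ht).1
    simp only [hw]
    nlinarith
  have hw_right : ∀ t ∈ Ico (0 : ℝ) T, w t a < 0 := fun t ht => by
    have hp2 : a ^ 2 - binf ^ 2 < p ^ 2 := (Real.sqrt_lt' ((Real.sqrt_nonneg _).trans_lt hp)).1 hp
    have h := mul_lt_mul_of_pos_left hp2 (div_pos (hE t ht) hD)
    rw [div_mul_cancel₀ _ hD.ne'] at h
    simp only [hw, (hbdry t ht).2]
    linarith
  have hw_zero : ∀ x ∈ Icc 1 a, w 0 x < 0 := by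
    intro x hx
    by_contra! hpos
    have hcont : ContinuousOn (w 0) (Icc 1 x) :=
      hw_cont.comp (f := fun y => ((0 : ℝ), y)) (by fun_prop)
        fun y hy => ⟨hT0, hy.1, hy.2.trans hx.2⟩
    obtain ⟨y, hy, hy0⟩ := intermediate_value_Icc hx.1 hcont ⟨(hw_left 0 hT0).le, hpos⟩
    have hya : y ≤ a := hy.2.trans hx.2
    have hy0' : y ^ 2 - (a ^ 2 - b 0 ^ 2) / (a ^ 2 - binf ^ 2) * f 0 y ^ 2 - b 0 ^ 2 = 0 := hy0
    refine hinit y ⟨hy.1, hya⟩ (f 0 y) ?_ ⟨?_, rfl⟩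
    · have hsq : f 0 y ^ 2 ≤ a ^ 2 - binf ^ 2 := by
        refine le_of_mul_le_mul_left ?_ (div_pos (hE 0 hT0) hD)
        rw [div_mul_cancel₀ _ hD.ne']
        nlinarith [hy.1]
      exact abs_le.1 (Real.abs_le_sqrt hsq)
    · rw [hyperbolaBarrier, eq_comm, Real.sqrt_eq_iff_mul_self_eq_of_pos (by linarith [hy.1])]
      linarith
  suffices hmain : ∀ x ∈ Icc 1 a, w t₁ x < 0 by
    rintro x hx y - ⟨hxy, hfy⟩
    refine (hmain x hx).ne ?_
    have h : x ^ 2 = (a ^ 2 - b t₁ ^ 2) / (a ^ 2 - binf ^ 2) * y ^ 2 + b t₁ ^ 2 := by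
      rw [hxy, hyperbolaBarrier, Real.sq_sqrt]
      exact add_nonneg (mul_nonneg (div_nonneg (hE t₁ ht₁).le hD.le) (sq_nonneg _))
        (sq_nonneg _)
    simp only [hw, hfy]
    linarith
  intro x₁ hx₁
  by_contra! hpos
  obtain ⟨t, ht, x, hx, h₀, hle, hbefore⟩ := exists_first_touching
    (hw_cont.mono (prod_mono_left fun s hs => ⟨hs.1, hs.2.trans_lt ht₁.2⟩)) hw_zero
    ⟨t₁, ⟨ht₁.1, le_rfl⟩, x₁, hx₁, hpos⟩
  have htT : t ∈ Ico (0 : ℝ) T := ⟨ht.1.le, ht.2.trans_lt ht₁.2⟩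
  have htn : Ico (0 : ℝ) T ∈ nhds t := Ico_mem_nhds ht.1 htT.2
  have hx1 : 1 < x := hx.1.lt_of_ne (by rintro rfl; exact (hw_left t htT).ne h₀)
  have hxa : x < a := hx.2.lt_of_ne (by rintro rfl; exact (hw_right t htT).ne h₀)
  obtain ⟨hu₁, hu₂⟩ := hyperbola_touching_derivatives (hslice t htT) ⟨hx1, hxa⟩ h₀ hle
  have hft : HasDerivAt (fun s => f s x) (flowRHS n a σ f t x) t := by
    rw [← hflow t htT x hx]
    refine DifferentiableWithinAt.hasDerivWithinAt ?_ |>.hasDerivAt htn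
    exact ((hf.differentiableOn (by simp)).comp (f := fun s : ℝ => (s, x)) (s := Ico 0 T)
      (by fun_prop) fun s hs => ⟨hs, hx⟩) t htT
  have hwt := (hasDerivAt_hyperbola_defining (a := a) (D := a ^ 2 - binf ^ 2) (x := x)
    ((hODE t htT).hasDerivAt htn) hft).nonneg_of_neg_left ht.1 h₀ hbefore
  obtain ⟨hβ, hβ₀⟩ := hb t htT
  have hspace := hyperbola_touching_spatial_bound hn (div_pos (hE t htT) hD)
    (by linarith : 0 < b t) h₀ hu₁ (by linarith) hu₂
  have hspeed := hyperbola_speed_lt h1 h3 hk hβ hβ₀ hxa (by linarith) h₀ (hσ x hx)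
  have hσ0 : 0 ≤ σ x := le_trans
    (mul_nonneg (mul_nonneg hk.le (by linarith)) (by linarith)) (hσ x hx)
  have hflow_le := mul_le_mul_of_nonneg_left hspace hσ0
  rw [flowRHS] at hwt
  linarith
end

section
/- Shrinking circle avoidance (Proposition 3.4): Let n ≥ 2 be an integer, R > 1, a = 6R, and let σ : [1,a] → ℝ satisfy 0 ≤ σ(x) < R for all x ∈ [1,a]. Then there exists Y ∈ ℝ such that for every y₀ ≤ Y the following holds: if f : [0,T) × [1,a] → ℝ is a smooth solution of ∂_t f = σ(x)·( (∂_xx f)/(1 + (∂_x f)²) + (n−1)·(x·∂_x f − f)/(x² + f²) ) with T ≤ R/4, and the graph of f(0,·) is disjoint from the closed ball of radius R centered at (3R, y₀) (i.e. (x−3R)² + (f(0,x)−y₀)² > R² for all x ∈ [1,a]), then for every t ∈ [0,T) and every x ∈ [1,a] one has (x−3R)² + (f(t,x)−y₀)² > R² − 4Rt; that is, the graph of f(t,·) stays disjoint from the shrinking ball of radius sqrt(R² − 4Rt) centered at (3R, y₀). -/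
open Real Set

open Filter Topology

/-- The second derivative is nonnegative at a local minimum. -/
theorem IsLocalMin.deriv_deriv_nonneg {g : ℝ → ℝ} {x : ℝ} (h : IsLocalMin g x)
    (hc : ContinuousAt g x) : 0 ≤ deriv (deriv g) x := by
  by_contra! hneg
  have hmax := isLocalMax_of_deriv_deriv_neg hneg h.deriv_eq_zero hc
  have hconst : g =ᶠ[𝓝 x] fun _ => g x := by
    filter_upwards [h, hmax] with y hy hy'
    exact le_antisymm hy' hy
  have hzero := hconst.deriv.deriv_eq
  simp at hzero
  exact hneg.ne hzero

/-- A function which attains its minimum over `[0, t]` at the right end point has a nonpositive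
derivative there. -/
theorem HasDerivWithinAt.nonpos_of_isMinOn_Icc {g : ℝ → ℝ} {g' t : ℝ} (ht : 0 < t)
    (hg : HasDerivWithinAt g g' (Icc 0 t) t) (hmin : IsMinOn g (Icc 0 t) t) : g' ≤ 0 := by
  have hcone : (0 : ℝ) - t ∈ posTangentConeAt (Icc 0 t) t :=
    sub_mem_posTangentConeAt_of_segment_subset
      ((convex_Icc 0 t).segment_subset (right_mem_Icc.2 ht.le) (left_mem_Icc.2 ht.le))
  have hnonneg := hmin.localize.hasFDerivWithinAt_nonneg hg.hasFDerivWithinAt hcone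
  simp at hnonneg
  nlinarith

/-- First and second order conditions for the squared distance from `(c, y₀)` to the graph of `h`
at a local minimum. -/
theorem deriv_conditions_of_isLocalMin_sq_dist {h : ℝ → ℝ} {c y₀ x : ℝ}
    (hh : ContDiffAt ℝ 2 h x)
    (hmin : IsLocalMin (fun z => (z - c) ^ 2 + (h z - y₀) ^ 2) x) :
    (x - c) + (h x - y₀) * deriv h x = 0 ∧
      0 ≤ 1 + (deriv h x) ^ 2 + (h x - y₀) * deriv (deriv h) x := by
  have hq : ∀ z, DifferentiableAt ℝ h z →
      HasDerivAt (fun z => (z - c) ^ 2 + (h z - y₀) ^ 2)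
        (2 * ((z - c) + (h z - y₀) * deriv h z)) z := by
    intro z hz
    have := (((hasDerivAt_id z).sub_const c).pow 2).add ((hz.hasDerivAt.sub_const y₀).pow 2)
    refine this.congr_deriv ?_
    simp
    ring
  have hdiff : ∀ᶠ z in 𝓝 x, DifferentiableAt ℝ h z := by
    filter_upwards [hh.eventually (by simp)] with z hz
    exact hz.differentiableAt (by simp)
  have hderiv : deriv (fun z => (z - c) ^ 2 + (h z - y₀) ^ 2) =ᶠ[𝓝 x]
      fun z => 2 * ((z - c) + (h z - y₀) * deriv h z) :=
    hdiff.mono fun z hz => (hq z hz).deriv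
  have hd := hdiff.self_of_nhds
  have hd2 : DifferentiableAt ℝ (deriv h) x :=
    ((hh.fderiv_right (m := 1) (by norm_num)).differentiableAt (by simp)).clm_apply
      (differentiableAt_const (1 : ℝ))
  have hfirst := hmin.deriv_eq_zero
  rw [(hq x hd).deriv] at hfirst
  have hsecond := hmin.deriv_deriv_nonneg (hq x hd).continuousAt
  have hq2 : HasDerivAt (fun z => 2 * ((z - c) + (h z - y₀) * deriv h z))
      (2 * (1 + (deriv h x) ^ 2 + (h x - y₀) * deriv (deriv h) x)) x := by
    have := (((hasDerivAt_id x).sub_const c).add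
      ((hd.hasDerivAt.sub_const y₀).mul hd2.hasDerivAt)).const_mul 2
    refine this.congr_deriv ?_
    ring
  rw [hderiv.deriv_eq, hq2.deriv] at hsecond
  constructor <;> linarith

/-- Pointwise speed estimate: at a point of contact, the normal speed of the flow is strictly less
than that of the shrinking circle. Here `u` and `w` are the coordinates relative to the center,
`p` and `q` the first and second derivatives, and `v` the height of the graph. -/
theorem neg_two_mul_lt_contact_speed {m R s x u v w p q : ℝ} (hm : 0 ≤ m) (hR : 0 < R)
    (hs : 0 ≤ s) (hsR : s < R) (hx : 0 < x) (huw : u ^ 2 + w ^ 2 ≤ R ^ 2) (hv : v ≤ -(m * R))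
    (hfirst : u + w * p = 0) (hsecond : 0 ≤ 1 + p ^ 2 + w * q) :
    -(2 * R) < w * (s * (q / (1 + p ^ 2) + m * (x * p - v) / (x ^ 2 + v ^ 2))) := by
  have hp : 0 < 1 + p ^ 2 := by positivity
  have hxv : 0 < x ^ 2 + v ^ 2 := by positivity
  have hcurv : -1 ≤ w * q / (1 + p ^ 2) := by
    rw [le_div_iff₀ hp]
    linarith
  have hv2 : m ^ 2 * R ^ 2 ≤ v ^ 2 := by
    have : 0 ≤ m * R := by positivity
    nlinarith
  have hext : -1 ≤ w * (m * (x * p - v)) / (x ^ 2 + v ^ 2) := by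
    rw [le_div_iff₀ hxv]
    have hwp : w * (m * (x * p - v)) = -(m * u * x + m * w * v) := by
      linear_combination m * x * hfirst
    have hmuw := mul_le_mul_of_nonneg_left huw (sq_nonneg m)
    nlinarith [sq_nonneg (x - m * u), sq_nonneg (v - m * w), sq_nonneg x]
  have hsum : w * (s * (q / (1 + p ^ 2) + m * (x * p - v) / (x ^ 2 + v ^ 2))) =
      s * (w * q / (1 + p ^ 2) + w * (m * (x * p - v)) / (x ^ 2 + v ^ 2)) := by
    ring
  rw [hsum]
  nlinarith

/-- If `G` is continuous on `[0, T) × [a, b]`, positive at time `0`, and nonpositive somewhere, then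
there is a first time at which it vanishes, and it vanishes there at a minimum. -/
theorem exists_first_zero {G : ℝ → ℝ → ℝ} {T a b : ℝ}
    (hG : ContinuousOn (fun p : ℝ × ℝ => G p.1 p.2) (Ico 0 T ×ˢ Icc a b))
    (h0 : ∀ x ∈ Icc a b, 0 < G 0 x) {t₁ x₁ : ℝ} (ht₁ : t₁ ∈ Ico 0 T) (hx₁ : x₁ ∈ Icc a b)
    (hneg : G t₁ x₁ ≤ 0) :
    ∃ t ∈ Ioo 0 T, ∃ x ∈ Icc a b, G t x = 0 ∧ (∀ z ∈ Icc a b, 0 ≤ G t z) ∧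
      ∀ s ∈ Icc 0 t, 0 ≤ G s x := by
  have hsub : Icc 0 t₁ ×ˢ Icc a b ⊆ Ico 0 T ×ˢ Icc a b :=
    prod_mono (Icc_subset_Ico_right ht₁.2) subset_rfl
  have hK : IsCompact ((Icc 0 t₁ ×ˢ Icc a b) ∩ (fun p : ℝ × ℝ => G p.1 p.2) ⁻¹' Iic 0) :=
    (isCompact_Icc.prod isCompact_Icc).of_isClosed_subset
      ((hG.mono hsub).preimage_isClosed_of_isClosed (isClosed_Icc.prod isClosed_Icc) isClosed_Iic)
      inter_subset_left
  obtain ⟨⟨t, x⟩, ⟨⟨ht, hx⟩, hGle⟩, hfirst⟩ :=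
    hK.exists_isMinOn ⟨(t₁, x₁), ⟨⟨right_mem_Icc.2 ht₁.1, hx₁⟩, hneg⟩⟩ continuous_fst.continuousOn
  simp only [mem_preimage, mem_Iic] at ht hx hGle
  have htT : t < T := ht.2.trans_lt ht₁.2
  have htpos : 0 < t := by
    rcases ht.1.eq_or_lt with rfl | h
    · exact absurd (h0 x hx) hGle.not_gt
    · exact h
  have hbefore : ∀ s ∈ Ico 0 t, ∀ z ∈ Icc a b, 0 < G s z := by
    intro s hs z hz
    by_contra! hle
    exact hs.2.not_ge (hfirst (show ((s, z) : ℝ × ℝ) ∈ _ from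
      ⟨⟨⟨hs.1, hs.2.le.trans ht.2⟩, hz⟩, hle⟩))
  have hat : ∀ z ∈ Icc a b, 0 ≤ G t z := by
    intro z hz
    have hcont : ContinuousOn (fun s => G s z) (Ico 0 T) :=
      hG.comp (f := fun s : ℝ => (s, z)) (by fun_prop) fun s hs => ⟨hs, hz⟩
    have hleft : Tendsto (fun s => G s z) (𝓝[Ico 0 t] t) (𝓝 (G t z)) :=
      (hcont t ⟨htpos.le, htT⟩).mono (Ico_subset_Ico_right htT.le)
    have : (𝓝[Ico 0 t] t).NeBot := by
      rw [nhdsWithin_Ico_eq_nhdsLT htpos]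
      infer_instance
    exact ge_of_tendsto hleft
      (eventually_mem_nhdsWithin.mono fun s hs => (hbefore s hs z hz).le)
  refine ⟨t, ⟨htpos, htT⟩, x, hx, le_antisymm hGle (hat x hx), hat, fun s hs => ?_⟩
  rcases hs.2.eq_or_lt with rfl | h
  · exact hat x hx
  · exact (hbefore s ⟨hs.1, h⟩ x hx).le

/-- At interior points, `flowRHS` is given by ordinary derivatives. -/
theorem flowRHS_eq_of_mem_Ioo (n : ℕ) {a : ℝ} (σ : ℝ → ℝ) (f : ℝ → ℝ → ℝ) (t : ℝ) {x : ℝ}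
    (hx : x ∈ Ioo 1 a) :
    flowRHS n a σ f t x = σ x * (deriv (deriv (f t)) x / (1 + (deriv (f t) x) ^ 2) +
      ((n : ℝ) - 1) * (x * deriv (f t) x - f t x) / (x ^ 2 + (f t x) ^ 2)) := by
  have hnhds : ∀ z ∈ Ioo 1 a, Icc 1 a ∈ 𝓝 z := fun z hz => Icc_mem_nhds hz.1 hz.2
  have hev : derivWithin (f t) (Icc 1 a) =ᶠ[𝓝 x] deriv (f t) := by
    filter_upwards [isOpen_Ioo.mem_nhds hx] with z hz
    exact derivWithin_of_mem_nhds (hnhds z hz)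
  rw [flowRHS, derivWithin_of_mem_nhds (hnhds x hx), hev.deriv_eq, hev.self_of_nhds]

/-- **Shrinking circle avoidance** (Proposition 3.4).  With `a = 6R` and `0 ≤ σ < R`, there
is `Y` such that for every `y₀ ≤ Y`: any smooth solution of the reduced flow on
`[0,T) × [1,a]` with `T ≤ R/4` whose initial graph avoids the closed ball
`B_R(3R, y₀)` keeps its graph disjoint from the shrinking balls
`B_{√(R²−4Rt)}(3R, y₀)` for all `t ∈ [0,T)`. -/
theorem circle_avoidance (n : ℕ) (hn : 2 ≤ n) (R : ℝ) (hR : 1 < R)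
    (σ : ℝ → ℝ) (hσ : ∀ x ∈ Icc 1 (6 * R), 0 ≤ σ x ∧ σ x < R) :
    ∃ Y : ℝ, ∀ y₀ ≤ Y, ∀ T : ℝ, T ≤ R / 4 →
      ∀ f : ℝ → ℝ → ℝ,
        ContDiffOn ℝ (⊤ : ℕ∞) (fun pt : ℝ × ℝ => f pt.1 pt.2) (Ico 0 T ×ˢ Icc 1 (6 * R)) →
        (∀ t ∈ Ico (0 : ℝ) T, ∀ x ∈ Icc 1 (6 * R),
          derivWithin (fun s => f s x) (Ico 0 T) t = flowRHS n (6 * R) σ f t x) →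
        (∀ x ∈ Icc 1 (6 * R), R ^ 2 < (x - 3 * R) ^ 2 + (f 0 x - y₀) ^ 2) →
        ∀ t ∈ Ico (0 : ℝ) T, ∀ x ∈ Icc 1 (6 * R),
          R ^ 2 - 4 * R * t < (x - 3 * R) ^ 2 + (f t x - y₀) ^ 2 := by
  refine ⟨-(n * R), fun y₀ hy₀ T hT f hf hflow hinit t₁ ht₁ x₁ hx₁ => ?_⟩
  by_contra! hcontact
  have hR0 : 0 < R := by linarith
  have hn1 : (0 : ℝ) ≤ (n : ℝ) - 1 := by
    have : (2 : ℝ) ≤ n := by exact_mod_cast hn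
    linarith
  have hfcont := hf.continuousOn
  obtain ⟨t, ht, x, hx, hzero, hspace, htime⟩ := exists_first_zero
    (G := fun s z => (z - 3 * R) ^ 2 + (f s z - y₀) ^ 2 - (R ^ 2 - 4 * R * s))
    (T := T) (a := 1) (b := 6 * R) (by fun_prop) (fun z hz => by have := hinit z hz; linarith)
    ht₁ hx₁ (by linarith)
  have htI : t ∈ Ico 0 T := ⟨ht.1.le, ht.2⟩
  have hRt : 0 < R * t := mul_pos hR0 ht.1
  have hdist : (x - 3 * R) ^ 2 + (f t x - y₀) ^ 2 ≤ R ^ 2 := by linarith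
  have hu : |x - 3 * R| ≤ R := abs_le_of_sq_le_sq (by nlinarith [sq_nonneg (f t x - y₀)]) hR0.le
  have hw : |f t x - y₀| ≤ R := abs_le_of_sq_le_sq (by nlinarith [sq_nonneg (x - 3 * R)]) hR0.le
  rw [abs_le] at hu hw
  have hxI : x ∈ Ioo 1 (6 * R) := ⟨by linarith, by linarith⟩
  have hspatial : ContDiffAt ℝ 2 (f t) x := by
    have hslice : ContDiffOn ℝ (⊤ : ℕ∞) (f t) (Icc 1 (6 * R)) :=
      hf.comp (f := fun z : ℝ => (t, z)) (by fun_prop) fun z hz => ⟨htI, hz⟩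
    exact (hslice.contDiffAt (Icc_mem_nhds hxI.1 hxI.2)).of_le
      (WithTop.coe_le_coe.2 (le_top (a := (2 : ℕ∞))))
  have hmin : IsLocalMin (fun z => (z - 3 * R) ^ 2 + (f t z - y₀) ^ 2) x := by
    filter_upwards [Icc_mem_nhds hxI.1 hxI.2] with z hz
    have := hspace z hz
    linarith
  obtain ⟨hfirst, hsecond⟩ := deriv_conditions_of_isLocalMin_sq_dist hspatial hmin
  have htemporal : DifferentiableOn ℝ (fun s => f s x) (Ico 0 T) :=
    (hf.comp (f := fun s : ℝ => (s, x)) (by fun_prop) fun s hs => ⟨hs, hx⟩).differentiableOn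
      (by simp)
  have hft := (htemporal t htI).hasDerivWithinAt
  rw [hflow t htI x hx, flowRHS_eq_of_mem_Ioo n σ f t hxI] at hft
  have hspeed := neg_two_mul_lt_contact_speed (x := x) (v := f t x) hn1 hR0
    (hσ x hx).1 (hσ x hx).2 (by linarith [hxI.1]) hdist (by linarith) hfirst hsecond
  have hG := (((hft.mono (Icc_subset_Ico_right ht.2)).sub_const y₀).pow 2).add
    ((hasDerivWithinAt_id t (Icc 0 t)).const_mul (4 * R))
  have hnonpos := hG.nonpos_of_isMinOn_Icc ht.1 fun s hs => by
    have := htime s hs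
    simp
    linarith
  simp at hnonpos
  linarith
end

section
/- Preservation of supercritical phase (reduced form of the lemma in Section 4): Let n ≥ 2 be an integer, a > 1, σ : [1,a] → ℝ smooth with σ > 0 on (1,a) and σ(1) = σ(a) = 0, and let f : [0,T) × [1,a] → ℝ be a smooth solution of ∂_t f = σ(x)·( (∂_xx f)/(1 + (∂_x f)²) + (n−1)·(x·∂_x f − f)/(x² + f²) ). Define the reduced Lagrangian angle Θ(t,x) := (n−1)·arctan(f(t,x)/x) + arctan(∂_x f(t,x)). If Θ(0,x) > (n−2)·π/2 for all x ∈ [1,a], then Θ(t,x) > (n−2)·π/2 for all t ∈ [0,T) and all x ∈ [1,a]. -/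
open Real Set

/-- The reduced Lagrangian angle `Θ(t,x) = (n−1)·arctan(f(t,x)/x) + arctan(∂ₓf(t,x))`. -/
noncomputable def redAngle (n : ℕ) (a : ℝ) (f : ℝ → ℝ → ℝ) (t x : ℝ) : ℝ :=
  ((n : ℝ) - 1) * Real.arctan (f t x / x) + Real.arctan (derivWithin (f t) (Icc 1 a) x)

section Slices

variable {E : Type*} [NormedAddCommGroup E] [NormedSpace ℝ E] {F : ℝ × ℝ → E} {I J : Set ℝ}
  {t x : ℝ}

/-- The partial derivative in the first variable along a horizontal slice of a product set. -/
theorem DifferentiableWithinAt.hasDerivWithinAt_fst_slice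
    (hF : DifferentiableWithinAt ℝ F (I ×ˢ J) (t, x))
    (hx : x ∈ J) :
    HasDerivWithinAt (fun s => F (s, x)) (fderivWithin ℝ F (I ×ˢ J) (t, x) (1, 0)) I t := by
  have hc : HasDerivWithinAt (fun s : ℝ => (s, x)) ((1 : ℝ), (0 : ℝ)) I t :=
    (hasDerivWithinAt_id t I).prodMk (hasDerivWithinAt_const t I x)
  exact hF.hasFDerivWithinAt.comp_hasDerivWithinAt t hc fun s hs => mk_mem_prod hs hx

/-- The partial derivative in the second variable along a vertical slice of a product set. -/
theorem DifferentiableWithinAt.hasDerivWithinAt_snd_slice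
    (hF : DifferentiableWithinAt ℝ F (I ×ˢ J) (t, x))
    (ht : t ∈ I) :
    HasDerivWithinAt (fun y => F (t, y)) (fderivWithin ℝ F (I ×ˢ J) (t, x) (0, 1)) J x := by
  have hc : HasDerivWithinAt (fun y : ℝ => (t, y)) ((0 : ℝ), (1 : ℝ)) J x :=
    (hasDerivWithinAt_const x J t).prodMk (hasDerivWithinAt_id x J)
  exact hF.hasFDerivWithinAt.comp_hasDerivWithinAt x hc fun y hy => mk_mem_prod ht hy

/-- Mixed partial derivatives commute on a product set, at points of the closure of its interior. -/
theorem ContDiffOn.exists_hasDerivWithinAt_mixed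
    (hF : ContDiffOn ℝ (⊤ : ℕ∞) F (I ×ˢ J))
    (hI : UniqueDiffOn ℝ I) (hJ : UniqueDiffOn ℝ J) (ht : t ∈ I) (hx : x ∈ J)
    (hint : (t, x) ∈ closure (interior (I ×ˢ J))) :
    ∃ d, HasDerivWithinAt (fun s => fderivWithin ℝ F (I ×ˢ J) (s, x) (0, 1)) d I t ∧
      HasDerivWithinAt (fun y => fderivWithin ℝ F (I ×ˢ J) (t, y) (1, 0)) d J x := by
  have hS : UniqueDiffOn ℝ (I ×ˢ J) := hI.prod hJ
  have hmem : (t, x) ∈ I ×ˢ J := ⟨ht, hx⟩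
  have hsymm : IsSymmSndFDerivWithinAt ℝ F (I ×ˢ J) (t, x) :=
    (hF (t, x) hmem).isSymmSndFDerivWithinAt
      (by rw [minSmoothness_of_isRCLikeNormedField]; norm_cast) hS hint hmem
  have hD : DifferentiableWithinAt ℝ (fderivWithin ℝ F (I ×ˢ J)) (I ×ˢ J) (t, x) :=
    (hF.fderivWithin (m := 1) hS (by norm_cast)).differentiableOn
      one_ne_zero _ hmem
  refine ⟨_, (hD.hasDerivWithinAt_fst_slice hx).clm_apply (hasDerivWithinAt_const t I (0, 1)), ?_⟩
  refine ((hD.hasDerivWithinAt_snd_slice ht).clm_apply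
    (hasDerivWithinAt_const x J (1, 0))).congr_deriv ?_
  simpa using (hsymm.eq (1, 0) (0, 1)).symm

end Slices

/-- If `w` is minimal at `x` over `[b, a]` and `σ · w'` vanishes at `x` with `σ > 0` inside, then
the derivative of `σ · w'` at `x` is nonnegative. -/
theorem IsMinOn.deriv_weighted_deriv_nonneg {a b x p : ℝ} {σ w w' P : ℝ → ℝ} (hab : b < a)
    (hσ : ∀ y ∈ Ioo b a, 0 < σ y) (hw : ∀ y ∈ Icc b a, HasDerivWithinAt w (w' y) (Icc b a) y)
    (hP : ∀ y ∈ Icc b a, P y = σ y * w' y) (hx : x ∈ Icc b a) (hmin : IsMinOn w (Icc b a) x)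
    (hPx : P x = 0) (hp : HasDerivWithinAt P p (Icc b a) x) : 0 ≤ p := by
  by_contra! hneg
  have hslope := (hasDerivWithinAt_iff_tendsto_slope.1 hp).eventually_lt_const hneg
  rw [eventually_nhdsWithin_iff, Metric.eventually_nhds_iff] at hslope
  obtain ⟨δ, hδ, hball⟩ := hslope
  have hslope' : ∀ y ∈ Icc b a, |y - x| < δ → y ≠ x → P y / (y - x) < 0 := by
    intro y hy hyd hne
    have := hball (y := y) (by simpa [Real.dist_eq] using hyd) ⟨hy, hne⟩
    simpa [slope_def_field, hPx] using this
  have hcont : ContinuousOn w (Icc b a) := fun y hy => (hw y hy).continuousWithinAt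
  have hderiv : ∀ y ∈ Ioo b a, deriv w y = w' y := fun y hy =>
    ((hw y (Ioo_subset_Icc_self hy)).hasDerivAt (Icc_mem_nhds hy.1 hy.2)).deriv
  rcases hx.2.lt_or_eq with hxa | rfl
  · obtain ⟨z, hxz, hz⟩ := exists_between (lt_min hxa (lt_add_of_pos_right x hδ))
    rw [lt_min_iff] at hz
    have hanti : StrictAntiOn w (Icc x z) := by
      refine strictAntiOn_of_deriv_neg (convex_Icc x z)
        (hcont.mono (Icc_subset_Icc hx.1 hz.1.le)) fun y hy => ?_
      rw [interior_Icc] at hy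
      have hyI : y ∈ Ioo b a := ⟨hx.1.trans_lt hy.1, hy.2.trans hz.1⟩
      have hyC := Ioo_subset_Icc_self hyI
      have h := hslope' y hyC (by rw [abs_of_pos (sub_pos.2 hy.1)]; linarith [hy.2, hz.2])
        hy.1.ne'
      rw [div_neg_iff, hP y hyC] at h
      rw [hderiv y hyI]
      have := hσ y hyI
      rcases h with h | h
      · linarith [hy.1, h.2]
      · exact (pos_iff_neg_of_mul_neg h.1).1 this
    have h1 := hanti (left_mem_Icc.2 hxz.le) (right_mem_Icc.2 hxz.le) hxz
    exact (hmin ⟨hx.1.trans hxz.le, hz.1.le⟩ : w x ≤ w z).not_gt h1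
  · obtain ⟨z, hz, hzx⟩ := exists_between (max_lt hab (sub_lt_self x hδ))
    rw [max_lt_iff] at hz
    have hmono : StrictMonoOn w (Icc z x) := by
      refine strictMonoOn_of_deriv_pos (convex_Icc z x)
        (hcont.mono (Icc_subset_Icc hz.1.le le_rfl)) fun y hy => ?_
      rw [interior_Icc] at hy
      have hyI : y ∈ Ioo b x := ⟨hz.1.trans hy.1, hy.2⟩
      have hyC := Ioo_subset_Icc_self hyI
      have h := hslope' y hyC (by rw [abs_of_neg (sub_neg.2 hy.2)]; linarith [hy.1, hz.2])
        hy.2.ne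
      rw [div_neg_iff, hP y hyC] at h
      rw [hderiv y hyI]
      have := hσ y hyI
      rcases h with h | h
      · exact (pos_iff_pos_of_mul_pos h.1).1 this
      · linarith [hy.2, h.2]
    have h1 := hmono (left_mem_Icc.2 hzx.le) (right_mem_Icc.2 hzx.le) hzx
    exact (hmin ⟨hz.1.le, hzx.le⟩ : w x ≤ w z).not_gt h1

/-- Minimum principle: if the time derivative of `u` is nonnegative at every spatial minimum over
the compact set `K`, a strict lower bound at the initial time persists. -/
theorem lt_of_deriv_nonneg_at_spatial_min {T c : ℝ} {K : Set ℝ} (hK : IsCompact K)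
    {u : ℝ → ℝ → ℝ} (hu : ContinuousOn (fun p : ℝ × ℝ => u p.1 p.2) (Ico 0 T ×ˢ K))
    (hmin : ∀ t ∈ Ioo 0 T, ∀ x ∈ K, IsMinOn (u t) K x →
      ∃ d, 0 ≤ d ∧ HasDerivWithinAt (fun s => u s x) d (Ico 0 T) t)
    (hinit : ∀ x ∈ K, c < u 0 x) : ∀ t ∈ Ico (0 : ℝ) T, ∀ x ∈ K, c < u t x := by
  intro t ht x hx
  have hsub : Icc 0 t ×ˢ K ⊆ Ico 0 T ×ˢ K :=
    prod_mono (Icc_subset_Ico_right ht.2) subset_rfl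
  have h0 : (0 : ℝ) ∈ Ico 0 T := ⟨le_rfl, ht.1.trans_lt ht.2⟩
  obtain ⟨x₀, hx₀, hm⟩ := hK.exists_isMinOn ⟨x, hx⟩
    (hu.comp (f := fun y : ℝ => ((0 : ℝ), y)) (by fun_prop) fun y hy => ⟨h0, hy⟩)
  refine (hinit x₀ hx₀).trans_le (le_of_forall_pos_le_add fun η hη => ?_)
  obtain ⟨ε, hε, hεt⟩ : ∃ ε > 0, ε * t ≤ η := by
    refine ⟨η / (t + 1), by have := ht.1; positivity, ?_⟩
    rw [div_mul_eq_mul_div, div_le_iff₀ (by linarith [ht.1])]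
    nlinarith [ht.1]
  obtain ⟨⟨t₁, x₁⟩, ⟨ht₁, hx₁⟩, hm₁⟩ := (isCompact_Icc.prod hK).exists_isMinOn
    ⟨(t, x), right_mem_Icc.2 ht.1, hx⟩
    ((hu.mono hsub).add (g := fun p : ℝ × ℝ => ε * p.1) (by fun_prop))
  rw [isMinOn_iff] at hm₁
  have hfinal : u t₁ x₁ + ε * t₁ ≤ u t x + ε * t := hm₁ (t, x) ⟨right_mem_Icc.2 ht.1, hx⟩
  rcases ht₁.1.eq_or_lt with rfl | hpos
  · have : u 0 x₀ ≤ u 0 x₁ := hm hx₁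
    linarith
  exfalso
  have ht₁T : t₁ ∈ Ioo 0 T := ⟨hpos, ht₁.2.trans_lt ht.2⟩
  obtain ⟨d, hd, hderiv⟩ := hmin t₁ ht₁T x₁ hx₁ <| isMinOn_iff.2 fun y hy => by
    simpa using hm₁ (t₁, y) ⟨ht₁, hy⟩
  have hv : HasDerivWithinAt (fun s => u s x₁ + ε * s) (d + ε * 1) (Icc 0 t₁) t₁ :=
    (hderiv.mono (Icc_subset_Ico_right ht₁T.2)).add ((hasDerivWithinAt_id t₁ _).const_mul ε)
  have hloc : IsLocalMinOn (fun s => u s x₁ + ε * s) (Icc 0 t₁) t₁ :=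
    IsMinOn.localize <| isMinOn_iff.2 fun s hs => hm₁ (s, x₁) ⟨⟨hs.1, hs.2.trans ht₁.2⟩, hx₁⟩
  have hcone := hloc.hasFDerivWithinAt_nonneg hv.hasFDerivWithinAt
    (sub_mem_posTangentConeAt_of_segment_subset (y := 0)
      ((convex_Icc 0 t₁).segment_subset (right_mem_Icc.2 hpos.le) (left_mem_Icc.2 hpos.le)))
  simp at hcone
  nlinarith

/-- **Preservation of supercritical phase** (Section 4).  If a smooth solution of the
reduced flow has `Θ(0,x) > (n−2)π/2` for all `x ∈ [1,a]`, then
`Θ(t,x) > (n−2)π/2` for all `t ∈ [0,T)` and all `x ∈ [1,a]`. -/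
theorem supercritical_phase_preserved (n : ℕ) (hn : 2 ≤ n) (a T : ℝ) (ha : 1 < a)
    (σ : ℝ → ℝ) (hσ : ContDiffOn ℝ (⊤ : ℕ∞) σ (Icc 1 a))
    (hσpos : ∀ x ∈ Ioo 1 a, 0 < σ x) (hσ1 : σ 1 = 0) (hσa : σ a = 0)
    (f : ℝ → ℝ → ℝ)
    (hf : ContDiffOn ℝ (⊤ : ℕ∞) (fun pt : ℝ × ℝ => f pt.1 pt.2) (Ico 0 T ×ˢ Icc 1 a))
    (hflow : ∀ t ∈ Ico (0 : ℝ) T, ∀ x ∈ Icc 1 a,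
      derivWithin (fun s => f s x) (Ico 0 T) t = flowRHS n a σ f t x)
    (hinit : ∀ x ∈ Icc 1 a, redAngle n a f 0 x > ((n : ℝ) - 2) * π / 2) :
    ∀ t ∈ Ico (0 : ℝ) T, ∀ x ∈ Icc 1 a, redAngle n a f t x > ((n : ℝ) - 2) * π / 2 := by
  rcases le_or_gt T 0 with hT | hT
  · intro t ht
    exact absurd (ht.1.trans_lt ht.2) hT.not_gt
  have hI := uniqueDiffOn_Ico (0 : ℝ) T
  have hJ := uniqueDiffOn_Icc ha
  set F : ℝ × ℝ → ℝ := fun p => f p.1 p.2 with hFdef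
  set S : Set (ℝ × ℝ) := Ico 0 T ×ˢ Icc 1 a
  have hdF : ∀ p ∈ S, DifferentiableWithinAt ℝ F S p := hf.differentiableOn (by simp)
  have hfx : ∀ t ∈ Ico (0 : ℝ) T, ∀ x ∈ Icc 1 a,
      HasDerivWithinAt (f t) (fderivWithin ℝ F S (t, x) (0, 1)) (Icc 1 a) x := fun t ht x hx =>
    (hdF (t, x) ⟨ht, hx⟩).hasDerivWithinAt_snd_slice ht
  have hft : ∀ t ∈ Ico (0 : ℝ) T, ∀ x ∈ Icc 1 a,
      HasDerivWithinAt (fun s => f s x) (fderivWithin ℝ F S (t, x) (1, 0)) (Ico 0 T) t :=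
    fun t ht x hx => (hdF (t, x) ⟨ht, hx⟩).hasDerivWithinAt_fst_slice hx
  have hfx_eq : ∀ t ∈ Ico (0 : ℝ) T, ∀ x ∈ Icc 1 a,
      derivWithin (f t) (Icc 1 a) x = fderivWithin ℝ F S (t, x) (0, 1) := fun t ht x hx =>
    (hfx t ht x hx).derivWithin (hJ x hx)
  have hD : ContDiffOn ℝ 1 (fun p => fderivWithin ℝ F S p (0, 1)) S :=
    (hf.fderivWithin (m := 1) (hI.prod hJ) (by norm_cast)).clm_apply contDiffOn_const
  refine lt_of_deriv_nonneg_at_spatial_min isCompact_Icc ?_ ?_ hinit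
  · have hcont : ContinuousOn (fun p : ℝ × ℝ => ((n : ℝ) - 1) * Real.arctan (F p / p.2) +
        Real.arctan (fderivWithin ℝ F S p (0, 1))) S := by
      have hq : ContinuousOn (fun p : ℝ × ℝ => F p / p.2) S :=
        hf.continuousOn.div continuousOn_snd fun p hp => (zero_lt_one.trans_le hp.2.1).ne'
      exact (continuousOn_const.mul (Real.continuous_arctan.comp_continuousOn hq)).add
        (Real.continuous_arctan.comp_continuousOn hD.continuousOn)
    refine hcont.congr fun p hp => ?_
    simp only [redAngle, hfx_eq p.1 hp.1 p.2 hp.2, hFdef]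
  · intro t ht x hx hmin
    have htI : t ∈ Ico (0 : ℝ) T := Ioo_subset_Ico_self ht
    have hx0 : x ≠ 0 := (zero_lt_one.trans_le hx.1).ne'
    obtain ⟨p, hp₁, hp₂⟩ := hf.exists_hasDerivWithinAt_mixed hI hJ htI hx (by
      rw [interior_prod_eq, interior_Ico, interior_Icc, closure_prod_eq, closure_Ioo hT.ne,
        closure_Ioo ha.ne]
      exact ⟨Ico_subset_Icc_self htI, hx⟩)
    have hdx : ∀ y ∈ Icc 1 a, HasDerivWithinAt (derivWithin (f t) (Icc 1 a))
        (derivWithin (derivWithin (f t) (Icc 1 a)) (Icc 1 a) y) (Icc 1 a) y := fun y hy =>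
      ((((hD.differentiableOn one_ne_zero (t, y) ⟨htI, hy⟩).hasDerivWithinAt_snd_slice
        htI).congr_of_mem (fun z hz => hfx_eq t htI z hz) hy).differentiableWithinAt
        ).hasDerivWithinAt
    have hΘx : ∀ y ∈ Icc 1 a, HasDerivWithinAt (redAngle n a f t)
        (derivWithin (derivWithin (f t) (Icc 1 a)) (Icc 1 a) y /
          (1 + (derivWithin (f t) (Icc 1 a) y) ^ 2) +
          ((n : ℝ) - 1) * (y * derivWithin (f t) (Icc 1 a) y - f t y) / (y ^ 2 + (f t y) ^ 2))
        (Icc 1 a) y := by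
      intro y hy
      have hy0 : 0 < y := zero_lt_one.trans_le hy.1
      have h := ((((hfx t htI y hy).div (hasDerivWithinAt_id y _) hy0.ne').arctan).const_mul
        ((n : ℝ) - 1)).add (hdx y hy).arctan
      refine h.congr_deriv ?_
      rw [← hfx_eq t htI y hy]
      have h1 : y ^ 2 + f t y ^ 2 ≠ 0 := by positivity
      have h2 : 1 + (derivWithin (f t) (Icc 1 a) y) ^ 2 ≠ 0 := by positivity
      have h3 : 1 + (f t y / y) ^ 2 ≠ 0 := by positivity
      simp only [Pi.div_apply, id]
      field_simp
      ring
    have hflow' : ∀ y ∈ Icc 1 a, fderivWithin ℝ F S (t, y) (1, 0) = flowRHS n a σ f t y :=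
      fun y hy => ((hft t htI y hy).derivWithin (hI t htI)).symm.trans (hflow t htI y hy)
    have hzero : fderivWithin ℝ F S (t, x) (1, 0) = 0 := by
      rw [hflow' x hx, flowRHS]
      by_cases hxi : x ∈ Ioo 1 a
      · have hnhds := Icc_mem_nhds hxi.1 hxi.2
        rw [(hmin.isLocalMin hnhds).hasDerivAt_eq_zero ((hΘx x hx).hasDerivAt hnhds), mul_zero]
      · rcases hx.1.eq_or_lt with rfl | h1
        · rw [hσ1, zero_mul]
        · rw [show x = a from hx.2.antisymm (not_lt.1 fun h => hxi ⟨h1, h⟩), hσa, zero_mul]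
    have hp0 : 0 ≤ p := hmin.deriv_weighted_deriv_nonneg ha hσpos hΘx hflow' hx hzero hp₂
    have hΘt := ((((hft t htI x hx).div_const x).arctan).const_mul ((n : ℝ) - 1)).add
      (hp₁.congr_of_mem (fun s hs => hfx_eq s hs x hx) htI).arctan
    refine ⟨_, ?_, hΘt⟩
    rw [hzero]
    simp only [zero_div, mul_zero, zero_add]
    positivity
end

section
/- Polar subsolution family converging to a stationary solution (Proposition 5.1): Let n ≥ 2 be an integer, a > 1, and 0 < θ_min < θ_max < π/2. Let r_∞ : [θ_min, θ_max] → ℝ be smooth and positive, satisfying the stationary equation 2·r_∞'² − r_∞·r_∞'' + r_∞² + (n−1)·(r_∞'² + r_∞²) = 0, with 1 ≤ r_∞(θ)·cos θ ≤ a, r_∞' ≥ 0, and r_∞'(θ) ≤ 2·r_∞(θ)·tan θ for all θ. Let σ : [1,a] → ℝ be continuous with σ > 0 on (1,a), and assume there exist k > 0 and ε ∈ (0, a−1) with σ(x) ≥ k·(x−1) for x ∈ [1, a−ε], and a constant C₃ > 0 such that for every b ≥ 1 and every θ, writing r_b(θ) for the function defined by 1/r_b² = (1/(1+b))·( b/r_∞²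 + cos²θ/a² ), one has ( r_∞(θ)·r_b(θ)·cos θ − r_b(θ)·a ) / σ( r_b(θ)·cos θ ) ≥ −C₃ whenever r_b(θ)·cos θ ∈ (a−ε, a]. Then there exists a smooth increasing function b : [0,∞) → ℝ with b(t) → ∞ such that r(t,θ) := r_{b(t)}(θ) satisfies, for all t ≥ 0 and all θ ∈ [θ_min, θ_max], the subsolution inequality r·∂_t r + σ(r·cos θ)·( (2(∂_θ r)² − r·∂_θθ r + r²)/((∂_θ r)² + r²) + (n−1) ) ≥ 0, and r(t,·) → r_∞ uniformly as t → ∞. -/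
open Real Set Filter

/-- The interpolation family of polar curves: `r_b(θ)` is defined by
`1/r_b² = (1/(1+b))·( b/r_∞(θ)² + cos²θ/a² )`. -/
noncomputable def interp (rinf : ℝ → ℝ) (a b θ : ℝ) : ℝ :=
  Real.sqrt ((1 + b) / (b / (rinf θ) ^ 2 + (Real.cos θ) ^ 2 / a ^ 2))

/-- The denominator `b / r_∞² + cos² / a²`, whose quotient `(1 + b) / ·` is `r_b²`. -/
noncomputable def interpDenom (rinf : ℝ → ℝ) (a b θ : ℝ) : ℝ :=
  b / (rinf θ) ^ 2 + (Real.cos θ) ^ 2 / a ^ 2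

section Pointwise

variable {rinf : ℝ → ℝ} {a b θ : ℝ}

lemma interpDenom_pos (ha : 0 < a) (hb : 0 < b) (hr : 0 < rinf θ) :
    0 < interpDenom rinf a b θ := by
  unfold interpDenom
  positivity

lemma interp_pos (ha : 0 < a) (hb : 0 < b) (hr : 0 < rinf θ) : 0 < interp rinf a b θ :=
  Real.sqrt_pos.2 (div_pos (by linarith) (interpDenom_pos ha hb hr))

lemma interp_sq_mul_interpDenom (ha : 0 < a) (hb : 0 < b) (hr : 0 < rinf θ) :
    interp rinf a b θ ^ 2 * interpDenom rinf a b θ = 1 + b := by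
  have hW := interpDenom_pos ha hb hr
  have h : interp rinf a b θ ^ 2 = (1 + b) / interpDenom rinf a b θ :=
    Real.sq_sqrt (div_nonneg (by linarith) hW.le)
  rw [h, div_mul_cancel₀ _ hW.ne']

/-- `x = r_b cos θ` satisfies `(1 + b) / x² = b / X² + 1 / a²` with `X = r_∞ cos θ`. -/
lemma interp_mul_cos_relation (ha : 0 < a) (hb : 0 < b) (hr : 0 < rinf θ) :
    (interp rinf a b θ * Real.cos θ) ^ 2 * (b * a ^ 2 + (rinf θ * Real.cos θ) ^ 2) =
      (1 + b) * a ^ 2 * (rinf θ * Real.cos θ) ^ 2 := by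
  have h := interp_sq_mul_interpDenom ha hb hr
  unfold interpDenom at h
  have hr' := hr.ne'
  have ha' := ha.ne'
  field_simp at h
  linear_combination Real.cos θ ^ 2 * h

end Pointwise

section Comparison

variable {a b x X : ℝ}

lemma le_of_interp_relation (hb : 0 < b) (hX : 0 < X) (hXa : X ≤ a) (hx : 0 < x)
    (h : x ^ 2 * (b * a ^ 2 + X ^ 2) = (1 + b) * a ^ 2 * X ^ 2) : X ≤ x ∧ x ≤ a := by
  have ha : 0 < a := hX.trans_le hXa
  have hsq : X ^ 2 ≤ a ^ 2 := by gcongr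
  have hpos : 0 < b * a ^ 2 + X ^ 2 := by positivity
  constructor
  · refine (sq_le_sq₀ hX.le hx.le).1 (le_of_mul_le_mul_right ?_ hpos)
    rw [h]
    nlinarith [mul_nonneg (sq_nonneg X) (sub_nonneg.2 hsq)]
  · refine (sq_le_sq₀ hx.le ha.le).1 (le_of_mul_le_mul_right ?_ hpos)
    rw [h]
    nlinarith [mul_nonneg (mul_nonneg hb.le (sq_nonneg a)) (sub_nonneg.2 hsq)]

lemma eq_of_interp_relation (hb : 0 < b) (hX : 0 < X) (ha : 0 < a) (hx : x = a)
    (h : x ^ 2 * (b * a ^ 2 + X ^ 2) = (1 + b) * a ^ 2 * X ^ 2) : X = a := by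
  subst hx
  have h1 : b * x ^ 2 * (x ^ 2 - X ^ 2) = 0 := by linear_combination h
  have h2 : x ^ 2 - X ^ 2 = 0 := by
    rcases mul_eq_zero.1 h1 with h0 | h0
    · exact absurd h0 (by positivity)
    · exact h0
  exact (pow_left_inj₀ hX.le ha.le two_ne_zero).1 (by linarith)

lemma sub_le_of_interp_relation (hb : 0 < b) (hX : 0 < X) (hXa : X ≤ a) (hx : 1 ≤ x)
    (h : x ^ 2 * (b * a ^ 2 + X ^ 2) = (1 + b) * a ^ 2 * X ^ 2) :
    x - X ≤ a ^ 4 / (1 + b) := by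
  have ha : 0 < a := hX.trans_le hXa
  obtain ⟨hXx, hxa⟩ := le_of_interp_relation hb hX hXa (by linarith) h
  have h1 : (1 + b) * a ^ 2 * (x ^ 2 - X ^ 2) = x ^ 2 * (a ^ 2 - X ^ 2) := by
    linear_combination h
  have h2 : x ^ 2 * (a ^ 2 - X ^ 2) ≤ a ^ 2 * a ^ 2 := by
    have : x ^ 2 ≤ a ^ 2 := by gcongr
    nlinarith [mul_nonneg (sq_nonneg x) (sq_nonneg X), sq_nonneg a]
  have h3 : (1 + b) * (x ^ 2 - X ^ 2) ≤ a ^ 2 := by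
    refine le_of_mul_le_mul_left ?_ (by positivity : 0 < a ^ 2)
    linarith
  have h4 : x - X ≤ x ^ 2 - X ^ 2 := by nlinarith
  have h5 : a ^ 2 ≤ a ^ 4 := pow_le_pow_right₀ (hx.trans hxa) (by norm_num)
  rw [le_div_iff₀ (by linarith)]
  nlinarith

end Comparison

section Elliptic

/-- The elliptic operator `(2 r'² - r r'' + r²) / (r'² + r²) + (n - 1)` in terms of
`W = const · r⁻²`. -/
lemma elliptic_eq {n r r₁ r₂ W W₁ W₂ : ℝ} (hr : 0 < r) (hW : 0 < W)
    (h₁ : r₁ = -(r * W₁) / (2 * W))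
    (h₂ : r₂ = -(r₁ * W₁ + r * W₂) / (2 * W) + r * W₁ ^ 2 / (2 * W ^ 2)) :
    (2 * r₁ ^ 2 - r * r₂ + r ^ 2) / (r₁ ^ 2 + r ^ 2) + (n - 1) =
      (W₂ / 2 + n * W + (n - 2) * (W₁ ^ 2 / (4 * W))) / (W * (1 + W₁ ^ 2 / (4 * W ^ 2))) := by
  have hden : r₁ ^ 2 + r ^ 2 = r ^ 2 * (1 + W₁ ^ 2 / (4 * W ^ 2)) := by
    rw [h₁]; field_simp; ring
  have hnum : 2 * r₁ ^ 2 - r * r₂ + r ^ 2 =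
      r ^ 2 * (1 - W₁ ^ 2 / (4 * W ^ 2) + W₂ / (2 * W)) := by
    rw [h₂, h₁]; field_simp; ring
  have hM : 0 < 1 + W₁ ^ 2 / (4 * W ^ 2) := by positivity
  rw [hden, hnum, mul_div_mul_left _ _ (by positivity : r ^ 2 ≠ 0), eq_div_iff (by positivity),
    add_mul, div_mul_eq_mul_div, mul_comm W, ← mul_assoc, mul_div_right_comm,
    mul_div_cancel_right₀ _ hM.ne']
  field_simp
  ring

/-- Lower bound for the elliptic operator applied to `U + V`, where `U = b / R²` comes from a
stationary solution and `V = c² / a²` from a vertical line. -/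
lemma elliptic_lower_bound {n a b c s R R₁ R₂ T : ℝ} (hn : 2 ≤ n) (ha : 0 < a) (hb : 0 < b)
    (hc : 0 < c) (hs : 0 ≤ s) (hcs : s ^ 2 + c ^ 2 = 1) (hR : 0 < R) (hR₁ : 0 ≤ R₁)
    (hRT : R₁ ≤ 2 * R * (s / c)) (hT : s / c ≤ T)
    (hstat : 2 * R₁ ^ 2 - R * R₂ + R ^ 2 + (n - 1) * (R₁ ^ 2 + R ^ 2) = 0)
    {W W₁ W₂ : ℝ} (hW : W = b / R ^ 2 + c ^ 2 / a ^ 2)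
    (hW₁ : W₁ = -(2 * b * R₁) / R ^ 3 - 2 * c * s / a ^ 2)
    (hW₂ : W₂ = b * (6 * R₁ ^ 2 / R ^ 4 - 2 * R₂ / R ^ 3) - 2 * (c ^ 2 - s ^ 2) / a ^ 2) :
    1 / (a ^ 2 * W * (1 + 4 * T ^ 2)) ≤
      (W₂ / 2 + n * W + (n - 2) * (W₁ ^ 2 / (4 * W))) / (W * (1 + W₁ ^ 2 / (4 * W ^ 2))) := by
  obtain ⟨p, rfl⟩ : ∃ p, R₁ = p * R := ⟨R₁ / R, by field_simp⟩
  obtain ⟨q, rfl⟩ : ∃ q, s = q * c := ⟨s / c, by field_simp⟩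
  obtain ⟨m, rfl⟩ : ∃ m, R₂ = m * R := ⟨R₂ / R, by field_simp⟩
  have hp : 0 ≤ p := nonneg_of_mul_nonneg_left hR₁ hR
  have hq : 0 ≤ q := nonneg_of_mul_nonneg_left hs hc
  rw [mul_div_cancel_right₀ _ hc.ne'] at hRT hT
  have hpq : p ≤ 2 * q := le_of_mul_le_mul_right (by linarith : p * R ≤ 2 * q * R) hR
  have hm : m = (n + 1) * p ^ 2 + n := by
    have : R ^ 2 * (m - ((n + 1) * p ^ 2 + n)) = 0 := by linear_combination -hstat
    rcases mul_eq_zero.1 this with h0 | h0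
    · exact absurd h0 (by positivity)
    · linarith
  obtain ⟨U, hU⟩ : ∃ U, U = b / R ^ 2 := ⟨_, rfl⟩
  obtain ⟨V, hV⟩ : ∃ V, V = c ^ 2 / a ^ 2 := ⟨_, rfl⟩
  have hUpos : 0 < U := by rw [hU]; positivity
  have hVpos : 0 < V := by rw [hV]; positivity
  have hV1 : V * (1 + q ^ 2) = 1 / a ^ 2 := by
    have h1 : V * (1 + q ^ 2) = ((q * c) ^ 2 + c ^ 2) / a ^ 2 := by rw [hV]; ring
    rw [h1, hcs]
  have hWe : W = U + V := by rw [hW, hU, hV]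
  have hW₁e : W₁ = -2 * (p * U + q * V) := by rw [hW₁, hU, hV]; field_simp; ring
  have hW₂e : W₂ = 2 * U * (3 * p ^ 2 - m) - 2 * V * (1 - q ^ 2) := by
    rw [hW₂, hU, hV]; field_simp; ring
  have hWpos : 0 < W := by rw [hWe]; positivity
  have hsq : U * p ^ 2 ≤ W₁ ^ 2 / (4 * W) := by
    rw [le_div_iff₀ (by positivity), hW₁e, hWe]
    have h1 : 0 ≤ U * V * (p * (2 * q - p)) := by
      have := sub_nonneg.2 hpq
      positivity
    nlinarith [sq_nonneg (q * V)]
  have hnum : 1 / a ^ 2 ≤ W₂ / 2 + n * W + (n - 2) * (W₁ ^ 2 / (4 * W)) := by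
    have h1 := mul_le_mul_of_nonneg_left hsq (sub_nonneg.2 hn)
    have h2 : 0 ≤ (n - 2) * V := mul_nonneg (sub_nonneg.2 hn) hVpos.le
    have h3 : W₂ / 2 + n * W + (n - 2) * (U * p ^ 2) = (n - 2) * V + V * (1 + q ^ 2) := by
      rw [hW₂e, hWe, hm]; ring
    rw [← hV1]
    linarith
  have hgrad : W₁ ^ 2 / (4 * W ^ 2) ≤ 4 * T ^ 2 := by
    have h1 : p * U + q * V ≤ 2 * T * W := by
      rw [hWe]
      nlinarith [mul_nonneg hUpos.le (by linarith : 0 ≤ 2 * T - p),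
        mul_nonneg hVpos.le (by linarith : 0 ≤ 2 * T - q)]
    have h2 : (p * U + q * V) ^ 2 ≤ (2 * T * W) ^ 2 := by gcongr
    rw [div_le_iff₀ (by positivity), hW₁e]
    linarith
  have hnum0 := (by positivity : 0 ≤ 1 / a ^ 2).trans hnum
  calc 1 / (a ^ 2 * W * (1 + 4 * T ^ 2)) = 1 / a ^ 2 / (W * (1 + 4 * T ^ 2)) := by
        rw [div_div, mul_assoc]
    _ ≤ _ := by gcongr

end Elliptic

section Derivatives

variable {rinf : ℝ → ℝ} {a b θ : ℝ} {S : Set ℝ}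

lemma hasDerivWithinAt_interpDenom {R₁ : ℝ} (hr : 0 < rinf θ)
    (h : HasDerivWithinAt rinf R₁ S θ) :
    HasDerivWithinAt (interpDenom rinf a b)
      (-(2 * b * R₁) / rinf θ ^ 3 - 2 * Real.cos θ * Real.sin θ / a ^ 2) S θ := by
  have h1 := ((hasDerivWithinAt_const θ S b).div (h.pow 2) (pow_pos hr 2).ne').add
    ((((Real.hasDerivAt_cos θ).hasDerivWithinAt (s := S)).pow 2).div_const (a ^ 2))
  refine h1.congr_deriv ?_
  simp only [Pi.pow_apply]
  field_simp
  ring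

lemma hasDerivWithinAt_interpDenom_deriv {ρ : ℝ → ℝ} {R₂ : ℝ} (hr : 0 < rinf θ)
    (h : HasDerivWithinAt rinf (ρ θ) S θ) (h' : HasDerivWithinAt ρ R₂ S θ) :
    HasDerivWithinAt
      (fun φ => -(2 * b * ρ φ) / rinf φ ^ 3 - 2 * Real.cos φ * Real.sin φ / a ^ 2)
      (b * (6 * ρ θ ^ 2 / rinf θ ^ 4 - 2 * R₂ / rinf θ ^ 3) -
        2 * (Real.cos θ ^ 2 - Real.sin θ ^ 2) / a ^ 2) S θ := by
  have hcos := (Real.hasDerivAt_cos θ).hasDerivWithinAt (s := S)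
  have hsin := (Real.hasDerivAt_sin θ).hasDerivWithinAt (s := S)
  have h1 := (((h'.const_mul (2 * b)).neg).div (h.pow 3) (pow_pos hr 3).ne').sub
    (((hcos.const_mul 2).mul hsin).div_const (a ^ 2))
  refine h1.congr_deriv ?_
  simp only [Pi.pow_apply, Pi.neg_apply]
  field_simp
  ring

lemma hasDerivWithinAt_interp {W₁ : ℝ} (ha : 0 < a) (hb : 0 < b) (hr : 0 < rinf θ)
    (h : HasDerivWithinAt (interpDenom rinf a b) W₁ S θ) :
    HasDerivWithinAt (interp rinf a b)
      (-(interp rinf a b θ * W₁) / (2 * interpDenom rinf a b θ)) S θ := by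
  have hW := interpDenom_pos ha hb hr
  have hp := interp_pos ha hb hr
  have h1 := ((hasDerivWithinAt_const θ S (1 + b)).div h hW.ne').sqrt
    (div_pos (by linarith) hW).ne'
  refine h1.congr_deriv ?_
  change (0 * interpDenom rinf a b θ - (1 + b) * W₁) / interpDenom rinf a b θ ^ 2 /
    (2 * interp rinf a b θ) = _
  have hsq := interp_sq_mul_interpDenom ha hb hr
  field_simp
  linear_combination W₁ * hsq

lemma hasDerivWithinAt_interp_deriv {ω : ℝ → ℝ} {W₂ : ℝ} (ha : 0 < a) (hb : 0 < b)
    (hr : 0 < rinf θ) (h : HasDerivWithinAt (interpDenom rinf a b) (ω θ) S θ)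
    (h' : HasDerivWithinAt ω W₂ S θ) :
    HasDerivWithinAt (fun φ => -(interp rinf a b φ * ω φ) / (2 * interpDenom rinf a b φ))
      (-(-(interp rinf a b θ * ω θ) / (2 * interpDenom rinf a b θ) * ω θ +
          interp rinf a b θ * W₂) / (2 * interpDenom rinf a b θ) +
        interp rinf a b θ * ω θ ^ 2 / (2 * interpDenom rinf a b θ ^ 2)) S θ := by
  have hW := interpDenom_pos ha hb hr
  refine ((((hasDerivWithinAt_interp ha hb hr h).mul h').neg).div (h.const_mul 2)
    (by positivity)).congr_deriv ?_
  simp only [Pi.mul_apply, Pi.neg_apply]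
  field_simp
  ring

/-- The time derivative: `r ∂ₜ r = -(δ / 2) (r² / r_∞² - 1) r² / (1 + b)` for `b = 1 + δ t`. -/
lemma interp_mul_derivWithin_time {δ t : ℝ} (ha : 0 < a) (hδ : 0 ≤ δ) (ht : 0 ≤ t)
    (hr : 0 < rinf θ) :
    interp rinf a (1 + δ * t) θ *
        derivWithin (fun s => interp rinf a (1 + δ * s) θ) (Ici 0) t =
      -(δ / 2) * (interp rinf a (1 + δ * t) θ ^ 2 / rinf θ ^ 2 - 1) *
        (interp rinf a (1 + δ * t) θ ^ 2 / (1 + (1 + δ * t))) := by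
  have hb : 0 < 1 + δ * t := by positivity
  have hW := interpDenom_pos (θ := θ) ha hb hr
  have hp := interp_pos ha hb hr
  have hsq := interp_sq_mul_interpDenom ha hb hr
  have hlin : HasDerivWithinAt (fun s : ℝ => 1 + δ * s) δ (Ici 0) t := by
    simpa using (((hasDerivAt_id t).const_mul δ).const_add 1).hasDerivWithinAt (s := Ici 0)
  have h1 := ((hlin.const_add 1).div
    ((hlin.div_const (rinf θ ^ 2)).add_const (Real.cos θ ^ 2 / a ^ 2)) hW.ne').sqrt
    (div_pos (by linarith) hW).ne'
  have h2 : derivWithin (fun s => interp rinf a (1 + δ * s) θ) (Ici 0) t = _ :=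
    h1.derivWithin (uniqueDiffOn_Ici 0 t ht)
  rw [h2]
  change interp rinf a (1 + δ * t) θ *
    ((δ * interpDenom rinf a (1 + δ * t) θ - (1 + (1 + δ * t)) * (δ / rinf θ ^ 2)) /
      interpDenom rinf a (1 + δ * t) θ ^ 2 / (2 * interp rinf a (1 + δ * t) θ)) = _
  rw [← hsq]
  field_simp
  ring

end Derivatives

/-- The elliptic operator applied to `r_b` is at least `r_b² / (a² (1 + 4 tan² θmax) (1 + b))`. -/
lemma interp_elliptic_lower_bound {n a b θmin θmax θ : ℝ} {rinf : ℝ → ℝ} (hn : 2 ≤ n)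
    (ha : 0 < a) (hb : 0 < b) (hθ0 : 0 < θmin) (hθ1 : θmin < θmax) (hθ2 : θmax < π / 2)
    (hrs : ContDiffOn ℝ (⊤ : ℕ∞) rinf (Icc θmin θmax))
    (hrpos : ∀ θ ∈ Icc θmin θmax, 0 < rinf θ) (hθ : θ ∈ Icc θmin θmax)
    (hstat : 2 * (derivWithin rinf (Icc θmin θmax) θ) ^ 2 -
          rinf θ * derivWithin (derivWithin rinf (Icc θmin θmax)) (Icc θmin θmax) θ +
          (rinf θ) ^ 2 +
          (n - 1) * ((derivWithin rinf (Icc θmin θmax) θ) ^ 2 + (rinf θ) ^ 2) = 0)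
    (hr1 : 0 ≤ derivWithin rinf (Icc θmin θmax) θ)
    (hr2 : derivWithin rinf (Icc θmin θmax) θ ≤ 2 * rinf θ * Real.tan θ) :
    interp rinf a b θ ^ 2 / (a ^ 2 * (1 + 4 * Real.tan θmax ^ 2) * (1 + b)) ≤
      (2 * (derivWithin (interp rinf a b) (Icc θmin θmax) θ) ^ 2 -
          interp rinf a b θ *
            derivWithin (derivWithin (interp rinf a b) (Icc θmin θmax)) (Icc θmin θmax) θ +
          (interp rinf a b θ) ^ 2) /
        ((derivWithin (interp rinf a b) (Icc θmin θmax) θ) ^ 2 + (interp rinf a b θ) ^ 2) +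
        (n - 1) := by
  set I := Icc θmin θmax with hI
  have hu : UniqueDiffOn ℝ I := uniqueDiffOn_Icc hθ1
  have hd : ∀ φ ∈ I, HasDerivWithinAt rinf (derivWithin rinf I φ) I φ := fun φ hφ =>
    ((hrs.differentiableOn (by simp)) φ hφ).hasDerivWithinAt
  have hdd : HasDerivWithinAt (derivWithin rinf I) (derivWithin (derivWithin rinf I) I θ) I θ :=
    ((((contDiffOn_infty.1 hrs 2).derivWithin hu (m := 1) (by norm_num)).differentiableOn
      (by simp)) θ hθ).hasDerivWithinAt
  have hW₁ : ∀ φ ∈ I, HasDerivWithinAt (interpDenom rinf a b) _ I φ := fun φ hφ =>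
    hasDerivWithinAt_interpDenom (hrpos φ hφ) (hd φ hφ)
  have hW₂ := hasDerivWithinAt_interpDenom_deriv (a := a) (b := b) (hrpos θ hθ) (hd θ hθ) hdd
  have hr₁ : ∀ φ ∈ I, HasDerivWithinAt (interp rinf a b) _ I φ := fun φ hφ =>
    hasDerivWithinAt_interp ha hb (hrpos φ hφ) (hW₁ φ hφ)
  have hWpos := interpDenom_pos ha hb (hrpos θ hθ)
  have hpos := interp_pos ha hb (hrpos θ hθ)
  have e₁ : EqOn (derivWithin (interp rinf a b) I) _ I := fun φ hφ =>
    (hr₁ φ hφ).derivWithin (hu φ hφ)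
  have hr₂ := (hasDerivWithinAt_interp_deriv ha hb (hrpos θ hθ) (hW₁ θ hθ) hW₂).congr e₁ (e₁ hθ)
  have hcos : 0 < Real.cos θ := Real.cos_pos_of_mem_Ioo ⟨by linarith [hθ.1, Real.pi_pos],
    by linarith [hθ.2]⟩
  have hsin : 0 ≤ Real.sin θ := Real.sin_nonneg_of_nonneg_of_le_pi (by linarith [hθ.1])
    (by linarith [hθ.2, Real.pi_pos])
  have hT : Real.sin θ / Real.cos θ ≤ Real.tan θmax := by
    rw [← Real.tan_eq_sin_div_cos]
    exact Real.strictMonoOn_tan.monotoneOn ⟨by linarith [hθ.1, Real.pi_pos], by linarith [hθ.2]⟩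
      ⟨by linarith [Real.pi_pos], hθ2⟩ hθ.2
  rw [Real.tan_eq_sin_div_cos] at hr2
  have key := elliptic_lower_bound hn ha hb hcos hsin (Real.sin_sq_add_cos_sq θ) (hrpos θ hθ)
    hr1 hr2 hT hstat rfl rfl rfl
  rw [elliptic_eq hpos hWpos (e₁ hθ) ((hr₂.derivWithin (hu θ hθ)).trans (by rw [e₁ hθ]))]
  refine le_trans (le_of_eq ?_) key
  rw [← interp_sq_mul_interpDenom ha hb (hrpos θ hθ)]
  change _ = 1 / (a ^ 2 * interpDenom rinf a b θ * (1 + 4 * Real.tan θmax ^ 2))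
  field_simp

/-- The diffusion coefficient dominates the speed of the interpolation. -/
lemma speed_le_sigma {a k ε C m x X r s : ℝ} {σ : ℝ → ℝ} (ha : 1 < a) (hm : 0 < m)
    (hmk : m ≤ k) (hmC : m * C ≤ 1) (hε : ε ∈ Ioo 0 (a - 1))
    (hσa : 0 ≤ σ a) (hσpos : ∀ x ∈ Ioo 1 a, 0 < σ x)
    (hσk : ∀ x ∈ Icc 1 (a - ε), k * (x - 1) ≤ σ x)
    (hX : 1 ≤ X) (hXx : X ≤ x) (hxa : x ≤ a) (hr : 1 ≤ r) (hs : s = σ x)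
    (heq : x = a → X = a)
    (hbound : x ∈ Ioc (a - ε) a → -C ≤ r * (X - a) / σ x) :
    m * (x ^ 2 / X ^ 2 - 1) ≤ 2 * a * s := by
  subst hs
  have hX0 : 0 < X := by linarith
  rcases le_or_gt x (a - ε) with hxε | hxε
  · have h1 := hσk x ⟨hX.trans hXx, hxε⟩
    have h2 : x ^ 2 / X ^ 2 ≤ x ^ 2 := div_le_self (sq_nonneg x) (one_le_pow₀ hX)
    calc m * (x ^ 2 / X ^ 2 - 1) ≤ m * (2 * a * (x - 1)) := by
          gcongr
          nlinarith
      _ ≤ k * (2 * a * (x - 1)) := by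
          have : 0 ≤ x - 1 := by linarith
          gcongr
      _ = 2 * a * (k * (x - 1)) := by ring
      _ ≤ 2 * a * σ x := by gcongr
  rcases hxa.eq_or_lt with rfl | hlt
  · rw [heq rfl, div_self (by positivity), sub_self, mul_zero]
    positivity
  · have hσx : 0 < σ x := hσpos x ⟨by linarith [hε.2], hlt⟩
    have h1 := hbound ⟨hxε, hxa⟩
    rw [le_div_iff₀ hσx] at h1
    have h2 : a - X ≤ C * σ x := by nlinarith
    have h3 : x ^ 2 / X ^ 2 - 1 ≤ 2 * a * (a - X) := by
      rw [sub_le_iff_le_add, div_le_iff₀ (by positivity)]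
      have h4 : x ^ 2 ≤ a ^ 2 := pow_le_pow_left₀ (by linarith) hxa 2
      have h5 : a ^ 2 - X ^ 2 ≤ 2 * a * (a - X) := by nlinarith [sq_nonneg (a - X)]
      have h6 : 2 * a * (a - X) ≤ 2 * a * (a - X) * X ^ 2 :=
        le_mul_of_one_le_right (mul_nonneg (by linarith) (by linarith)) (one_le_pow₀ hX)
      linarith
    calc m * (x ^ 2 / X ^ 2 - 1) ≤ m * (2 * a * (C * σ x)) := by
          gcongr
          exact h3.trans (by gcongr)
      _ = m * C * (2 * a * σ x) := by ring
      _ ≤ 2 * a * σ x := mul_le_of_le_one_left (by positivity) hmC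

/-- **Polar subsolution family converging to a stationary solution** (Proposition 5.1).
Given a stationary polar solution `r_∞` with `r_∞' ≥ 0` and `r_∞' ≤ 2 r_∞ tan θ`, and the
stated hypotheses on `σ`, there is a smooth increasing `b : [0,∞) → ℝ` with `b(t) → ∞`
such that `r(t,θ) = r_{b(t)}(θ)` satisfies the subsolution inequality
`r ∂ₜr + σ(r cos θ)·( (2 r_θ² − r r_θθ + r²)/(r_θ² + r²) + (n−1) ) ≥ 0`, and
`r(t,·) → r_∞` uniformly as `t → ∞`. -/
theorem polar_subsolution (n : ℕ) (hn : 2 ≤ n) (a θmin θmax : ℝ) (ha : 1 < a)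
    (hθ0 : 0 < θmin) (hθ1 : θmin < θmax) (hθ2 : θmax < π / 2)
    (rinf : ℝ → ℝ) (hrs : ContDiffOn ℝ (⊤ : ℕ∞) rinf (Icc θmin θmax))
    (hrpos : ∀ θ ∈ Icc θmin θmax, 0 < rinf θ)
    (hstat : ∀ θ ∈ Icc θmin θmax,
      2 * (derivWithin rinf (Icc θmin θmax) θ) ^ 2 -
          rinf θ * derivWithin (derivWithin rinf (Icc θmin θmax)) (Icc θmin θmax) θ +
          (rinf θ) ^ 2 +
          ((n : ℝ) - 1) * ((derivWithin rinf (Icc θmin θmax) θ) ^ 2 + (rinf θ) ^ 2) = 0)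
    (hx : ∀ θ ∈ Icc θmin θmax, rinf θ * Real.cos θ ∈ Icc 1 a)
    (hr1 : ∀ θ ∈ Icc θmin θmax, 0 ≤ derivWithin rinf (Icc θmin θmax) θ)
    (hr2 : ∀ θ ∈ Icc θmin θmax,
      derivWithin rinf (Icc θmin θmax) θ ≤ 2 * rinf θ * Real.tan θ)
    (σ : ℝ → ℝ) (hσc : ContinuousOn σ (Icc 1 a)) (hσpos : ∀ x ∈ Ioo 1 a, 0 < σ x)
    (k ε C₃ : ℝ) (hk : 0 < k) (hε : ε ∈ Ioo 0 (a - 1)) (hC₃ : 0 < C₃)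
    (hσk : ∀ x ∈ Icc 1 (a - ε), k * (x - 1) ≤ σ x)
    (hbound : ∀ b : ℝ, 1 ≤ b → ∀ θ ∈ Icc θmin θmax,
      interp rinf a b θ * Real.cos θ ∈ Ioc (a - ε) a →
      -C₃ ≤ (rinf θ * interp rinf a b θ * Real.cos θ - interp rinf a b θ * a) /
          σ (interp rinf a b θ * Real.cos θ)) :
    ∃ b : ℝ → ℝ, ContDiffOn ℝ (⊤ : ℕ∞) b (Ici 0) ∧ StrictMonoOn b (Ici 0) ∧
      Tendsto b atTop atTop ∧
      (∀ t ∈ Ici (0 : ℝ), ∀ θ ∈ Icc θmin θmax,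
        interp rinf a (b t) θ * derivWithin (fun s => interp rinf a (b s) θ) (Ici 0) t +
          σ (interp rinf a (b t) θ * Real.cos θ) *
            ((2 * (derivWithin (fun φ => interp rinf a (b t) φ) (Icc θmin θmax) θ) ^ 2 -
                interp rinf a (b t) θ *
                  derivWithin (derivWithin (fun φ => interp rinf a (b t) φ) (Icc θmin θmax))
                    (Icc θmin θmax) θ +
                (interp rinf a (b t) θ) ^ 2) /
              ((derivWithin (fun φ => interp rinf a (b t) φ) (Icc θmin θmax) θ) ^ 2 +
                (interp rinf a (b t) θ) ^ 2) +
              ((n : ℝ) - 1)) ≥ 0) ∧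
      TendstoUniformlyOn (fun t θ => interp rinf a (b t) θ) rinf atTop (Icc θmin θmax) := by
  have ha0 : 0 < a := by linarith
  obtain ⟨M, hM⟩ : ∃ M, M = 1 + 4 * Real.tan θmax ^ 2 := ⟨_, rfl⟩
  have hM0 : 0 < M := by rw [hM]; positivity
  obtain ⟨m, hm0, hmk, hmC⟩ : ∃ m, 0 < m ∧ m ≤ k ∧ m * C₃ ≤ 1 :=
    ⟨min k (1 / C₃), lt_min hk (by positivity), min_le_left _ _,
      (le_div_iff₀ hC₃).1 (min_le_right _ _)⟩
  obtain ⟨δ, hδ⟩ : ∃ δ, δ = m / (a ^ 3 * M) := ⟨_, rfl⟩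
  have hδ0 : 0 < δ := by rw [hδ]; positivity
  have hcos : ∀ θ ∈ Icc θmin θmax, 0 < Real.cos θ := fun θ hθ =>
    Real.cos_pos_of_mem_Ioo ⟨by linarith [hθ.1, Real.pi_pos], by linarith [hθ.2]⟩
  have hrange : ∀ b, 0 < b → ∀ θ ∈ Icc θmin θmax,
      rinf θ * Real.cos θ ≤ interp rinf a b θ * Real.cos θ ∧
        interp rinf a b θ * Real.cos θ ≤ a := fun b hb θ hθ =>
    le_of_interp_relation hb (by linarith [(hx θ hθ).1]) (hx θ hθ).2
      (mul_pos (interp_pos ha0 hb (hrpos θ hθ)) (hcos θ hθ))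
      (interp_mul_cos_relation ha0 hb (hrpos θ hθ))
  have hσcl : ∀ x ∈ Icc 1 a, 0 ≤ σ x := by
    intro x hxI
    have hcl : closure (Ioo 1 a) = Icc 1 a := closure_Ioo ha.ne
    exact ContinuousWithinAt.closure_le (s := Ioo 1 a) (f := fun _ => (0 : ℝ)) (hcl ▸ hxI)
      continuousWithinAt_const ((hσc x hxI).mono Ioo_subset_Icc_self)
      fun y hy => (hσpos y hy).le
  have htend : Tendsto (fun t : ℝ => 1 + δ * t) atTop atTop :=
    tendsto_atTop_add_const_left _ _ (tendsto_id.const_mul_atTop hδ0)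
  refine ⟨fun t => 1 + δ * t, by fun_prop, ?_, htend, ?_, ?_⟩
  · intro s _ t _ hst
    have := mul_lt_mul_of_pos_left hst hδ0
    simpa using this
  · intro t ht θ hθ
    have ht0 : 0 ≤ t := ht
    have hδt : 0 ≤ δ * t := by positivity
    have hb : 0 < 1 + δ * t := by positivity
    have hr := hrpos θ hθ
    have hc := hcos θ hθ
    obtain ⟨hXx, hxa⟩ := hrange _ hb θ hθ
    have hX1 := (hx θ hθ).1
    have hr1' : 1 ≤ interp rinf a (1 + δ * t) θ :=
      (hX1.trans hXx).trans
        (mul_le_of_le_one_right (interp_pos ha0 hb hr).le (Real.cos_le_one θ))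
    have hQ := interp_elliptic_lower_bound (n := n) (by exact_mod_cast hn) ha0 hb hθ0 hθ1 hθ2
      hrs hrpos hθ (hstat θ hθ) (hr1 θ hθ) (hr2 θ hθ)
    have hS := speed_le_sigma ha hm0 hmk hmC hε (hσcl a ⟨ha.le, le_rfl⟩) hσpos hσk hX1 hXx hxa
      hr1' rfl
      (fun h => eq_of_interp_relation hb (by linarith) ha0 h
        (interp_mul_cos_relation ha0 hb hr))
      (fun h => (hbound _ (by linarith) θ hθ h).trans_eq (by congr 1; ring))
    rw [mul_pow, mul_pow, mul_div_mul_right _ _ (by positivity)] at hS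
    have hT := interp_mul_derivWithin_time (θ := θ) ha0 hδ0.le ht0 hr
    have hσ0 := hσcl _ ⟨hX1.trans hXx, hxa⟩
    refine (add_le_add hT.ge (mul_le_mul_of_nonneg_left hQ hσ0)).trans' ?_
    rw [← hM]
    have hid : -(δ / 2) * (interp rinf a (1 + δ * t) θ ^ 2 / rinf θ ^ 2 - 1) *
          (interp rinf a (1 + δ * t) θ ^ 2 / (1 + (1 + δ * t))) +
        σ (interp rinf a (1 + δ * t) θ * Real.cos θ) *
          (interp rinf a (1 + δ * t) θ ^ 2 / (a ^ 2 * M * (1 + (1 + δ * t)))) =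
        (interp rinf a (1 + δ * t) θ ^ 2 / (1 + (1 + δ * t))) / (2 * a ^ 3 * M) *
          (2 * a * σ (interp rinf a (1 + δ * t) θ * Real.cos θ) -
            m * (interp rinf a (1 + δ * t) θ ^ 2 / rinf θ ^ 2 - 1)) := by
      have hm : m = δ * (a ^ 3 * M) := by rw [hδ]; field_simp
      rw [hm]
      field_simp
      ring
    rw [hid]
    exact mul_nonneg (by positivity) (sub_nonneg.2 hS)
  · have hcm : 0 < Real.cos θmax := hcos θmax ⟨hθ1.le, le_rfl⟩
    rw [Metric.tendstoUniformlyOn_iff]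
    intro η hη
    have hlim : Tendsto (fun t : ℝ => a ^ 4 / (1 + (1 + δ * t))) atTop (nhds 0) :=
      (tendsto_atTop_add_const_left _ 1 htend).const_div_atTop _
    filter_upwards [hlim.eventually (gt_mem_nhds (mul_pos hη hcm)), eventually_ge_atTop 0]
      with t ht ht0 θ hθ
    have hb : 0 < 1 + δ * t := by positivity
    obtain ⟨hXx, hxa⟩ := hrange _ hb θ hθ
    have hX1 := (hx θ hθ).1
    have hsub := sub_le_of_interp_relation hb (by linarith) (hx θ hθ).2 (hX1.trans hXx)
      (interp_mul_cos_relation ha0 hb (hrpos θ hθ))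
    have hle : rinf θ ≤ interp rinf a (1 + δ * t) θ := le_of_mul_le_mul_right hXx (hcos θ hθ)
    have hcc : Real.cos θmax ≤ Real.cos θ :=
      Real.cos_le_cos_of_nonneg_of_le_pi (by linarith [hθ.1]) (by linarith [Real.pi_pos]) hθ.2
    rw [dist_comm, Real.dist_eq, abs_of_nonneg (sub_nonneg.2 hle)]
    refine lt_of_mul_lt_mul_right ?_ hcm.le
    calc (interp rinf a (1 + δ * t) θ - rinf θ) * Real.cos θmax
        ≤ (interp rinf a (1 + δ * t) θ - rinf θ) * Real.cos θ :=
          mul_le_mul_of_nonneg_left hcc (sub_nonneg.2 hle)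
      _ ≤ a ^ 4 / (1 + (1 + δ * t)) := by linarith
      _ < η * Real.cos θmax := ht
end

section
/- Curvature inequality for the interpolated polar curves (core of Proposition 5.1): Let n ≥ 2 be an integer, a > 0, b > 0, and θ in an interval contained in (0, π/2). Let r_∞ be a smooth positive function of θ satisfying the stationary equation 2·r_∞'² − r_∞·r_∞'' + r_∞² + (n−1)·(r_∞'² + r_∞²) = 0, together with r_∞' ≥ 0 and r_∞'(θ) ≤ 2·r_∞(θ)·tan θ. Define r = r(θ) > 0 by 1/r² = (1/(1+b))·( b/r_∞(θ)² + cos²θ/a² ). Then at every θ, 2·r'² − r·r'' + r² + (n−1)·(r'² + r²) ≥ 0, where ' denotes d/dθ. -/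
open Real Set

/-- If `r = √(K / U)`, then `r' = -r U' / (2U)`. -/
theorem hasDerivAt_sqrt_const_div {K x U' : ℝ} {U : ℝ → ℝ} (hK : 0 < K) (hU : 0 < U x)
    (h : HasDerivAt U U' x) :
    HasDerivAt (fun t => √(K / U t)) (-(√(K / U x) * U') / (2 * U x)) x := by
  have hpos : 0 < K / U x := div_pos hK hU
  have hs : 0 < √(K / U x) := Real.sqrt_pos.2 hpos
  have hsq : √(K / U x) ^ 2 * U x = K := by
    rw [Real.sq_sqrt hpos.le]; field_simp
  refine (((hasDerivAt_const x K).fun_div h hU.ne').sqrt hpos.ne').congr_deriv ?_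
  generalize √(K / U x) = s at hs hsq ⊢
  subst hsq
  field_simp
  ring

/-- In terms of `U = K / r²`, the polar curvature expression is
`r² / (4U²)` times `(m - 1) U'² + 2 U U'' + 4 (1 + m) U²`. -/
theorem polar_curvature_sqrt_const_div {K x U'' m : ℝ} {U U' : ℝ → ℝ} (hK : 0 < K)
    (hpos : ∀ᶠ t in nhds x, 0 < U t) (h : ∀ᶠ t in nhds x, HasDerivAt U (U' t) t)
    (h' : HasDerivAt U' U'' x) (r : ℝ → ℝ) (hr : r = fun t => √(K / U t)) :
    2 * deriv r x ^ 2 - r x * deriv (deriv r) x + r x ^ 2 + m * (deriv r x ^ 2 + r x ^ 2) =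
      r x ^ 2 / (4 * U x ^ 2) *
        ((m - 1) * U' x ^ 2 + 2 * U x * U'' + 4 * (1 + m) * U x ^ 2) := by
  have hd : ∀ᶠ t in nhds x, HasDerivAt r (-(r t * U' t) / (2 * U t)) t := by
    filter_upwards [hpos, h] with t ht h_t
    rw [hr]
    exact hasDerivAt_sqrt_const_div hK ht h_t
  have hUx := hpos.self_of_nhds
  have hdx := hd.self_of_nhds
  have hd2 : deriv r =ᶠ[nhds x] fun t => -(r t * U' t) / (2 * U t) :=
    hd.mono fun t ht => ht.deriv
  have hdd := ((hdx.mul h').neg.div (h.self_of_nhds.const_mul 2) (by positivity)).deriv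
  have hdd' : deriv (deriv r) x = _ := hd2.deriv_eq.trans hdd
  rw [hdd', hdx.deriv]
  simp only [Pi.neg_apply, Pi.mul_apply]
  field_simp
  ring

/-- The curvature form at the interpolant `U = b v + w cos²`, with `p = r' / r` and `q = r'' / r`
for the stationary solution `v = 1 / r²`. -/
theorem interp_form_nonneg {m p q v w b s c : ℝ} (hm : 1 ≤ m) (hp : 0 ≤ p)
    (hv : 0 ≤ v) (hw : 0 ≤ w) (hb : 0 ≤ b) (hc : 0 ≤ c) (hpc : p * c ≤ 2 * s)
    (hsc : s ^ 2 + c ^ 2 = 1) (hq : q = 2 * p ^ 2 + 1 + m * (p ^ 2 + 1)) :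
    0 ≤ (m - 1) * (b * v * (-2 * p) - 2 * w * s * c) ^ 2 +
      2 * (b * v + w * c ^ 2) *
        (b * v * (6 * p ^ 2 - 2 * q) - 2 * w * (c ^ 2 - s ^ 2)) +
      4 * (1 + m) * (b * v + w * c ^ 2) ^ 2 := by
  have key : 0 ≤ 4 * m * w ^ 2 * c ^ 2 * (s ^ 2 + c ^ 2) +
      b * v * w * (4 * (m - 1) * (p * c) * (2 * s - p * c) + 4 * s ^ 2 + 4 * m * c ^ 2) := by
    have h1 : 0 ≤ m - 1 := by linarith
    have h2 : 0 ≤ 2 * s - p * c := by linarith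
    have h3 : 0 ≤ m := by linarith
    positivity
  convert key using 1
  subst hq
  ring

/-- **Curvature inequality for the interpolated polar curves** (core of Proposition 5.1).
If `r_∞` is a positive smooth solution of the stationary equation on an interval
`I ⊆ (0, π/2)` with `r_∞' ≥ 0` and `r_∞' ≤ 2 r_∞ tan θ`, then the interpolant `r = r_b`
satisfies `2 r'² − r r'' + r² + (n−1)(r'² + r²) ≥ 0` at every `θ ∈ I`. -/
theorem interp_curvature_inequality (n : ℕ) (hn : 2 ≤ n) (a b : ℝ) (ha : 0 < a)
    (hb : 0 < b) (I : Set ℝ) (hIopen : IsOpen I) (hIconn : I.OrdConnected)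
    (hIsub : I ⊆ Ioo 0 (π / 2))
    (rinf : ℝ → ℝ) (hrs : ContDiffOn ℝ (⊤ : ℕ∞) rinf I)
    (hrpos : ∀ θ ∈ I, 0 < rinf θ)
    (hstat : ∀ θ ∈ I,
      2 * (deriv rinf θ) ^ 2 - rinf θ * deriv (deriv rinf) θ + (rinf θ) ^ 2 +
        ((n : ℝ) - 1) * ((deriv rinf θ) ^ 2 + (rinf θ) ^ 2) = 0)
    (hr1 : ∀ θ ∈ I, 0 ≤ deriv rinf θ)
    (hr2 : ∀ θ ∈ I, deriv rinf θ ≤ 2 * rinf θ * Real.tan θ) :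
    ∀ θ ∈ I,
      0 ≤ 2 * (deriv (interp rinf a b) θ) ^ 2 -
            interp rinf a b θ * deriv (deriv (interp rinf a b)) θ +
            (interp rinf a b θ) ^ 2 +
            ((n : ℝ) - 1) * ((deriv (interp rinf a b) θ) ^ 2 + (interp rinf a b θ) ^ 2) := by
  intro θ hθ
  have hcos : ∀ t ∈ I, 0 < Real.cos t := fun t ht =>
    Real.cos_pos_of_mem_Ioo ⟨by linarith [(hIsub ht).1, Real.pi_pos], (hIsub ht).2⟩
  have hnhds : ∀ᶠ t in nhds θ, t ∈ I := hIopen.mem_nhds hθ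
  have hR : ∀ t ∈ I, HasDerivAt rinf (deriv rinf t) t := fun t ht =>
    ((hrs.differentiableOn (by simp)).differentiableAt (hIopen.mem_nhds ht)).hasDerivAt
  have hR' : HasDerivAt (deriv rinf) (deriv (deriv rinf) θ) θ :=
    (((hrs.deriv_of_isOpen (m := 1) hIopen (by norm_cast)).differentiableOn
      (by simp)).differentiableAt (hIopen.mem_nhds hθ)).hasDerivAt
  have hRθ := hrpos θ hθ
  have hU : ∀ᶠ t in nhds θ,
      HasDerivAt (fun t => b / rinf t ^ 2 + Real.cos t ^ 2 / a ^ 2)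
        (b * (-2 * deriv rinf t / rinf t ^ 3) - 2 * Real.sin t * Real.cos t / a ^ 2) t := by
    filter_upwards [hnhds] with t ht
    have hRt := hrpos t ht
    refine (((hasDerivAt_const t b).fun_div ((hR t ht).fun_pow 2) (by positivity)).add
      (((Real.hasDerivAt_cos t).fun_pow 2).div_const (a ^ 2))).congr_deriv ?_
    field_simp
    ring
  have hU' : HasDerivAt
      (fun t => b * (-2 * deriv rinf t / rinf t ^ 3) - 2 * Real.sin t * Real.cos t / a ^ 2)
      (b * (1 / rinf θ ^ 2) * (6 * (deriv rinf θ / rinf θ) ^ 2 -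
        2 * (deriv (deriv rinf) θ / rinf θ)) -
        2 * (1 / a ^ 2) * (Real.cos θ ^ 2 - Real.sin θ ^ 2)) θ := by
    refine ((((hR'.const_mul (-2)).fun_div ((hR θ hθ).fun_pow 3) (by positivity)).const_mul b).sub
      ((((Real.hasDerivAt_sin θ).const_mul 2).fun_mul (Real.hasDerivAt_cos θ)).div_const
        (a ^ 2))).congr_deriv ?_
    field_simp
    ring
  have hpos : ∀ᶠ t in nhds θ, 0 < b / rinf t ^ 2 + Real.cos t ^ 2 / a ^ 2 := by
    filter_upwards [hnhds] with t ht
    have hRt := hrpos t ht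
    positivity
  have hn' : (1 : ℝ) ≤ n - 1 := by
    have : (2 : ℝ) ≤ n := by exact_mod_cast hn
    linarith
  have hcθ := hcos θ hθ
  have hpc : deriv rinf θ / rinf θ * Real.cos θ ≤ 2 * Real.sin θ := by
    have h := mul_le_mul_of_nonneg_right (hr2 θ hθ) hcθ.le
    rw [mul_assoc, Real.tan_mul_cos hcθ.ne'] at h
    rw [div_mul_eq_mul_div, div_le_iff₀ hRθ]
    linarith
  have hq : deriv (deriv rinf) θ / rinf θ = 2 * (deriv rinf θ / rinf θ) ^ 2 + 1 +
      ((n : ℝ) - 1) * ((deriv rinf θ / rinf θ) ^ 2 + 1) := by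
    have h := hstat θ hθ
    field_simp
    linarith
  have hform := interp_form_nonneg (v := 1 / rinf θ ^ 2) (w := 1 / a ^ 2) hn'
    (div_nonneg (hr1 θ hθ) hRθ.le) (by positivity) (by positivity) hb.le hcθ.le hpc
    (Real.sin_sq_add_cos_sq θ) hq
  rw [polar_curvature_sqrt_const_div (by linarith : 0 < 1 + b) hpos hU hU'
    (interp rinf a b) rfl]
  refine mul_nonneg (by positivity) ?_
  refine hform.trans_eq ?_
  ring
end

section
/- Level curves of Im(e^{−i θ̂} zⁿ) are stationary: Let n ≥ 1 be an integer, c > 0, θ̂ ∈ ℝ, and let I be an open interval of angles θ on which sin(nθ − θ̂) > 0. Then the function r(θ) := ( c / sin(nθ − θ̂) )^{1/n} satisfies the stationary equation 2·r'² − r·r'' + r² + (n−1)·(r'² + r²) = 0 on I; equivalently, (2r'² − r r'' + r²)/(r'² + r²) + (n−1) = 0. Equivalently, the polar curve θ ↦ (r(θ) cos θ, r(θ) sin θ), which parametrizes a level set { Im(e^{−i θ̂} zⁿ) = c } of the harmonic polynomial Im(e^{−i θ̂} zⁿ), is a stationary solution of the reduced curve flow. -/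
open Real Set

/-- The polar radius function of a level set `{ Im(e^{−i θ̂} zⁿ) = c }`:
`r(θ) = ( c / sin(nθ − θ̂) )^{1/n}`. -/
noncomputable def levelCurve (n : ℕ) (c θhat θ : ℝ) : ℝ :=
  (c / Real.sin ((n : ℝ) * θ - θhat)) ^ ((1 : ℝ) / (n : ℝ))

/-- The polar radius of a level curve has derivative `-r cot(nθ − θ̂)`. -/
theorem hasDerivAt_levelCurve {n : ℕ} (hn : 1 ≤ n) {c θhat θ : ℝ} (hc : 0 < c)
    (hs : 0 < Real.sin ((n : ℝ) * θ - θhat)) :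
    HasDerivAt (levelCurve n c θhat)
      (-(levelCurve n c θhat θ *
        (Real.cos ((n : ℝ) * θ - θhat) / Real.sin ((n : ℝ) * θ - θhat)))) θ := by
  have hn0 : (n : ℝ) ≠ 0 := by positivity
  have hφ : HasDerivAt (fun t : ℝ => (n : ℝ) * t - θhat) n θ := by
    simpa using ((hasDerivAt_id θ).const_mul (n : ℝ)).sub_const θhat
  have hq : 0 < c / Real.sin ((n : ℝ) * θ - θhat) := div_pos hc hs
  have h := ((hasDerivAt_const θ c).div hφ.sin hs.ne').rpow_const
    (p := (1 : ℝ) / (n : ℝ)) (Or.inl hq.ne')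
  refine h.congr_deriv ?_
  simp only [levelCurve, Pi.div_apply]
  rw [Real.rpow_sub_one hq.ne']
  field_simp
  ring

/-- **Level curves of `Im(e^{−i θ̂} zⁿ)` are stationary.**  On an open interval where
`sin(nθ − θ̂) > 0`, the polar curve `r(θ) = (c / sin(nθ − θ̂))^{1/n}` satisfies the
stationary equation `2 r'² − r r'' + r² + (n−1)(r'² + r²) = 0`. -/
theorem level_curves_stationary (n : ℕ) (hn : 1 ≤ n) (c θhat : ℝ) (hc : 0 < c)
    (I : Set ℝ) (hIopen : IsOpen I) (hIconn : I.OrdConnected)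
    (hsin : ∀ θ ∈ I, 0 < Real.sin ((n : ℝ) * θ - θhat)) :
    ∀ θ ∈ I,
      2 * (deriv (levelCurve n c θhat) θ) ^ 2 -
          levelCurve n c θhat θ * deriv (deriv (levelCurve n c θhat)) θ +
          (levelCurve n c θhat θ) ^ 2 +
          ((n : ℝ) - 1) *
            ((deriv (levelCurve n c θhat) θ) ^ 2 + (levelCurve n c θhat θ) ^ 2) = 0 := by
  intro θ hθ
  have hs := hsin θ hθ
  have hr := hasDerivAt_levelCurve hn hc hs
  have hφ : HasDerivAt (fun t : ℝ => (n : ℝ) * t - θhat) n θ := by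
    simpa using ((hasDerivAt_id θ).const_mul (n : ℝ)).sub_const θhat
  have hderiv : deriv (levelCurve n c θhat) =ᶠ[nhds θ] fun t =>
      -(levelCurve n c θhat t *
        (Real.cos ((n : ℝ) * t - θhat) / Real.sin ((n : ℝ) * t - θhat))) := by
    filter_upwards [hIopen.mem_nhds hθ] with t ht
    exact (hasDerivAt_levelCurve hn hc (hsin t ht)).deriv
  have hr' := (hr.mul (hφ.cos.div hφ.sin hs.ne')).neg
  have hr'' := (hr'.congr_of_eventuallyEq hderiv).deriv
  rw [hr'', hr.deriv]
  simp only [Pi.div_apply]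
  generalize Real.sin ((n : ℝ) * θ - θhat) = s at *
  generalize Real.cos ((n : ℝ) * θ - θhat) = k at *
  generalize levelCurve n c θhat θ = r at *
  have hs0 : s ≠ 0 := hs.ne'
  field_simp
  ring
end

section
/- Strict local minimum of the x-coordinate at a vertical tangency (core of Lemma 5.2): Let n ≥ 2 be an integer and let r be a smooth positive function defined near θ₀ ∈ (0, π/2) satisfying the stationary equation 2·r'² − r·r'' + r² + (n−1)·(r'² + r²) = 0. Suppose r'(θ₀) = r(θ₀)·tan θ₀ (equivalently, the polar curve θ ↦ (r cos θ, r sin θ) has a vertical tangent at θ₀). Then the function x(θ) := r(θ)·cos θ satisfies x'(θ₀) = 0 and x''(θ₀) > 0; in particular x has a strict local minimum at θ₀. -/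
open Real Set

open Filter Topology in
/-- The second-derivative test with a strict conclusion. -/
theorem eventually_lt_of_deriv_deriv_pos {f : ℝ → ℝ} {a : ℝ} (hf : 0 < deriv (deriv f) a)
    (hd : deriv f a = 0) (hc : ContinuousAt f a) : ∀ᶠ x in 𝓝[≠] a, f a < f x := by
  have hsign := nhdsWithin_le_nhds (s := {a}ᶜ)
    (eventually_nhdsWithin_sign_eq_of_deriv_pos hf hd)
  have hleft := deriv_neg_left_of_sign_deriv hsign
  have hright := deriv_pos_right_of_sign_deriv hsign
  obtain ⟨l, hl, hneg⟩ := (mem_nhdsLT_iff_exists_Ioo_subset).1 hleft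
  obtain ⟨u, hu, hpos⟩ := (mem_nhdsGT_iff_exists_Ioo_subset).1 hright
  rw [← nhdsLT_sup_nhdsGT, eventually_sup]
  constructor
  · have hanti : StrictAntiOn f (Ioc l a) := by
      refine strictAntiOn_of_deriv_neg (convex_Ioc l a) (fun x hx => ?_) (fun x hx => ?_)
      · rcases hx.2.eq_or_lt with rfl | hxa
        · exact hc.continuousWithinAt
        · exact (differentiableAt_of_deriv_ne_zero
            (ne_of_lt (hneg ⟨hx.1, hxa⟩))).continuousAt.continuousWithinAt
      · rw [interior_Ioc] at hx
        exact hneg hx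
    filter_upwards [Ioo_mem_nhdsLT hl] with x hx
    exact hanti ⟨hx.1, hx.2.le⟩ ⟨hl, le_rfl⟩ hx.2
  · have hmono : StrictMonoOn f (Ico a u) := by
      refine strictMonoOn_of_deriv_pos (convex_Ico a u) (fun x hx => ?_) (fun x hx => ?_)
      · rcases hx.1.eq_or_lt with rfl | hax
        · exact hc.continuousWithinAt
        · exact (differentiableAt_of_deriv_ne_zero
            (ne_of_gt (hpos ⟨hax, hx.2⟩))).continuousAt.continuousWithinAt
      · rw [interior_Ico] at hx
        exact hpos hx
    filter_upwards [Ioo_mem_nhdsGT hu] with x hx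
    exact hmono ⟨le_rfl, hu⟩ ⟨hx.1.le, hx.2⟩ hx.1

/-- **Strict local minimum of the x-coordinate at a vertical tangency** (core of Lemma 5.2).
If a smooth positive `r` satisfies the stationary equation near `θ₀ ∈ (0, π/2)` and the
polar curve has a vertical tangent at `θ₀` (i.e. `r'(θ₀) = r(θ₀) tan θ₀`), then
`x(θ) = r(θ) cos θ` has `x'(θ₀) = 0`, `x''(θ₀) > 0`, and a strict local minimum at `θ₀`. -/
theorem vertical_tangency_strict_min (n : ℕ) (hn : 2 ≤ n) (θ₀ : ℝ)
    (hθ : θ₀ ∈ Ioo 0 (π / 2)) (U : Set ℝ) (hU : IsOpen U) (hθU : θ₀ ∈ U)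
    (r : ℝ → ℝ) (hr : ContDiffOn ℝ (⊤ : ℕ∞) r U) (hrpos : ∀ θ ∈ U, 0 < r θ)
    (hstat : ∀ θ ∈ U,
      2 * (deriv r θ) ^ 2 - r θ * deriv (deriv r) θ + (r θ) ^ 2 +
        ((n : ℝ) - 1) * ((deriv r θ) ^ 2 + (r θ) ^ 2) = 0)
    (hvert : deriv r θ₀ = r θ₀ * Real.tan θ₀) :
    deriv (fun θ => r θ * Real.cos θ) θ₀ = 0 ∧
    0 < deriv (deriv (fun θ => r θ * Real.cos θ)) θ₀ ∧
    ∃ δ > 0, ∀ θ : ℝ, |θ - θ₀| < δ → θ ≠ θ₀ →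
      r θ₀ * Real.cos θ₀ < r θ * Real.cos θ := by
  have hcos : 0 < Real.cos θ₀ := Real.cos_pos_of_mem_Ioo ⟨by linarith [hθ.1, Real.pi_pos], hθ.2⟩
  have hr₀ := hrpos θ₀ hθU
  obtain ⟨hdr, hr'⟩ := (contDiffOn_infty_iff_deriv_of_isOpen hU).1 hr
  have hdr' := ((contDiffOn_infty_iff_deriv_of_isOpen hU).1 hr').1
  have hx : ∀ θ ∈ U, HasDerivAt (fun θ => r θ * Real.cos θ)
      (deriv r θ * Real.cos θ + r θ * -Real.sin θ) θ := fun θ h =>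
    (hdr.differentiableAt (hU.mem_nhds h)).hasDerivAt.mul (Real.hasDerivAt_cos θ)
  have hx₂ : deriv (deriv (fun θ => r θ * Real.cos θ)) θ₀ =
      deriv (deriv r) θ₀ * Real.cos θ₀ + deriv r θ₀ * -Real.sin θ₀ +
        (deriv r θ₀ * -Real.sin θ₀ + r θ₀ * -Real.cos θ₀) := by
    have heq : deriv (fun θ => r θ * Real.cos θ) =ᶠ[nhds θ₀]
        fun θ => deriv r θ * Real.cos θ + r θ * -Real.sin θ :=
      Filter.eventually_of_mem (hU.mem_nhds hθU) fun θ h => (hx θ h).deriv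
    rw [heq.deriv_eq]
    exact (((hdr'.differentiableAt (hU.mem_nhds hθU)).hasDerivAt.mul
      (Real.hasDerivAt_cos θ₀)).add ((hdr.differentiableAt (hU.mem_nhds hθU)).hasDerivAt.mul
      (Real.hasDerivAt_sin θ₀).neg)).deriv
  have htan : deriv r θ₀ * Real.cos θ₀ = r θ₀ * Real.sin θ₀ := by
    rw [hvert, mul_assoc, Real.tan_mul_cos hcos.ne']
  have hx₁ : deriv (fun θ => r θ * Real.cos θ) θ₀ = 0 := by
    rw [(hx θ₀ hθU).deriv]
    linarith
  have hpos : 0 < deriv (deriv (fun θ => r θ * Real.cos θ)) θ₀ := by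
    have hn' : (0 : ℝ) < n - 1 := by
      have : (2 : ℝ) ≤ n := by exact_mod_cast hn
      linarith
    refine pos_of_mul_pos_right (a := r θ₀) ?_ hr₀.le
    have key : r θ₀ * deriv (deriv (fun θ => r θ * Real.cos θ)) θ₀ =
        Real.cos θ₀ * (((n : ℝ) - 1) * ((deriv r θ₀) ^ 2 + (r θ₀) ^ 2)) := by
      rw [hx₂]
      linear_combination (-Real.cos θ₀) * hstat θ₀ hθU + 2 * deriv r θ₀ * htan
    rw [key]
    positivity
  refine ⟨hx₁, hpos, ?_⟩
  have hlt := eventually_lt_of_deriv_deriv_pos hpos hx₁ (hx θ₀ hθU).continuousAt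
  obtain ⟨δ, hδ, h⟩ := Metric.eventually_nhds_iff.1 (eventually_nhdsWithin_iff.1 hlt)
  exact ⟨δ, hδ, fun θ hd hne => h (by rwa [Real.dist_eq]) hne⟩
end
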